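/- Let K be a field of characteristic 0 with finite maximal abelian subextension of conductor f, let λ be the number of roots of unity in K, and define f' := Π_{p | λ} p^{v_p(f)} if 4 | f, and f' := 4·Π_{p | λ} p^{v_p(f)} if f is odd. Then the Chevalley-Bass number Λ of K satisfies lcm(4, λ, f'/λ) | Λ and Λ | f'. -/

import Mathlib

noncomputable section

/-- The maximal abelian subextension of `K/ℚ`: the compositum of all subextensions of `K/ℚ`
which are Galois over `ℚ` with abelian Galois group. -/
def maxAb (K : Type*) [Field K] [CharZero K] : IntermediateField ℚ K :=
  ⨆ F ∈ {F : IntermediateField ℚ K |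
      IsGalois ℚ ↥F ∧ ∀ σ τ : ↥F ≃ₐ[ℚ] ↥F, σ * τ = τ * σ}, F

/-- The set of positive integers `Λ` satisfying the Chevalley–Bass property for the field `F`:
for every `n > 0`, `(F(ζ_{Λn})ˣ)^{Λn} ∩ Fˣ ⊆ (Fˣ)ⁿ`, where `F(ζ_{Λn})` is the field obtained
by adjoining all `Λn`-th roots of unity inside the algebraically closed extension `Ω`. -/
def cbSet (F Ω : Type*) [Field F] [Field Ω] [Algebra F Ω] : Set ℕ :=
  {Λ | 0 < Λ ∧ ∀ n : ℕ, 0 < n → ∀ x : F, x ≠ 0 →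
    (∃ y ∈ IntermediateField.adjoin F {z : Ω | z ^ (Λ * n) = 1},
        y ^ (Λ * n) = algebraMap F Ω x) →
    ∃ z : F, z ^ n = x}

/-- The Chevalley–Bass number of a field `F` (computed inside an algebraic closure `Ω`):
the smallest positive integer in `cbSet F Ω`. -/
def chevalleyBass (F Ω : Type*) [Field F] [Field Ω] [Algebra F Ω] : ℕ :=
  sInf (cbSet F Ω)

/-- The number of roots of unity contained in a field `F`. -/
def numRootsOfUnity (F : Type*) [Field F] : ℕ :=
  Nat.card (CommGroup.torsion Fˣ)

/-- The conductor of the maximal abelian subextension of `K/ℚ`: the smallest positive `f`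
such that `K_ab ⊆ ℚ(ζ_f)` inside the algebraic closure `Ω`. -/
def conductorAb (K Ω : Type*) [Field K] [CharZero K] [Field Ω] [Algebra K Ω]
    [Algebra ℚ Ω] [IsScalarTower ℚ K Ω] : ℕ :=
  sInf {f | 0 < f ∧ (maxAb K).map (IsScalarTower.toAlgHom ℚ K Ω)
    ≤ IntermediateField.adjoin ℚ {z : Ω | z ^ f = 1}}

end

section Ramification

open WithZero

variable {k L : Type*} [Field k] [Field L] [Algebra k L]
  {v : Valuation L (WithZero (Multiplicative ℤ))}

theorem val_mul_le {x y : L} {a b c : ℤ} (hx : v x ≤ exp a) (hy : v y ≤ exp b) (h : a + b ≤ c) :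
    v (x * y) ≤ exp c := by
  rw [map_mul]
  refine (mul_le_mul' hx hy).trans ?_
  rwa [← exp_add, exp_le_exp]

theorem val_le_mono {x : L} {a b : ℤ} (hx : v x ≤ exp a) (h : a ≤ b) : v x ≤ exp b :=
  hx.trans (exp_le_exp.2 h)

theorem val_lt_one_iff {x : L} : v x < 1 ↔ v x ≤ exp (-1 : ℤ) := by
  have := WithZero.lt_mul_exp_iff_le (x := v x) (y := exp (-1 : ℤ)) exp_ne_zero
  rw [← this, ← exp_add]
  simp

theorem ne_zero_of_val_eq_exp {x : L} {n : ℤ} (hx : v x = exp n) : x ≠ 0 := by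
  rintro rfl
  rw [map_zero] at hx
  exact exp_ne_zero hx.symm

theorem exists_val_eq_exp {x : L} (hx : x ≠ 0) : ∃ n : ℤ, v x = exp n :=
  ⟨(v x).log, (exp_log ((Valuation.ne_zero_iff v).2 hx)).symm⟩

theorem val_natCast_le_one (v : Valuation L (WithZero (Multiplicative ℤ))) (n : ℕ) :
    v (n : L) ≤ 1 := by
  induction n with
  | zero => simp
  | succ n ih => push_cast; exact v.map_add_le ih (by simp)

theorem val_intCast_le_one (v : Valuation L (WithZero (Multiplicative ℤ))) (n : ℤ) :
    v (n : L) ≤ 1 := by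
  obtain ⟨n, rfl | rfl⟩ := n.eq_nat_or_neg
  · simpa using val_natCast_le_one v n
  · simpa [Valuation.map_neg] using val_natCast_le_one v n

theorem dvd_of_val_intCast_lt_one {p : ℕ} (hp : p.Prime) (hvp : v (p : L) < 1) {a : ℤ}
    (ha : v (a : L) < 1) : (p : ℤ) ∣ a := by
  by_contra h
  have hc : IsCoprime (p : ℤ) a := (Nat.prime_iff_prime_int.1 hp).coprime_iff_not_dvd.2 h
  obtain ⟨x, y, hxy⟩ := hc
  have h1 : (x : L) * p + y * a = 1 := by exact_mod_cast congrArg (Int.cast : ℤ → L) hxy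
  have : v ((x : L) * p + y * a) < 1 := by
    refine v.map_add_lt ?_ ?_ <;> rw [map_mul]
    · exact mul_lt_one_of_nonneg_of_lt_one_right (val_intCast_le_one v x) zero_le hvp
    · exact mul_lt_one_of_nonneg_of_lt_one_right (val_intCast_le_one v y) zero_le ha
  rw [h1] at this
  simp at this

theorem val_intCast_lt_one_of_dvd {p : ℕ} (hvp : v (p : L) < 1) {a : ℤ}
    (ha : (p : ℤ) ∣ a) : v (a : L) < 1 := by
  obtain ⟨b, rfl⟩ := ha
  push_cast
  rw [map_mul]
  exact mul_lt_one_of_nonneg_of_lt_one_left zero_le hvp (val_intCast_le_one v b)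

/-- Invariance of `v` under `σ` together with a factorisation of each element as a power of a
uniformiser times a unit reduces a multiplicative property to those two cases. -/
theorem induction_uniformizer {π : L} (hπ : v π = exp (-1 : ℤ)) {P : L → Prop}
    (hpi : P π) (hunit : ∀ u, v u = 1 → P u)
    (hmul : ∀ x y, x ≠ 0 → y ≠ 0 → P x → P y → P (x * y)) (hinv : ∀ x, x ≠ 0 → P x → P x⁻¹)
    {y : L} (hy : y ≠ 0) : P y := by
  have hπ0 : π ≠ 0 := ne_zero_of_val_eq_exp hπ
  obtain ⟨n, hn⟩ := exists_val_eq_exp (v := v) hy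
  have hnat : ∀ m : ℕ, P (π ^ m) := by
    intro m
    induction m with
    | zero => simpa using hunit 1 (by simp)
    | succ m ih => rw [pow_succ]; exact hmul _ _ (pow_ne_zero _ hπ0) hπ0 ih hpi
  have hint : ∀ m : ℤ, P (π ^ m) := by
    intro m
    obtain ⟨m, rfl | rfl⟩ := m.eq_nat_or_neg
    · simpa using hnat m
    · simpa using hinv _ (pow_ne_zero _ hπ0) (hnat m)
  have h1 : y = π ^ (-n) * (y * π ^ n) := by
    rw [mul_left_comm, ← zpow_add₀ hπ0]; simp
  rw [h1]
  refine hmul _ _ (zpow_ne_zero _ hπ0) (mul_ne_zero hy (zpow_ne_zero _ hπ0)) (hint _) (hunit _ ?_)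
  rw [map_mul, map_zpow₀, hn, hπ, ← exp_zsmul, ← exp_add]
  simp

theorem val_apply_sub_mul_le {σ : L ≃ₐ[k] L} (hv : ∀ y, v (σ y) = v y) {x y : L}
    {c : WithZero (Multiplicative ℤ)}
    (hx : v (σ x - x) ≤ v x * c) (hy : v (σ y - y) ≤ v y * c) :
    v (σ (x * y) - x * y) ≤ v (x * y) * c := by
  have : σ (x * y) - x * y = σ x * (σ y - y) + (σ x - x) * y := by rw [map_mul]; ring
  rw [this, map_mul v x y]
  refine v.map_add_le ?_ ?_
  · rw [map_mul, hv, mul_assoc]; gcongr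
  · rw [map_mul, mul_right_comm]; gcongr

theorem raises_of_uniformizer {σ : L ≃ₐ[k] L} (hv : ∀ y, v (σ y) = v y) {π : L}
    (hπ : v π = exp (-1 : ℤ)) {t : ℤ} (h1 : v (σ π - π) ≤ exp (-(1 + t)))
    (h2 : ∀ u, v u = 1 → v (σ u - u) ≤ exp (-t)) (y : L) :
    v (σ y - y) ≤ v y * exp (-t) := by
  rcases eq_or_ne y 0 with rfl | hy
  · simp
  refine induction_uniformizer (v := v) (P := fun y => v (σ y - y) ≤ v y * exp (-t)) hπ
    ?_ ?_ ?_ ?_ hy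
  · rw [hπ, ← exp_add]; convert h1 using 2; ring
  · intro u hu; rw [hu, one_mul]; exact h2 u hu
  · intro x y _ _ hx hy
    exact val_apply_sub_mul_le hv hx hy
  · intro x hx0 hx
    have h0 : σ x ≠ 0 := by simpa using hx0
    have : σ x⁻¹ - x⁻¹ = -((σ x - x) * (x⁻¹ * (σ x)⁻¹)) := by
      rw [map_inv₀]; field_simp; ring
    have hvx : v x ≠ 0 := (Valuation.ne_zero_iff v).2 hx0
    rw [this, Valuation.map_neg, map_mul, map_mul, map_inv₀, map_inv₀, hv]
    calc v (σ x - x) * ((v x)⁻¹ * (v x)⁻¹) ≤ (v x * exp (-t)) * ((v x)⁻¹ * (v x)⁻¹) := by gcongr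
      _ = (v x)⁻¹ * exp (-t) := by field_simp

section Residue

variable {π : L} (hπ : v π = exp (-1 : ℤ))
  (hres : ∀ y, v y ≤ 1 → ∃ a : ℤ, v (y - a) < 1)

include hπ hres

theorem val_sub_le_of_integral {σ : L ≃ₐ[k] L} (hv : ∀ y, v (σ y) = v y) {t : ℕ}
    (h1 : v (σ π - π) ≤ exp (-(1 + t) : ℤ)) {y : L} (hy : v y ≤ 1) :
    v (σ y - y) ≤ exp (-(1 + t) : ℤ) := by
  have hπ0 : π ≠ 0 := ne_zero_of_val_eq_exp hπ
  have key : ∀ s : ℕ, s ≤ t + 1 → ∀ y, v y ≤ 1 → v (σ y - y) ≤ exp (-s : ℤ) := by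
    intro s
    induction s with
    | zero =>
      intro _ y hy
      simp only [Nat.cast_zero, neg_zero, exp_zero]
      exact v.map_sub_le (by rwa [hv]) hy
    | succ s ih =>
      intro hs y hy
      obtain ⟨a, ha⟩ := hres y hy
      obtain ⟨w, hw⟩ : ∃ w, y - a = π * w := ⟨π⁻¹ * (y - a), by field_simp⟩
      have hw1 : v w ≤ 1 := by
        rw [val_lt_one_iff, hw, map_mul, hπ] at ha
        have : v w = exp (1 : ℤ) * (exp (-1 : ℤ) * v w) := by
          rw [← mul_assoc, ← exp_add]; simp
        rw [this]
        calc _ ≤ exp (1 : ℤ) * exp (-1 : ℤ) := by gcongr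
          _ = 1 := by rw [← exp_add]; simp
      have hy' : y = a + π * w := by rw [← hw]; ring
      have : σ y - y = (σ π - π) * σ w + π * (σ w - w) := by
        rw [hy', map_add, map_mul, map_intCast]; ring
      rw [this]
      refine v.map_add_le ?_ ?_
      · refine val_mul_le h1 (b := 0) (by rwa [hv, exp_zero]) ?_
        push_cast; omega
      · refine val_mul_le hπ.le (ih (by omega) w hw1) ?_
        push_cast; omega
  have := key (t + 1) le_rfl y hy
  refine val_le_mono this (by push_cast; omega)

theorem raises_of_residue {σ : L ≃ₐ[k] L} (hv : ∀ y, v (σ y) = v y) {t : ℕ}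
    (h1 : v (σ π - π) ≤ exp (-(1 + t) : ℤ)) (y : L) : v (σ y - y) ≤ v y * exp (-t : ℤ) :=
  raises_of_uniformizer hv hπ h1 (fun _ hu =>
    val_le_mono (val_sub_le_of_integral hπ hres hv h1 hu.le) (by omega)) y

theorem val_div_sub_one_le {σ : L ≃ₐ[k] L} (hv : ∀ y, v (σ y) = v y) {t : ℕ}
    (h1 : v (σ π - π) ≤ exp (-(1 + t) : ℤ)) {y : L} (hy : y ≠ 0) :
    v (σ y / y - 1) ≤ exp (-t : ℤ) := by
  have : σ y / y - 1 = (σ y - y) * y⁻¹ := by field_simp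
  have hvx : v y ≠ 0 := (Valuation.ne_zero_iff v).2 hy
  rw [this, map_mul, map_inv₀]
  calc _ ≤ (v y * exp (-t : ℤ)) * (v y)⁻¹ := by
        gcongr; exact raises_of_residue hπ hres hv h1 y
    _ = _ := by field_simp

theorem val_leading_term {σ : L ≃ₐ[k] L} (hv : ∀ y, v (σ y) = v y) {t : ℕ} (ht : 1 ≤ t)
    (h1 : v (σ π - π) ≤ exp (-(1 + t) : ℤ)) {y : L} {m : ℤ} (hy : v y = exp (-m)) :
    v (σ y / y - 1 - m * (σ π / π - 1)) ≤ exp (-(t + 1) : ℤ) := by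
  have hy0 : y ≠ 0 := ne_zero_of_val_eq_exp hy
  have hπ0 : π ≠ 0 := ne_zero_of_val_eq_exp hπ
  have hmain : ∀ {y : L}, y ≠ 0 → v (σ y / y - 1) ≤ exp (-t : ℤ) :=
    val_div_sub_one_le hπ hres hv h1
  suffices ∃ m : ℤ, v y = exp (-m) ∧ v (σ y / y - 1 - m * (σ π / π - 1)) ≤ exp (-(t + 1) : ℤ) by
    obtain ⟨m', h, h'⟩ := this
    obtain rfl : m' = m := by
      rw [h, exp_inj] at hy; omega
    exact h'
  refine induction_uniformizer (v := v)
    (P := fun y => ∃ m : ℤ, v y = exp (-m) ∧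
      v (σ y / y - 1 - m * (σ π / π - 1)) ≤ exp (-(t + 1) : ℤ)) hπ ?_ ?_ ?_ ?_ hy0
  · exact ⟨1, hπ, by simp⟩
  · intro u hu
    refine ⟨0, by simpa using hu, ?_⟩
    have hu0 : u ≠ 0 := by rintro rfl; simp at hu
    have : σ u / u - 1 - ((0 : ℤ) : L) * (σ π / π - 1) = (σ u - u) * u⁻¹ := by
      field_simp; simp
    rw [this]
    refine val_mul_le (b := 0) (val_sub_le_of_integral hπ hres hv h1 hu.le) ?_ (by omega)
    simp [map_inv₀, hu]
  · rintro x y hx0 hy0 ⟨m, hm, hx⟩ ⟨n, hn, hy⟩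
    refine ⟨m + n, by rw [map_mul, hm, hn, ← exp_add]; congr 1; ring, ?_⟩
    have h0 : σ x ≠ 0 := by simpa using hx0
    have : σ (x * y) / (x * y) - 1 - ((m + n : ℤ) : L) * (σ π / π - 1) =
        (σ x / x - 1 - m * (σ π / π - 1)) + (σ y / y - 1 - n * (σ π / π - 1)) +
        (σ x / x - 1) * (σ y / y - 1) := by
      rw [map_mul]; push_cast; field_simp; ring
    rw [this]
    exact v.map_add_le (v.map_add_le hx hy) (val_mul_le (hmain hx0) (hmain hy0) (by omega))
  · rintro x hx0 ⟨m, hm, hx⟩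
    refine ⟨-m, by rw [map_inv₀, hm, ← exp_neg], ?_⟩
    have h0 : σ x ≠ 0 := by simpa using hx0
    have : σ x⁻¹ / x⁻¹ - 1 - ((-m : ℤ) : L) * (σ π / π - 1) =
        -(σ x / x - 1 - m * (σ π / π - 1)) + (σ x / x - 1) * (σ x / x - 1) * (x / σ x) := by
      rw [map_inv₀]; push_cast; field_simp; ring
    rw [this]
    refine v.map_add_le (by rwa [Valuation.map_neg]) ?_
    refine val_mul_le (b := 0) (val_mul_le (hmain hx0) (hmain hx0) le_rfl) ?_ (by omega)
    rw [map_div₀, hv, div_self ((Valuation.ne_zero_iff v).2 hx0)]; simp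

theorem val_mul_apply_sub {σ τ : L ≃ₐ[k] L} (hσ : ∀ y, v (σ y) = v y) {t : ℕ} (ht : 1 ≤ t)
    (h1 : v (σ π - π) ≤ exp (-(1 + t) : ℤ)) (h2 : v (τ π - π) ≤ exp (-(1 + t) : ℤ)) :
    v ((σ * τ) π - π - (σ π - π) - (τ π - π)) ≤ exp (-(2 + t) : ℤ) := by
  have : (σ * τ) π - π - (σ π - π) - (τ π - π) = σ (τ π - π) - (τ π - π) := by
    rw [AlgEquiv.mul_apply, map_sub]; ring
  rw [this]
  refine (raises_of_residue hπ hres hσ h1 _).trans ?_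
  calc _ ≤ exp (-(1 + t) : ℤ) * exp (-t : ℤ) := by gcongr
    _ ≤ _ := by rw [← exp_add, exp_le_exp]; omega

theorem commutator_break_congr {p : ℕ} (hp : p.Prime) (hvp : v (p : L) < 1)
    {σ τ : L ≃ₐ[k] L} (hσ : ∀ y, v (σ y) = v y) (hτ : ∀ y, v (τ y) = v y)
    (hc : σ * τ = τ * σ) {s t : ℕ} (hs : 1 ≤ s) (ht : 1 ≤ t)
    (h1 : v (σ π - π) = exp (-(1 + s) : ℤ)) (h2 : v (τ π - π) = exp (-(1 + t) : ℤ)) :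
    (p : ℤ) ∣ (t : ℤ) - s := by
  have hπ0 : π ≠ 0 := ne_zero_of_val_eq_exp hπ
  set a := σ π / π - 1 with ha
  set b := τ π / π - 1 with hb
  have aux : ∀ (ρ : L ≃ₐ[k] L) (r : ℕ), v (ρ π - π) = exp (-(1 + r) : ℤ) →
      v (ρ π / π - 1) = exp (-r : ℤ) := by
    intro ρ r hr
    have : ρ π / π - 1 = (ρ π - π) * π⁻¹ := by field_simp
    rw [this, map_mul, map_inv₀, hr, hπ, ← exp_neg, ← exp_add]
    congr 1; ring
  have va := aux σ s h1
  have vb := aux τ t h2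
  rw [← ha] at va
  rw [← hb] at vb
  have ha0 : a ≠ 0 := ne_zero_of_val_eq_exp va
  have hb0 : b ≠ 0 := ne_zero_of_val_eq_exp vb
  have e1 : σ π = π * (1 + a) := by rw [ha]; field_simp; ring
  have e2 : τ π = π * (1 + b) := by rw [hb]; field_simp; ring
  have l1 := val_leading_term hπ hres hσ hs h1.le vb
  have l2 := val_leading_term hπ hres hτ ht h2.le va
  rw [← ha] at l1
  rw [← hb] at l2
  have hcπ : σ (τ π) = τ (σ π) := by
    have := congrArg (fun ρ : L ≃ₐ[k] L => ρ π) hc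
    simpa using this
  rw [e1, e2, map_mul, map_mul, e1, e2, map_add, map_add, map_one, map_one] at hcπ
  have hcπ' : (1 + a) * (1 + σ b) = (1 + b) * (1 + τ a) := by
    apply mul_left_cancel₀ hπ0
    linear_combination hcπ
  set x := σ b / b - 1 - ((t : ℤ) : L) * a with hx
  set y := τ a / a - 1 - ((s : ℤ) : L) * b with hy
  have e3 : σ b = b * (1 + t * a + x) := by rw [hx]; push_cast; field_simp; ring
  have e4 : τ a = a * (1 + s * b + y) := by rw [hy]; push_cast; field_simp; ring
  have key : (((t : ℤ) - (s : ℤ) : ℤ) : L) * (a * b) =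
      -(b * x) + a * y - a * b * (t * a + x) + a * b * (s * b + y) := by
    rw [e3, e4] at hcπ'
    push_cast
    linear_combination hcπ'
  have nle : ∀ n : ℕ, v (n : L) ≤ exp (0 : ℤ) := fun n => by
    simpa using val_natCast_le_one v n
  have hbound : v ((((t : ℤ) - (s : ℤ) : ℤ) : L) * (a * b)) ≤ exp (-(s + t + 1) : ℤ) := by
    rw [key]
    have vab : v (a * b) ≤ exp (-(s + t) : ℤ) := val_mul_le va.le vb.le (by omega)
    have vta : v ((t : L) * a) ≤ exp (-1 : ℤ) := val_mul_le (nle t) va.le (by omega)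
    have vsb : v ((s : L) * b) ≤ exp (-1 : ℤ) := val_mul_le (nle s) vb.le (by omega)
    refine v.map_add_le (v.map_sub_le (v.map_add_le ?_ ?_) ?_) ?_
    · rw [Valuation.map_neg]; exact val_mul_le vb.le l1 (by omega)
    · exact val_mul_le va.le l2 (by omega)
    · exact val_mul_le vab (v.map_add_le vta (val_le_mono l1 (by omega))) (by omega)
    · exact val_mul_le vab (v.map_add_le vsb (val_le_mono l2 (by omega))) (by omega)
  refine dvd_of_val_intCast_lt_one hp hvp (v := v) ?_
  rw [val_lt_one_iff]
  rw [map_mul, map_mul, va, vb, ← exp_add] at hbound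
  calc v (((t : ℤ) - (s : ℤ) : ℤ) : L)
      = v (((t : ℤ) - (s : ℤ) : ℤ) : L) * exp (-s + -t : ℤ) * exp (s + t : ℤ) := by
        rw [mul_assoc, ← exp_add]; ring_nf; simp
    _ ≤ exp (-(s + t + 1) : ℤ) * exp (s + t : ℤ) := by gcongr
    _ = exp (-1 : ℤ) := by rw [← exp_add]; congr 1; ring

end Residue

end Ramification

section WildInertia

open WithZero

variable {k L : Type*} [Field k] [Field L] [Algebra k L]
  {v : Valuation L (WithZero (Multiplicative ℤ))}
variable {π : L} (hπ : v π = exp (-1 : ℤ))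
  (hres : ∀ y, v y ≤ 1 → ∃ a : ℤ, v (y - a) < 1)

include hπ hres

theorem eq_one_of_forall_val_le {σ : L ≃ₐ[k] L} (hv : ∀ y, v (σ y) = v y) (h : σ π = π) :
    σ = 1 := by
  have h1 : ∀ t : ℕ, v (σ π - π) ≤ exp (-(1 + t) : ℤ) := fun t => by simp [h]
  ext y
  by_contra hy
  have hy0 : y ≠ 0 := by rintro rfl; simp at hy
  obtain ⟨m, hm⟩ := exists_val_eq_exp (v := v) hy0
  obtain ⟨n, hn⟩ := exists_val_eq_exp (v := v) (sub_ne_zero.2 hy)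
  have := raises_of_residue hπ hres hv (h1 (m - n + 1).toNat) y
  rw [AlgEquiv.one_apply] at hn
  rw [hn, hm, ← exp_add, exp_le_exp] at this
  omega

theorem val_apply_uniformizer_sub_le {p : ℕ} (hp : p.Prime) (hvp : v (p : L) < 1)
    {σ : L ≃ₐ[k] L} (hv : ∀ y, v (σ y) = v y) (hσ : σ ^ p = 1) :
    v (σ π - π) ≤ exp (-2 : ℤ) := by
  have hπ0 : π ≠ 0 := ne_zero_of_val_eq_exp hπ
  have h0 : v (σ π - π) ≤ exp (-(1 + (0 : ℕ)) : ℤ) :=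
    v.map_sub_le (by rw [hv, hπ]; simp) (by simp [hπ])
  have hsub : ∀ y, v y ≤ 1 → v (σ y - y) < 1 := fun y hy => by
    rw [val_lt_one_iff]; exact val_le_mono (val_sub_le_of_integral hπ hres hv h0 hy) (by simp)
  set u := σ π / π with hu
  have vu : v u = 1 := by
    rw [hu, map_div₀, hv, div_self ((Valuation.ne_zero_iff v).2 hπ0)]
  obtain ⟨a, ha⟩ := hres u vu.le
  have hpow : ∀ j : ℕ, v ((σ ^ j) π / π - a ^ j) < 1 := by
    intro j
    induction j with
    | zero => simp [hπ0]
    | succ j ih =>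
      have e : (σ ^ (j + 1)) π / π - (a : L) ^ (j + 1) =
          σ ((σ ^ j) π / π - a ^ j) * u + a ^ j * (u - a) := by
        rw [pow_succ', AlgEquiv.mul_apply, map_sub, map_div₀, map_pow, map_intCast, hu]
        have : σ π ≠ 0 := by simpa using hπ0
        field_simp
        ring
      rw [e]
      refine v.map_add_lt ?_ ?_
      · rw [map_mul, vu, mul_one, hv]; exact ih
      · rw [map_mul, map_pow]
        refine mul_lt_one_of_nonneg_of_lt_one_right ?_ zero_le ha
        exact pow_le_one' (val_intCast_le_one v a) j
  have h1 := hpow p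
  rw [hσ, AlgEquiv.one_apply, div_self hπ0] at h1
  have h2 : v ((a ^ p - 1 : ℤ) : L) < 1 := by
    rw [← Valuation.map_neg]; push_cast; simpa using h1
  have h3 := dvd_of_val_intCast_lt_one hp hvp h2
  have h4 : (p : ℤ) ∣ a - 1 := by
    have := Fact.mk hp
    rw [← ZMod.intCast_zmod_eq_zero_iff_dvd] at h3 ⊢
    push_cast at h3 ⊢
    rwa [ZMod.pow_card] at h3
  have h5 := val_intCast_lt_one_of_dvd hvp h4
  have h6 : v (u - 1) < 1 := by
    have : u - 1 = (u - a) + ((a - 1 : ℤ) : L) := by push_cast; ring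
    rw [this]; exact v.map_add_lt ha h5
  have : σ π - π = π * (u - 1) := by rw [hu]; field_simp
  rw [this]
  exact val_mul_le hπ.le (val_lt_one_iff.1 h6) (by norm_num)

theorem exists_break {p : ℕ} (hp : p.Prime) (hvp : v (p : L) < 1)
    {σ : L ≃ₐ[k] L} (hv : ∀ y, v (σ y) = v y) (hσ : σ ^ p = 1) (h1 : σ ≠ 1) :
    ∃ t : ℕ, 1 ≤ t ∧ v (σ π - π) = exp (-(1 + t) : ℤ) := by
  have hne : σ π - π ≠ 0 := fun h => h1 (eq_one_of_forall_val_le hπ hres hv (sub_eq_zero.1 h))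
  obtain ⟨n, hn⟩ := exists_val_eq_exp (v := v) hne
  have := val_apply_uniformizer_sub_le hπ hres hp hvp hv hσ
  rw [hn, exp_le_exp] at this
  refine ⟨(-n - 1).toNat, by omega, ?_⟩
  rw [hn]; congr 1; omega

theorem val_pow_apply_sub {σ : L ≃ₐ[k] L} (hσ : ∀ y, v (σ y) = v y) {t : ℕ} (ht : 1 ≤ t)
    (h1 : v (σ π - π) ≤ exp (-(1 + t) : ℤ)) (j : ℕ) :
    v ((σ ^ j) π - π - j * (σ π - π)) ≤ exp (-(2 + t) : ℤ) := by
  induction j with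
  | zero => simp
  | succ j ih =>
    have h2 : v ((σ ^ j) π - π) ≤ exp (-(1 + t) : ℤ) := by
      have : (σ ^ j) π - π = ((σ ^ j) π - π - j * (σ π - π)) + j * (σ π - π) := by ring
      rw [this]
      refine v.map_add_le (val_le_mono ih (by omega)) (val_mul_le (a := 0) ?_ h1 (by omega))
      simpa using val_natCast_le_one v j
    have := val_mul_apply_sub hπ hres hσ ht h1 h2
    have e : (σ ^ (j + 1)) π - π - ((j + 1 : ℕ) : L) * (σ π - π) =
      ((σ * σ ^ j) π - π - (σ π - π) - ((σ ^ j) π - π)) + ((σ ^ j) π - π - j * (σ π - π)) := by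
      rw [pow_succ']; push_cast; ring
    rw [e]
    exact v.map_add_le this ih

/-- Two independent automorphisms with the same break can be combined to one with larger break. -/
theorem exists_larger_break {p : ℕ} (hp : p.Prime) (hvp : v (p : L) < 1)
    (hv : ∀ (σ : L ≃ₐ[k] L) y, v (σ y) = v y) {σ τ : L ≃ₐ[k] L} {t : ℕ} (ht : 1 ≤ t)
    (h1 : v (σ π - π) = exp (-(1 + t) : ℤ)) (h2 : v (τ π - π) = exp (-(1 + t) : ℤ)) :
    ∃ j : ℕ, v ((σ * τ ^ j) π - π) ≤ exp (-(2 + t) : ℤ) := by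
  have hne : τ π - π ≠ 0 := ne_zero_of_val_eq_exp h2
  obtain ⟨a, ha⟩ := hres ((σ π - π) / (τ π - π)) (by
    rw [map_div₀, h1, h2, div_self exp_ne_zero])
  obtain ⟨j, hj⟩ : ∃ j : ℕ, (p : ℤ) ∣ j + a := by
    have hp0 : (p : ℤ) ≠ 0 := by exact_mod_cast hp.ne_zero
    refine ⟨((-a) % p).toNat, ?_⟩
    rw [Int.toNat_of_nonneg (Int.emod_nonneg _ hp0), Int.dvd_iff_emod_eq_zero]
    simp
  have h3 := val_pow_apply_sub hπ hres (hv τ) ht h2.le j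
  have h4 : v ((τ ^ j) π - π) ≤ exp (-(1 + t) : ℤ) := by
    have : (τ ^ j) π - π = ((τ ^ j) π - π - j * (τ π - π)) + j * (τ π - π) := by ring
    rw [this]
    refine v.map_add_le (val_le_mono h3 (by omega)) (val_mul_le (a := 0) ?_ h2.le (by omega))
    simpa using val_natCast_le_one v j
  have h5 := val_mul_apply_sub hπ hres (hv σ) ht h1.le h4
  refine ⟨j, ?_⟩
  have e : (σ * τ ^ j) π - π = ((σ * τ ^ j) π - π - (σ π - π) - ((τ ^ j) π - π)) +
      ((τ ^ j) π - π - j * (τ π - π)) + ((σ π - π) / (τ π - π) - a) * (τ π - π) +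
      ((j + a : ℤ) : L) * (τ π - π) := by
    push_cast; field_simp; ring
  rw [e]
  refine v.map_add_le (v.map_add_le (v.map_add_le h5 h3) ?_) ?_
  · exact val_mul_le (val_lt_one_iff.1 ha) h2.le (by omega)
  · exact val_mul_le (val_lt_one_iff.1 (val_intCast_lt_one_of_dvd hvp hj)) h2.le (by omega)

end WildInertia

section WildContradiction

open WithZero

variable {k L : Type*} [Field k] [Field L] [Algebra k L]
  {v : Valuation L (WithZero (Multiplicative ℤ))}

theorem prod_pow_apply_fixed {p : ℕ} {σ : L ≃ₐ[k] L} (hσ : σ ^ p = 1) (y : L) :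
    σ (∏ j ∈ Finset.range p, (σ ^ j) y) = ∏ j ∈ Finset.range p, (σ ^ j) y := by
  rcases p with _ | p
  · simp
  rw [map_prod, Finset.prod_range_succ, Finset.prod_range_succ']
  simp only [← AlgEquiv.mul_apply, ← pow_succ', hσ]
  simp

theorem sum_pow_apply_fixed {p : ℕ} {σ : L ≃ₐ[k] L} (hσ : σ ^ p = 1) (y : L) :
    σ (∑ j ∈ Finset.range p, (σ ^ j) y) = ∑ j ∈ Finset.range p, (σ ^ j) y := by
  rcases p with _ | p
  · simp
  rw [map_sum, Finset.sum_range_succ, Finset.sum_range_succ']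
  simp only [← AlgEquiv.mul_apply, ← pow_succ', hσ]
  simp

theorem sum_pow_apply_eq (σ : L ≃ₐ[k] L) (n : ℕ) (x : L) :
    ∑ j ∈ Finset.range n, (σ ^ j) x =
      ∑ j ∈ Finset.range n, (n.choose (j + 1) : L) * (fun y => σ y - y)^[j] x := by
  let f : Module.End k L := σ.toLinearMap
  have h := congrArg (fun q => Polynomial.aeval (f - 1) q x)
    (Polynomial.geom_sum_X_comp_X_add_one_eq_sum (R := k) n)
  simp only [Polynomial.aeval_comp, map_sum, map_pow, Polynomial.aeval_X, map_add, map_one,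
    sub_add_cancel, map_mul, map_natCast, LinearMap.sum_apply] at h
  have h1 : ∀ j, (f ^ j) x = (σ ^ j) x := by
    intro j
    induction j with
    | zero => simp
    | succ j ih => rw [pow_succ', pow_succ', Module.End.mul_apply, ih, AlgEquiv.mul_apply]; rfl
  have h2 : ∀ j, ((f - 1) ^ j) x = (fun y => σ y - y)^[j] x := by
    intro j
    induction j with
    | zero => simp
    | succ j ih => rw [pow_succ', Module.End.mul_apply, ih, Function.iterate_succ_apply']; rfl
  simp only [h1] at h
  rw [h]
  refine Finset.sum_congr rfl fun j _ => ?_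
  rw [Module.End.mul_apply, h2]
  generalize (fun y => σ y - y)^[j] x = z
  generalize n.choose (j + 1) = m
  induction m with
  | zero => simp
  | succ m ih => push_cast; rw [LinearMap.add_apply, ih]; simp; ring

/-- There is no totally ramified extension with group `(ℤ/p)²` of an absolutely unramified
local-like field with prime residue field, for `p` odd. -/
theorem false_of_totallyRamified_elementary {p : ℕ} (hp : p.Prime) (hp2 : p ≠ 2)
    (hcard : Nat.card (L ≃ₐ[k] L) = p ^ 2) (hcomm : ∀ σ τ : L ≃ₐ[k] L, σ * τ = τ * σ)
    (hexp : ∀ σ : L ≃ₐ[k] L, σ ^ p = 1)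
    (hv : ∀ (σ : L ≃ₐ[k] L) y, v (σ y) = v y)
    {π : L} (hπ : v π = exp (-1 : ℤ)) (hres : ∀ y, v y ≤ 1 → ∃ a : ℤ, v (y - a) < 1)
    (hvp : v (p : L) = exp (-(p ^ 2 : ℤ)))
    (hfix : ∀ y, y ≠ 0 → (∀ σ : L ≃ₐ[k] L, σ y = y) → ∃ n : ℤ, v y = exp (p ^ 2 * n)) : False := by
  have hp3 : 3 ≤ p := by have := hp.two_le; omega
  have hπ0 : π ≠ 0 := ne_zero_of_val_eq_exp hπ
  have hvp1 : v (p : L) < 1 := by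
    rw [hvp, ← exp_zero, exp_lt_exp]
    have : (0 : ℤ) < p := by exact_mod_cast hp.pos
    have : (0 : ℤ) < p ^ 2 := by positivity
    omega
  have : Finite (L ≃ₐ[k] L) := Nat.finite_of_card_ne_zero (by rw [hcard]; positivity)
  have hbr : ∀ σ : L ≃ₐ[k] L, σ ≠ 1 → ∃ t : ℕ, 1 ≤ t ∧ v (σ π - π) = exp (-(1 + t) : ℤ) :=
    fun σ h => exists_break hπ hres hp hvp1 (hv σ) (hexp σ) h
  choose! t ht1 ht using hbr
  have hne : {σ : L ≃ₐ[k] L | σ ≠ 1}.Nonempty := by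
    by_contra h
    have h1 : ∀ σ : L ≃ₐ[k] L, σ = 1 := by
      intro σ; by_contra h2; exact h ⟨σ, h2⟩
    have : Subsingleton (L ≃ₐ[k] L) := ⟨fun a b => by rw [h1 a, h1 b]⟩
    rw [Nat.card_of_subsingleton (1 : L ≃ₐ[k] L)] at hcard
    nlinarith
  obtain ⟨τ, hτ1, hτmin⟩ := Set.exists_min_image _ t (Set.toFinite _) hne
  have hτ1 : τ ≠ 1 := hτ1
  have := Fact.mk hp
  have hoτ : orderOf τ = p := orderOf_eq_prime (hexp τ) hτ1
  have hcτ : Nat.card (Subgroup.zpowers τ) = p := by rw [Nat.card_zpowers, hoτ]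
  obtain ⟨σ, hσ⟩ : ∃ σ, σ ∉ Subgroup.zpowers τ := by
    by_contra! h
    have : Subgroup.zpowers τ = ⊤ := by ext; simp [h]
    rw [this, Subgroup.card_top, hcard] at hcτ
    nlinarith
  have key : ∃ ρ : L ≃ₐ[k] L, ρ ∉ Subgroup.zpowers τ ∧ t τ < t ρ := by
    have hσ1 : σ ≠ 1 := by rintro rfl; exact hσ (one_mem _)
    rcases (hτmin σ hσ1).lt_or_eq with h | h
    · exact ⟨σ, hσ, h⟩
    · have h1 := ht σ hσ1
      rw [← h] at h1
      obtain ⟨j, hj⟩ := exists_larger_break hπ hres hp hvp1 hv (ht1 τ hτ1) h1 (ht τ hτ1)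
      have hn : σ * τ ^ j ∉ Subgroup.zpowers τ := by
        intro h2
        exact hσ ((Subgroup.mul_mem_cancel_right _ (Subgroup.npow_mem_zpowers τ j)).1 h2)
      refine ⟨σ * τ ^ j, hn, ?_⟩
      rw [ht (σ * τ ^ j) (by rintro h3; rw [h3] at hn; exact hn (one_mem _)), exp_le_exp] at hj
      omega
  obtain ⟨ρ, hρ, hlt⟩ := key
  have hρ1 : ρ ≠ 1 := by rintro rfl; exact hρ (one_mem _)
  have hdvd := commutator_break_congr hπ hres hp hvp1 (hv τ) (hv ρ) (hcomm τ ρ) (ht1 τ hτ1)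
    (ht1 ρ hρ1) (ht τ hτ1) (ht ρ hρ1)
  have htρ : p + 1 ≤ t ρ := by
    have := Int.le_of_dvd (by omega) hdvd
    have := ht1 τ hτ1
    omega
  have hgen : ∀ y : L, τ y = y → ρ y = y → ∀ σ : L ≃ₐ[k] L, σ y = y := by
    intro y h1 h2
    let H := MulAction.stabilizer (L ≃ₐ[k] L) y
    have hτH : τ ∈ H := h1
    have hρH : ρ ∈ H := h2
    have hle : Subgroup.zpowers τ ≤ H := by rwa [Subgroup.zpowers_le]
    have hd1 : Nat.card H ∣ p ^ 2 := hcard ▸ Subgroup.card_subgroup_dvd_card H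
    obtain ⟨i, hi, hi'⟩ := (Nat.dvd_prime_pow hp).1 hd1
    have hcl : p < Nat.card H := by
      rw [← hcτ]
      refine lt_of_le_of_ne (Subgroup.card_le_of_le hle) fun h => hρ ?_
      rw [Subgroup.eq_of_le_of_card_ge hle h.ge]; exact hρH
    have hi2 : i = 2 := by
      interval_cases i <;> simp_all
    have : H = ⊤ := Subgroup.eq_top_of_card_eq _ (by rw [hi', hi2, hcard])
    intro σ
    have : σ ∈ H := by rw [this]; trivial
    exact this
  have hcom : ∀ (α β : L ≃ₐ[k] L) y, α (β y) = β (α y) := fun α β y => by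
    rw [← AlgEquiv.mul_apply, hcomm, AlgEquiv.mul_apply]
  have hval : ∀ y, y ≠ 0 → τ y = y → ∃ n : ℤ, v y = exp (p * n) := by
    intro y hy0 hy
    obtain ⟨n, hn⟩ := hfix (∏ j ∈ Finset.range p, (ρ ^ j) y)
      (Finset.prod_ne_zero_iff.2 fun j _ => (map_ne_zero (ρ ^ j)).2 hy0)
      (hgen _ (by rw [map_prod]; simp only [hcom τ, hy]) (prod_pow_apply_fixed (hexp ρ) y))
    rw [map_prod] at hn
    simp only [hv, Finset.prod_const, Finset.card_range] at hn
    obtain ⟨m, hm⟩ := exists_val_eq_exp (v := v) hy0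
    refine ⟨n, ?_⟩
    rw [hm, ← exp_nsmul, exp_inj] at hn
    rw [hm]; congr 1
    have : (p : ℤ) ≠ 0 := by exact_mod_cast hp.ne_zero
    apply mul_left_cancel₀ this
    simp at hn
    rw [hn]; ring
  have hraise : ∀ y, τ y = y → v (ρ y - y) ≤ v y * exp (-(2 * p) : ℤ) := by
    intro y hy
    have h1 := raises_of_residue hπ hres (hv ρ) (ht ρ hρ1).le y
    rcases eq_or_ne y 0 with rfl | hy0
    · simp
    rcases eq_or_ne (ρ y - y) 0 with h0 | h0
    · rw [h0]; simp
    obtain ⟨m, hm⟩ := hval y hy0 hy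
    obtain ⟨n, hn⟩ := hval _ h0 (by rw [map_sub, hcom τ, hy])
    rw [hm, hn, ← exp_add, exp_le_exp] at h1 ⊢
    have h2 : (p : ℤ) * n < p * (m - 1) := by linarith
    have hp0 : (0 : ℤ) < p := by exact_mod_cast hp.pos
    have h3 := lt_of_mul_lt_mul_left h2 hp0.le
    have h4 : n ≤ m - 2 := by omega
    have := mul_le_mul_of_nonneg_left h4 hp0.le
    linarith
  set x := ∏ j ∈ Finset.range p, (τ ^ j) π with hx
  have hτx : τ x = x := prod_pow_apply_fixed (hexp τ) π
  have hvx : v x = exp (-p : ℤ) := by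
    rw [hx, map_prod]
    simp only [hv, Finset.prod_const, Finset.card_range, hπ, ← exp_nsmul]
    simp
  have hτit : ∀ j : ℕ, τ ((fun y => ρ y - y)^[j] x) = (fun y => ρ y - y)^[j] x := by
    intro j
    induction j with
    | zero => simpa using hτx
    | succ j ih => rw [Function.iterate_succ_apply', map_sub, hcom τ, ih]
  have hit : ∀ j : ℕ, v ((fun y => ρ y - y)^[j] x) ≤ exp (-(p + 2 * p * j) : ℤ) := by
    intro j
    induction j with
    | zero => simp [hvx]
    | succ j ih =>
      rw [Function.iterate_succ_apply']
      refine (hraise _ (hτit j)).trans ?_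
      calc _ ≤ exp (-(p + 2 * p * j) : ℤ) * exp (-(2 * p) : ℤ) := by gcongr
        _ = _ := by rw [← exp_add]; congr 1; push_cast; ring
  set T := ∑ j ∈ Finset.range p, (ρ ^ j) x with hT
  have hTeq := sum_pow_apply_eq ρ p x
  obtain ⟨q, hq⟩ : ∃ q, p = q + 1 := ⟨p - 1, by omega⟩
  have hp0 : (0 : ℤ) < p := by exact_mod_cast hp.pos
  have hp3' : (3 : ℤ) ≤ p := by exact_mod_cast hp3
  have hrest : v (∑ j ∈ Finset.range q, (p.choose (j + 1 + 1) : L) *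
      (fun y => ρ y - y)^[j + 1] x) < exp (-(p ^ 2 + p) : ℤ) := by
    refine v.map_sum_lt exp_ne_zero fun j hj => ?_
    have hj : j < q := Finset.mem_range.1 hj
    rw [map_mul]
    rcases eq_or_ne (j + 1 + 1) p with h | h
    · rw [h, Nat.choose_self, Nat.cast_one, map_one, one_mul]
      refine (hit (j + 1)).trans_lt ?_
      rw [exp_lt_exp]
      have : ((j + 1 : ℕ) : ℤ) = p - 1 := by omega
      rw [this]
      nlinarith
    · obtain ⟨c, hc⟩ := hp.dvd_choose_self (by omega : j + 1 + 1 ≠ 0) (by omega)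
      have h1 : v ((p.choose (j + 1 + 1) : ℕ) : L) ≤ exp (-(p ^ 2) : ℤ) := by
        rw [hc]; push_cast
        exact val_mul_le hvp.le (b := 0) (by simpa using val_natCast_le_one v c) (by simp)
      calc _ ≤ exp (-(p ^ 2) : ℤ) * exp (-(p + 2 * p * (j + 1 : ℕ)) : ℤ) := by
            gcongr; exact hit _
        _ < _ := by
            rw [← exp_add, exp_lt_exp]
            push_cast
            nlinarith
  have hvT : v T = exp (-(p ^ 2 + p) : ℤ) := by
    have hfirst : v ((p : L) * x) = exp (-(p ^ 2 + p) : ℤ) := by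
      rw [map_mul, hvp, hvx, ← exp_add]; congr 1; ring
    rw [hT, hTeq, show Finset.range p = Finset.range (q + 1) by rw [hq], Finset.sum_range_succ']
    simp only [zero_add, Nat.choose_one_right, Function.iterate_zero, id_eq]
    rw [Valuation.map_add_eq_of_lt_right v (by rw [hfirst]; exact hrest), hfirst]
  obtain ⟨n, hn⟩ := hfix T (ne_zero_of_val_eq_exp hvT) (hgen _ (by
    rw [hT, map_sum]; simp only [hcom τ, hτx]) (sum_pow_apply_fixed (hexp ρ) x))
  rw [hvT, exp_inj] at hn
  have h1 : (p : ℤ) * (p * (n + 1) + 1) = 0 := by linarith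
  have h2 : (p : ℤ) * (n + 1) + 1 = 0 := by
    rcases mul_eq_zero.1 h1 with h | h
    · omega
    · exact h
  have h3 : (p : ℤ) ∣ 1 := ⟨-(n + 1), by linarith⟩
  have := Int.le_of_dvd one_pos h3
  omega

end WildContradiction

section Tame

open WithZero

variable {k L : Type*} [Field k] [Field L] [Algebra k L]
  {v : Valuation L (WithZero (Multiplicative ℤ))}

theorem residue_eq_zero_iff_val_lt_one (x : v.valuationSubring) :
    IsLocalRing.residue v.valuationSubring x = 0 ↔ v (x : L) < 1 := by
  rw [IsLocalRing.residue_eq_zero_iff, IsLocalRing.mem_maximalIdeal, mem_nonunits_iff,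
    (Valuation.valuationSubring.integers v).isUnit_iff_valuation_eq_one]
  exact ⟨fun h => lt_of_le_of_ne x.2 h, fun h => h.ne⟩

theorem eq_one_of_tame {π : L} (hπ : v π = exp (-1 : ℤ)) {σ : L ≃ₐ[k] L}
    (hv : ∀ y, v (σ y) = v y) (hin : ∀ y, v y ≤ 1 → v (σ y - y) < 1)
    (h1 : v (σ π / π - 1) < 1) {m : ℕ} (hm : v (m : L) = 1) (hσ : σ ^ m = 1) : σ = 1 := by
  have hπ0 : π ≠ 0 := ne_zero_of_val_eq_exp hπ
  have hr : ∀ y, v (σ y - y) ≤ v y * exp (-1 : ℤ) := by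
    refine raises_of_uniformizer hv hπ ?_ fun u hu => val_lt_one_iff.1 (hin u hu.le)
    have : σ π - π = π * (σ π / π - 1) := by field_simp
    rw [this]
    exact val_mul_le hπ.le (val_lt_one_iff.1 h1) (by norm_num)
  have hv' : ∀ (j : ℕ) y, v ((σ ^ j) y) = v y := by
    intro j y
    induction j with
    | zero => simp
    | succ j ih => rw [pow_succ', AlgEquiv.mul_apply, hv, ih]
  have hj : ∀ (j : ℕ) z, v ((σ ^ j) z - z) ≤ v z * exp (-1 : ℤ) := by
    intro j z
    induction j with
    | zero => simp
    | succ j ih =>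
      have : (σ ^ (j + 1)) z - z = (σ ((σ ^ j) z) - (σ ^ j) z) + ((σ ^ j) z - z) := by
        rw [pow_succ', AlgEquiv.mul_apply]; ring
      rw [this]
      refine v.map_add_le ?_ ih
      exact (hr _).trans_eq (by rw [hv'])
  ext y
  rw [AlgEquiv.one_apply, ← sub_eq_zero]
  set z := σ y - y with hz
  have hsum : ∑ j ∈ Finset.range m, (σ ^ j) z = 0 := by
    have : ∀ j ∈ Finset.range m, (σ ^ j) z = (σ ^ (j + 1)) y - (σ ^ j) y := by
      intro j _
      rw [hz, map_sub, pow_succ, AlgEquiv.mul_apply]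
    rw [Finset.sum_congr rfl this, Finset.sum_range_sub (fun j => (σ ^ j) y), hσ]
    simp
  have hsum2 : (m : L) * z = -∑ j ∈ Finset.range m, ((σ ^ j) z - z) := by
    rw [Finset.sum_sub_distrib, hsum]; simp
  by_contra h0
  have h2 : v ((m : L) * z) ≤ v z * exp (-1 : ℤ) := by
    rw [hsum2, Valuation.map_neg]
    exact v.map_sum_le fun j _ => hj j z
  rw [map_mul, hm, one_mul] at h2
  obtain ⟨n, hn⟩ := exists_val_eq_exp (v := v) h0
  rw [hn, ← exp_add, exp_le_exp] at h2
  omega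

/-- A tame inertia group commuting with a Frobenius element has order at most `p - 1`. -/
theorem card_tame_inertia_le {p : ℕ} (hp : p.Prime) (hvp : v (p : L) < 1) {π : L}
    (hπ : v π = exp (-1 : ℤ)) (I : Subgroup (L ≃ₐ[k] L)) [Finite I]
    (hI : ¬ p ∣ Nat.card I)
    (hv : ∀ σ ∈ I, ∀ y, v (σ y) = v y) (hin : ∀ σ ∈ I, ∀ y, v y ≤ 1 → v (σ y - y) < 1)
    (φ : L ≃ₐ[k] L) (hφI : ∀ σ ∈ I, ∀ y, φ (σ y) = σ (φ y)) (hvφ : ∀ y, v (φ y) = v y)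
    (hφ : ∀ y, v y ≤ 1 → v (φ y - y ^ p) < 1) : Nat.card I ≤ p - 1 := by
  have hπ0 : π ≠ 0 := ne_zero_of_val_eq_exp hπ
  have hvπ0 : v π ≠ 0 := (Valuation.ne_zero_iff v).2 hπ0
  have hu : ∀ σ ∈ I, v (σ π / π) = 1 := fun σ hσ => by
    rw [map_div₀, hv σ hσ, div_self hvπ0]
  let r := IsLocalRing.residue v.valuationSubring
  have hr : ∀ a b : v.valuationSubring, r a = r b ↔ v ((a : L) - b) < 1 := by
    intro a b
    rw [← sub_eq_zero, ← map_sub, residue_eq_zero_iff_val_lt_one]; rfl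
  let f : I →* IsLocalRing.ResidueField v.valuationSubring :=
    { toFun := fun σ => r ⟨σ.1 π / π, (hu σ.1 σ.2).le⟩
      map_one' := by
        rw [← map_one r, hr]; simp [hπ0]
      map_mul' := by
        rintro ⟨σ, hσ⟩ ⟨τ, hτ⟩
        rw [← map_mul r, hr]
        have h0 : σ π ≠ 0 := by simpa using hπ0
        have : (σ * τ) π / π - σ π / π * (τ π / π) = (σ (τ π / π) - τ π / π) * (σ π / π) := by
          rw [AlgEquiv.mul_apply, map_div₀]; field_simp
        change v ((σ * τ) π / π - σ π / π * (τ π / π)) < 1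
        rw [this, map_mul, hu σ hσ, mul_one]
        exact hin σ hσ _ (hu τ hτ).le }
  have hfp : ∀ σ, (f.toHomUnits σ : IsLocalRing.ResidueField v.valuationSubring) ^ (p - 1) = 1 := by
    intro σ
    have h1 : f σ ^ p = f σ := by
      change r _ ^ p = r _
      rw [← map_pow r, hr]
      obtain ⟨σ, hσ⟩ := σ
      change v ((σ π / π) ^ p - σ π / π) < 1
      have hφπ0 : φ π ≠ 0 := by simpa using hπ0
      have h0 : σ π ≠ 0 := by simpa using hπ0
      set w := φ π / π with hw
      have hvw : v w = 1 := by rw [hw, map_div₀, hvφ, div_self hvπ0]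
      have hw0 : w ≠ 0 := by rw [hw]; exact div_ne_zero hφπ0 hπ0
      have e : (σ π / π) ^ p - σ π / π =
          -(φ (σ π / π) - (σ π / π) ^ p) + (σ w - w) * (w⁻¹ * (σ π / π)) := by
        have : φ (σ π / π) = σ w / w * (σ π / π) := by
          rw [map_div₀, hφI σ hσ, hw, map_div₀]; field_simp
        rw [this]; field_simp; ring
      rw [e]
      refine v.map_add_lt ?_ ?_
      · rw [Valuation.map_neg]; exact hφ _ (hu σ hσ).le
      · rw [map_mul, map_mul, map_inv₀, hvw, hu σ hσ]
        simpa using hin σ hσ w hvw.le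
    have hne : f σ ≠ 0 := (f.toHomUnits σ).ne_zero
    have h2 : f σ ^ (p - 1) * f σ = 1 * f σ := by
      rw [← pow_succ, Nat.sub_add_cancel hp.one_le, h1, one_mul]
    exact mul_right_cancel₀ hne h2
  have hinj : Function.Injective f.toHomUnits := by
    rw [injective_iff_map_eq_one]
    rintro ⟨σ, hσ⟩ h
    have h1 : f ⟨σ, hσ⟩ = 1 := congrArg Units.val h
    have h2 : r ⟨σ π / π, (hu σ hσ).le⟩ = r 1 := by rw [map_one]; exact h1
    rw [hr] at h2
    have hm : v ((Nat.card I : ℕ) : L) = 1 := by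
      refine le_antisymm (val_natCast_le_one v _) (not_lt.1 fun hlt => hI ?_)
      have := dvd_of_val_intCast_lt_one hp hvp (v := v) (a := (Nat.card I : ℕ))
        (by exact_mod_cast hlt)
      exact_mod_cast this
    have : σ = 1 := eq_one_of_tame hπ (hv σ hσ) (hin σ hσ) h2 hm (by
      have := pow_card_eq_one' (x := (⟨σ, hσ⟩ : I))
      exact congrArg Subtype.val this)
    exact Subtype.ext this
  have : NeZero (p - 1) := ⟨by have := hp.two_le; omega⟩
  let g : I → rootsOfUnity (p - 1) (IsLocalRing.ResidueField v.valuationSubring) :=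
    fun σ => ⟨f.toHomUnits σ, by rw [mem_rootsOfUnity']; exact hfp σ⟩
  have hg : Function.Injective g := fun a b h => hinj (congrArg Subtype.val h)
  exact (Nat.card_le_card_of_injective g hg).trans (card_rootsOfUnity _ _)

end Tame

section RamificationIndex

open NumberField Ideal

/-- The ramification index of the rational prime `p` in the Galois number field `L`. -/
noncomputable def ramIdx (p : ℕ) (L : Type*) [Field L] : ℕ :=
  (Ideal.span {(p : ℤ)}).ramificationIdxIn (𝓞 L)

theorem span_natCast_isPrime {p : ℕ} (hp : p.Prime) : (Ideal.span {(p : ℤ)}).IsPrime :=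
  (Ideal.span_singleton_prime (by exact_mod_cast hp.ne_zero)).2 (Nat.prime_iff_prime_int.1 hp)

theorem span_natCast_ne_bot {p : ℕ} (hp : p.Prime) : Ideal.span {(p : ℤ)} ≠ ⊥ := by
  simpa using hp.ne_zero

variable (L : Type*) [Field L] [NumberField L]

theorem exists_isPrime_liesOver {p : ℕ} (hp : p.Prime) :
    ∃ P : Ideal (𝓞 L), P.IsPrime ∧ P.LiesOver (Ideal.span {(p : ℤ)}) := by
  have := span_natCast_isPrime hp
  obtain ⟨P, h₁, h₂⟩ := (inferInstance : Nonempty ((Ideal.span {(p : ℤ)}).primesOver (𝓞 L)))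
  exact ⟨P, h₁, h₂⟩

variable {L}

theorem ramIdx_ne_zero [IsGalois ℚ L] {p : ℕ} (hp : p.Prime) : ramIdx p L ≠ 0 := by
  have := span_natCast_isPrime hp
  exact Ideal.ramificationIdxIn_ne_zero Gal(L/ℚ)

theorem card_inertia_eq_ramIdx [IsGalois ℚ L] {p : ℕ} (hp : p.Prime) (P : Ideal (𝓞 L)) [P.IsPrime]
    [P.LiesOver (Ideal.span {(p : ℤ)})] : Nat.card (P.inertia Gal(L/ℚ)) = ramIdx p L := by
  have := span_natCast_isPrime hp
  have hb := span_natCast_ne_bot hp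
  have : (Ideal.span {(p : ℤ)}).IsMaximal := Ideal.IsPrime.isMaximal this hb
  have : Finite (ℤ ⧸ Ideal.span {(p : ℤ)}) := Ring.HasFiniteQuotients.finiteQuotient hb
  exact Ideal.card_inertia_eq_ramificationIdxIn _ P

theorem ramIdx_mul [IsGalois ℚ L] {F : Type*} [Field F] [NumberField F] [IsGalois ℚ F]
    [Algebra F L] {p : ℕ} (hp : p.Prime) (P : Ideal (𝓞 F)) [P.IsPrime]
    [P.LiesOver (Ideal.span {(p : ℤ)})] :
    ramIdx p F * P.ramificationIdxIn (𝓞 L) = ramIdx p L := by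
  have := span_natCast_isPrime hp
  have : IsGalois F L := IsGalois.tower_top_of_isGalois ℚ F L
  exact Ideal.ramificationIdxIn_mul_ramificationIdxIn (p := Ideal.span {(p : ℤ)}) P Gal(F/ℚ) (𝓞 L)
    Gal(L/ℚ) Gal(L/F)

theorem ramIdx_dvd_of_algebra [IsGalois ℚ L] (F : Type*) [Field F] [NumberField F] [IsGalois ℚ F]
    [Algebra F L] {p : ℕ} (hp : p.Prime) : ramIdx p F ∣ ramIdx p L := by
  obtain ⟨P, _, _⟩ := exists_isPrime_liesOver F hp
  exact ⟨_, (ramIdx_mul hp P).symm⟩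

theorem ramIdx_dvd_finrank [IsGalois ℚ L] {p : ℕ} (hp : p.Prime) :
    ramIdx p L ∣ Module.finrank ℚ L := by
  obtain ⟨P, _, _⟩ := exists_isPrime_liesOver L hp
  rw [← card_inertia_eq_ramIdx hp P, ← IsGalois.card_aut_eq_finrank]
  exact Subgroup.card_subgroup_dvd_card _

theorem finrank_eq_one_of_ramIdx_eq_one [IsGalois ℚ L] (h : ∀ p : ℕ, p.Prime → ramIdx p L = 1) :
    Module.finrank ℚ L = 1 := by
  by_contra H
  obtain ⟨p, hp, hp'⟩ := NumberField.exists_not_isUnramifiedIn (𝒪 := 𝓞 L) H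
  have := span_natCast_isPrime hp
  refine hp' ?_
  rw [Algebra.isUnramifiedIn_iff_forall_ramificationIdx_eq_one]
  intro P _ _
  rw [← Ideal.ramificationIdxIn_eq_ramificationIdx (Ideal.span {(p : ℤ)}) P Gal(L/ℚ)]
  exact h p hp

theorem ramIdx_cyclotomic_of_not_dvd {n : ℕ} [NeZero n] [IsCyclotomicExtension {n} ℚ L] {p : ℕ}
    (hp : p.Prime) (h : ¬ p ∣ n) : ramIdx p L = 1 := by
  have := Fact.mk hp
  exact IsCyclotomicExtension.Rat.ramificationIdxIn_eq_of_not_dvd p L h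


theorem exists_intermediateField_finrank_eq_ramIdx [IsAbelianGalois ℚ L] {p : ℕ} (hp : p.Prime) :
    ∃ E : IntermediateField ℚ L, Module.finrank E L = ramIdx p L ∧ ramIdx p E = 1 := by
  obtain ⟨P, _, _⟩ := exists_isPrime_liesOver L hp
  have hp' := span_natCast_isPrime hp
  have hb := span_natCast_ne_bot hp
  let E := IntermediateField.fixedField (P.inertia Gal(L/ℚ))
  have hE : Module.finrank E L = ramIdx p L := by
    rw [← card_inertia_eq_ramIdx hp P, IntermediateField.finrank_fixedField_eq_card]
  refine ⟨E, hE, ?_⟩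
  have : IsAbelianGalois ℚ E := IsAbelianGalois.tower_bot ℚ E L
  let Q : Ideal (𝓞 E) := P.under (𝓞 E)
  have : Q.LiesOver (Ideal.span {(p : ℤ)}) := ⟨by
    rw [Ideal.under_under]; exact Ideal.LiesOver.over⟩
  have hQ : Q.ramificationIdxIn (𝓞 L) = Module.finrank E L := by
    have hQb : Q ≠ ⊥ := Ideal.ne_bot_of_liesOver_of_ne_bot hb Q
    have : Q.IsMaximal := Ideal.IsPrime.isMaximal inferInstance hQb
    have : Finite (𝓞 E ⧸ Q) := Ring.HasFiniteQuotients.finiteQuotient hQb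
    rw [← Ideal.card_inertia_eq_ramificationIdxIn (G := Gal(L/E)) Q P,
      ← IsGalois.card_aut_eq_finrank, Subgroup.card_eq_iff_eq_top]
    refine eq_top_iff.2 fun σ _ x ↦ ?_
    have h : σ.restrictScalars ℚ ∈ P.inertia Gal(L/ℚ) := by
      rw [← IntermediateField.fixingSubgroup_fixedField (P.inertia Gal(L/ℚ)),
        IntermediateField.mem_fixingSubgroup_iff]
      exact fun y hy ↦ σ.commutes ⟨y, hy⟩
    exact h x
  have h := ramIdx_mul (L := L) hp Q
  rw [hQ, hE] at h
  exact Nat.eq_of_mul_eq_mul_right (Nat.pos_of_ne_zero (ramIdx_ne_zero (L := L) hp))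
    (by simpa using h)

theorem ramIdx_eq_one_of_sup_eq_top [IsGalois ℚ L] {F₁ F₂ : IntermediateField ℚ L} [IsGalois ℚ F₁]
    [IsGalois ℚ F₂] (hF : F₁ ⊔ F₂ = ⊤) {p : ℕ} (hp : p.Prime) (h₁ : ramIdx p F₁ = 1)
    (h₂ : ramIdx p F₂ = 1) : ramIdx p L = 1 := by
  obtain ⟨P, _, _⟩ := exists_isPrime_liesOver L hp
  have key (F : IntermediateField ℚ L) [IsGalois ℚ F] (h : ramIdx p F = 1) (σ : Gal(L/ℚ))
      (hσ : σ ∈ P.inertia Gal(L/ℚ)) (x : L) (hx : x ∈ F) : σ x = x := by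
    have : (P.under (𝓞 F)).LiesOver (Ideal.span {(p : ℤ)}) := ⟨by
      rw [Ideal.under_under]; exact Ideal.LiesOver.over⟩
    have hc := card_inertia_eq_ramIdx hp (P.under (𝓞 F))
    rw [h, Subgroup.card_eq_one] at hc
    have hm : σ.restrictNormal F ∈ (P.under (𝓞 F)).inertia Gal(F/ℚ) := by
      intro x
      rw [Ideal.under, Submodule.mem_toAddSubgroup, Ideal.mem_comap]
      convert hσ (algebraMap (𝓞 F) (𝓞 L) x) using 1
      rw [map_sub]
      rw [Submodule.mem_toAddSubgroup]
      congr! 2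
      refine RingOfIntegers.ext ?_
      exact AlgEquiv.restrictNormal_commutes σ F (x : F)
    rw [hc, Subgroup.mem_bot] at hm
    have := AlgEquiv.restrictNormal_commutes σ F ⟨x, hx⟩
    rw [hm] at this
    exact this.symm
  rw [← card_inertia_eq_ramIdx hp P, Subgroup.card_eq_one, eq_bot_iff]
  intro σ hσ
  have hle : F₁ ⊔ F₂ ≤ IntermediateField.fixedField (Subgroup.zpowers σ) := by
    refine sup_le ?_ ?_ <;> intro x hx <;> rw [IntermediateField.mem_fixedField_iff] <;>
      intro τ hτ
    · exact key F₁ h₁ τ (Subgroup.zpowers_le.2 hσ hτ) x hx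
    · exact key F₂ h₂ τ (Subgroup.zpowers_le.2 hσ hτ) x hx
  rw [Subgroup.mem_bot]
  ext x
  have := hle (hF ▸ IntermediateField.mem_top : x ∈ F₁ ⊔ F₂)
  rw [IntermediateField.mem_fixedField_iff] at this
  exact this σ (Subgroup.mem_zpowers σ)

end RamificationIndex

section AdicValuation

open NumberField Ideal IsDedekindDomain WithZero

variable {L : Type*} [Field L] [NumberField L] (w : HeightOneSpectrum (𝓞 L))

open scoped Pointwise in
theorem adic_valuation_smul_le {σ : Gal(L/ℚ)} (hσ : σ • w.asIdeal = w.asIdeal) (y : 𝓞 L) :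
    w.valuation L (σ (y : L)) ≤ w.valuation L (y : L) := by
  by_cases hy : y = 0
  · simp [hy]
  have e : σ (y : L) = algebraMap (𝓞 L) L (σ • y) := rfl
  rw [e, HeightOneSpectrum.valuation_of_algebraMap,
    HeightOneSpectrum.valuation_of_algebraMap,
    w.intValuation_eq_exp_neg_multiplicity hy, w.intValuation_le_pow_iff_mem]
  have hmem : y ∈ w.asIdeal ^ multiplicity w.asIdeal (Ideal.span {y}) := by
    rw [← w.intValuation_le_pow_iff_mem, w.intValuation_eq_exp_neg_multiplicity hy]
  have := Ideal.smul_mem_pointwise_smul σ y _ hmem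
  rwa [Ideal.pointwise_smul_def, Ideal.map_pow, ← Ideal.pointwise_smul_def, hσ] at this

open scoped Pointwise in
theorem adic_valuation_smul {σ : Gal(L/ℚ)} (hσ : σ • w.asIdeal = w.asIdeal) (y : L) :
    w.valuation L (σ y) = w.valuation L y := by
  have key (y : 𝓞 L) : w.valuation L (σ (y : L)) = w.valuation L (y : L) := by
    refine le_antisymm (adic_valuation_smul_le w hσ y) ?_
    have h : σ⁻¹ • w.asIdeal = w.asIdeal := by rw [inv_smul_eq_iff, hσ]
    have := adic_valuation_smul_le w h (σ • y)
    have e : σ⁻¹ (((σ • y : 𝓞 L)) : L) = y := by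
      change σ⁻¹ (σ (y : L)) = y
      exact σ.symm_apply_apply (y : L)
    rwa [e] at this
  obtain ⟨a, b, hb, rfl⟩ := IsFractionRing.div_surjective (A := 𝓞 L) y
  rw [map_div₀, map_div₀, map_div₀]
  congr 1
  · exact key a
  · exact key b

theorem exists_integer_valuation_sub_lt_one {y : L} (hy : w.valuation L y ≤ 1) :
    ∃ r : 𝓞 L, w.valuation L (y - r) < 1 := by
  obtain ⟨a, ha⟩ := w.exists_valuation_sub_lt_of_integer hy 1
  refine ⟨a, ?_⟩
  rw [Valuation.map_sub_swap]
  exact ha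

theorem valuation_integer_le_one (r : 𝓞 L) : w.valuation L (r : L) ≤ 1 := w.valuation_le_one r

theorem adic_valuation_sub_lt_one_of_inertia {σ : Gal(L/ℚ)}
    (hσ : σ ∈ w.asIdeal.inertia Gal(L/ℚ)) {y : L} (hy : w.valuation L y ≤ 1) :
    w.valuation L (σ y - y) < 1 := by
  obtain ⟨r, hr⟩ := exists_integer_valuation_sub_lt_one w hy
  have hs := Ideal.inertia_le_stabilizer (M := Gal(L/ℚ)) w.asIdeal hσ
  have h₁ : w.valuation L (σ (r : L) - r) < 1 := by
    have : σ (r : L) - r = algebraMap (𝓞 L) L (σ • r - r) := by rw [map_sub]; rfl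
    rw [this, HeightOneSpectrum.valuation_lt_one_iff_mem]
    exact hσ r
  have h₂ : w.valuation L (σ (y - r)) < 1 := by rwa [adic_valuation_smul w hs]
  have : σ y - y = σ (y - r) + (σ (r : L) - r) - (y - r) := by rw [map_sub]; ring
  rw [this]
  exact Valuation.map_sub_lt _ (Valuation.map_add_lt _ h₂ h₁) hr

theorem Valuation.map_pow_sub_pow_lt_one {R Γ : Type*} [CommRing R]
    [LinearOrderedCommGroupWithZero Γ] (v : Valuation R Γ) {x y : R} (hx : v x ≤ 1) (hy : v y ≤ 1)
    (h : v (x - y) < 1) (n : ℕ) : v (x ^ n - y ^ n) < 1 := by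
  induction n with
  | zero => simp
  | succ n ih =>
    have : x ^ (n + 1) - y ^ (n + 1) = x ^ n * (x - y) + (x ^ n - y ^ n) * y := by ring
    rw [this]
    refine Valuation.map_add_lt _ ?_ ?_ <;> rw [map_mul]
    · exact (mul_le_of_le_one_left' (by rw [map_pow]; exact pow_le_one' hx n)).trans_lt h
    · exact (mul_le_of_le_one_right' hy).trans_lt ih

variable {p : ℕ} [w.asIdeal.LiesOver (Ideal.span {(p : ℤ)})]

omit [NumberField L] in
theorem natCard_quotient_under : Nat.card (ℤ ⧸ w.asIdeal.under ℤ) = p := by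
  rw [← Ideal.over_def w.asIdeal (Ideal.span {(p : ℤ)})]
  exact (Nat.card_congr (Int.quotientSpanNatEquivZMod p).toEquiv).trans (Nat.card_zmod p)

theorem exists_frobenius [IsGalois ℚ L] : ∃ φ : Gal(L/ℚ),
    (∀ y, w.valuation L (φ y) = w.valuation L y) ∧
    ∀ y, w.valuation L y ≤ 1 → w.valuation L (φ y - y ^ p) < 1 := by
  have : Finite (𝓞 L ⧸ w.asIdeal) := Ring.HasFiniteQuotients.finiteQuotient w.ne_bot
  have := w.isPrime
  obtain ⟨φ, hφ⟩ := IsArithFrobAt.exists_of_isInvariant ℤ Gal(L/ℚ) w.asIdeal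
  have hs : ∀ y, w.valuation L (φ y) = w.valuation L y :=
    adic_valuation_smul w hφ.mem_stabilizer
  refine ⟨φ, hs, fun y hy ↦ ?_⟩
  obtain ⟨r, hr⟩ := exists_integer_valuation_sub_lt_one w hy
  have h₁ : w.valuation L (φ (r : L) - r ^ p) < 1 := by
    have : φ (r : L) - r ^ p = algebraMap (𝓞 L) L (φ • r - r ^ p) := by rw [map_sub, map_pow]; rfl
    rw [this, HeightOneSpectrum.valuation_lt_one_iff_mem]
    have := hφ r
    rwa [natCard_quotient_under (p := p) w] at this
  have h₂ : w.valuation L (φ (y - r)) < 1 := by rwa [hs]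
  have h₃ := Valuation.map_pow_sub_pow_lt_one _ hy (valuation_integer_le_one w r) hr p
  have : φ y - y ^ p = φ (y - r) + (φ (r : L) - r ^ p) - (y ^ p - r ^ p) := by rw [map_sub]; ring
  rw [this]
  exact Valuation.map_sub_lt _ (Valuation.map_add_lt _ h₂ h₁) h₃

theorem adic_valuation_natCast [IsGalois ℚ L] (hp : p.Prime) :
    w.valuation L (p : L) = exp (-(ramIdx p L : ℤ)) := by
  have h0 : (p : 𝓞 L) ≠ 0 := by exact_mod_cast hp.ne_zero
  have hp' := span_natCast_isPrime hp
  have := w.isPrime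
  have e : (p : L) = algebraMap (𝓞 L) L (p : 𝓞 L) := by simp
  rw [e, HeightOneSpectrum.valuation_of_algebraMap, w.intValuation_eq_exp_neg_multiplicity h0]
  have hm : (Ideal.span {(p : ℤ)}).map (algebraMap ℤ (𝓞 L)) = Ideal.span {(p : 𝓞 L)} := by
    rw [Ideal.map_span]; simp
  rw [ramIdx, Ideal.ramificationIdxIn_eq_ramificationIdx _ w.asIdeal Gal(L/ℚ),
    Ideal.IsDedekindDomain.ramificationIdx_eq_multiplicity (Ideal.span {(p : ℤ)}), hm]
  rw [hm]
  simpa using h0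

theorem exists_heightOneSpectrum_liesOver (L : Type*) [Field L] [NumberField L] {p : ℕ}
    (hp : p.Prime) :
    ∃ w : HeightOneSpectrum (𝓞 L), w.asIdeal.LiesOver (Ideal.span {(p : ℤ)}) := by
  obtain ⟨P, h, h'⟩ := exists_isPrime_liesOver L hp
  exact ⟨⟨P, h, Ideal.ne_bot_of_liesOver_of_ne_bot (span_natCast_ne_bot hp) P⟩, h'⟩

theorem ramIdx_le_of_not_dvd [IsAbelianGalois ℚ L] (hp : p.Prime)
    (h : ¬ p ∣ Module.finrank ℚ L) : ramIdx p L ≤ p - 1 := by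
  obtain ⟨w, _⟩ := exists_heightOneSpectrum_liesOver L hp
  have := w.isPrime
  have hc := card_inertia_eq_ramIdx hp w.asIdeal
  obtain ⟨φ, hφ, hφ'⟩ := exists_frobenius (p := p) w
  obtain ⟨π, hπ⟩ := w.valuation_exists_uniformizer L
  rw [← hc]
  have hcard : Nat.card (w.asIdeal.inertia Gal(L/ℚ)) ∣ Module.finrank ℚ L :=
    hc ▸ ramIdx_dvd_finrank hp
  refine card_tame_inertia_le (v := w.valuation L) hp ?_ hπ _ (fun h' ↦ h (h'.trans hcard))
    (fun σ hσ ↦ adic_valuation_smul w (Ideal.inertia_le_stabilizer (M := Gal(L/ℚ)) w.asIdeal hσ))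
    (fun σ hσ y hy ↦ adic_valuation_sub_lt_one_of_inertia w hσ hy) φ (fun σ _ y ↦ ?_) hφ hφ'
  · rw [adic_valuation_natCast w hp, ← exp_zero, exp_lt_exp]
    have := ramIdx_ne_zero (L := L) hp
    lia
  · exact DFunLike.congr_fun (mul_comm' φ σ) y

theorem adic_valuation_natCast_lt_one [IsGalois ℚ L] (hp : p.Prime) :
    w.valuation L (p : L) < 1 := by
  rw [adic_valuation_natCast w hp, ← exp_zero, exp_lt_exp]
  have := ramIdx_ne_zero (L := L) hp
  lia

theorem adic_valuation_intCast_eq_one [IsGalois ℚ L] (hp : p.Prime) {a : ℤ} (ha : ¬ (p : ℤ) ∣ a) :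
    w.valuation L (a : L) = 1 := by
  refine (val_intCast_le_one _ a).eq_of_not_lt fun h ↦ ha ?_
  exact dvd_of_val_intCast_lt_one hp (adic_valuation_natCast_lt_one w hp) h

theorem exists_adic_valuation_intCast [IsGalois ℚ L] (hp : p.Prime) {a : ℤ} (ha : a ≠ 0) :
    ∃ n : ℤ, w.valuation L (a : L) = exp (ramIdx p L * n : ℤ) := by
  obtain ⟨u, hu, h⟩ := (Int.finiteMultiplicity_iff.2
    ⟨by simpa using hp.ne_one, ha⟩ : FiniteMultiplicity (p : ℤ) a).exists_eq_pow_mul_and_not_dvd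
  generalize multiplicity (p : ℤ) a = k at hu
  subst hu
  refine ⟨-k, ?_⟩
  push_cast
  rw [map_mul, adic_valuation_intCast_eq_one w hp h, map_pow, adic_valuation_natCast w hp, mul_one,
    ← exp_nsmul]
  congr 1
  simp only [nsmul_eq_mul]
  ring

theorem not_dvd_of_sq_eq [IsGalois ℚ L] (hp : p.Prime) (h : ramIdx p L = 1) {d : ℤ}
    (hd : Squarefree d) {x : L} (hx : x ^ 2 = d) : ¬ (p : ℤ) ∣ d := by
  rintro ⟨u, rfl⟩
  obtain ⟨w, _⟩ := exists_heightOneSpectrum_liesOver L hp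
  have hu : ¬ (p : ℤ) ∣ u := fun hu ↦ (Nat.prime_iff_prime_int.1 hp).not_isUnit
    (hd _ (mul_dvd_mul_left _ hu))
  have hv := congr_arg (w.valuation L) hx
  push_cast at hv
  rw [map_pow, map_mul, adic_valuation_intCast_eq_one w hp hu, adic_valuation_natCast w hp, h,
    mul_one] at hv
  have h0 : w.valuation L x ≠ 0 := fun h0 ↦ by
    rw [h0, zero_pow two_ne_zero] at hv
    exact exp_ne_zero hv.symm
  obtain ⟨n, hn⟩ : ∃ n : ℤ, w.valuation L x = exp n := ⟨_, (exp_log h0).symm⟩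
  rw [hn, ← exp_nsmul, exp_inj] at hv
  simp only [nsmul_eq_mul] at hv
  lia

theorem ramIdx_ne_sq_of_elementary [IsAbelianGalois ℚ L] (hp : p.Prime) (hp2 : p ≠ 2)
    (hcard : Module.finrank ℚ L = p ^ 2) (hexp : ∀ σ : Gal(L/ℚ), σ ^ p = 1) :
    ramIdx p L ≠ p ^ 2 := by
  intro hram
  obtain ⟨w, _⟩ := exists_heightOneSpectrum_liesOver L hp
  have := w.isPrime
  have hp' := span_natCast_isPrime hp
  have hb := span_natCast_ne_bot hp
  have hm : (Ideal.span {(p : ℤ)}).IsMaximal := Ideal.IsPrime.isMaximal hp' hb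
  have hmw := w.isMaximal
  have hc := card_inertia_eq_ramIdx hp w.asIdeal
  have hG : Nat.card Gal(L/ℚ) = p ^ 2 := by rw [IsGalois.card_aut_eq_finrank, hcard]
  have htop : w.asIdeal.inertia Gal(L/ℚ) = ⊤ := by
    rw [← Subgroup.card_eq_iff_eq_top, hc, hram, hG]
  have hdeg : w.asIdeal.inertiaDeg ℤ = 1 := by
    have := Ideal.ncard_primesOver_mul_ramificationIdxIn_mul_inertiaDegIn (Ideal.span {(p : ℤ)})
      (𝓞 L) Gal(L/ℚ)
    change _ * (ramIdx p L * _) = _ at this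
    rw [hram, hG, Ideal.inertiaDegIn_eq_inertiaDeg _ w.asIdeal Gal(L/ℚ), ← mul_assoc,
      mul_comm _ (p ^ 2), mul_assoc] at this
    have h1 := Nat.eq_one_of_mul_eq_one_left (Nat.eq_of_mul_eq_mul_left (pow_pos hp.pos 2)
      (this.trans (mul_one _).symm))
    exact h1
  have hsurj : ∀ r : 𝓞 L, ∃ a : ℤ, r - a ∈ w.asIdeal := by
    intro r
    rw [Ideal.inertiaDeg_eq_of_isMaximal (Ideal.span {(p : ℤ)})] at hdeg
    let := Ideal.Quotient.field (Ideal.span {(p : ℤ)})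
    have hs := (Algebra.finrank_eq_one_iff_bijective_algebraMap.1 hdeg).2
    obtain ⟨a, ha⟩ := hs (Ideal.Quotient.mk _ r)
    obtain ⟨a, rfl⟩ := Ideal.Quotient.mk_surjective a
    refine ⟨a, ?_⟩
    rw [← Ideal.Quotient.mk_eq_mk_iff_sub_mem, ← ha]
    rfl
  obtain ⟨π, hπ⟩ := w.valuation_exists_uniformizer L
  refine false_of_totallyRamified_elementary (v := w.valuation L) hp hp2 hG mul_comm' hexp
    (fun σ ↦ adic_valuation_smul w (Ideal.inertia_le_stabilizer (M := Gal(L/ℚ)) w.asIdeal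
      (htop ▸ Subgroup.mem_top σ))) hπ (fun y hy ↦ ?_) ?_ (fun y hy0 hy ↦ ?_)
  · obtain ⟨r, hr⟩ := exists_integer_valuation_sub_lt_one w hy
    obtain ⟨a, ha⟩ := hsurj r
    refine ⟨a, ?_⟩
    have h₁ : w.valuation L (algebraMap (𝓞 L) L (r - a)) < 1 := by
      rwa [HeightOneSpectrum.valuation_lt_one_iff_mem]
    have : y - a = (y - r) + algebraMap (𝓞 L) L (r - a) := by rw [map_sub, map_intCast]; ring
    rw [this]
    exact Valuation.map_add_lt _ hr h₁
  · rw [adic_valuation_natCast w hp, hram]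
    norm_cast
  · obtain ⟨q, rfl⟩ : y ∈ Set.range (algebraMap ℚ L) := by
      rwa [IsGalois.mem_range_algebraMap_iff_fixed]
    have hq : q ≠ 0 := by rintro rfl; simp at hy0
    obtain ⟨m, hm⟩ := exists_adic_valuation_intCast w hp (Rat.num_ne_zero.2 hq)
    obtain ⟨n, hn⟩ := exists_adic_valuation_intCast w hp (a := q.den) (by simp)
    refine ⟨m - n, ?_⟩
    have : algebraMap ℚ L q = (q.num : L) / ((q.den : ℤ) : L) := by
      conv_lhs => rw [← q.num_div_den]
      simp
    rw [this, map_div₀, hm, hn, hram, ← exp_sub]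
    push_cast
    congr 1
    ring

end AdicValuation

section Abelian

open IntermediateField

theorem IsAbelianGalois.iSup {k K : Type*} [Field k] [Field K] [Algebra k K] {ι : Type*}
    (t : ι → IntermediateField k K) [h : ∀ i, IsAbelianGalois k (t i)] :
    IsAbelianGalois k (⨆ i, t i : IntermediateField k K) := by
  have hn : Normal k (⨆ i, t i : IntermediateField k K) := IntermediateField.normal_iSup k K t
  have hs : Algebra.IsSeparable k (⨆ i, t i : IntermediateField k K) :=
    IntermediateField.isSeparable_iSup k K
  have hg : IsGalois k (⨆ i, t i : IntermediateField k K) := { }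
  refine { is_comm := ⟨fun σ τ ↦ ?_⟩ }
  have key : ∀ i, (t i) ≤ (IntermediateField.fixedField (Subgroup.zpowers (σ * τ * σ⁻¹ * τ⁻¹))).map
      (⨆ i, t i : IntermediateField k K).val := by
    intro i x hx
    have hi : t i ≤ ⨆ i, t i := le_iSup t i
    have hni : Normal k (IntermediateField.restrict hi) :=
      Normal.of_algEquiv (IntermediateField.restrictAlgEquiv hi)
    refine ⟨⟨x, hi hx⟩, ?_, rfl⟩
    refine (IntermediateField.mem_fixedField_iff _ _).2 (Subgroup.forall_mem_zpowers.2 ?_)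
    have : IsAbelianGalois k (IntermediateField.restrict hi) :=
      .of_algHom (IntermediateField.restrictAlgEquiv hi).symm.toAlgHom
    have hr : AlgEquiv.restrictNormalHom (IntermediateField.restrict hi)
        (σ * τ * σ⁻¹ * τ⁻¹) = 1 := by
      rw [map_mul, map_mul, map_mul, map_inv, map_inv, mul_comm' (AlgEquiv.restrictNormalHom _ σ)]
      group
    have h1 : (σ * τ * σ⁻¹ * τ⁻¹) ⟨x, hi hx⟩ = ⟨x, hi hx⟩ := by
      have := AlgEquiv.restrictNormal_commutes (σ * τ * σ⁻¹ * τ⁻¹) (IntermediateField.restrict hi)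
        ⟨⟨x, hi hx⟩, (IntermediateField.mem_restrict hi _).2 hx⟩
      refine this.symm.trans ?_
      change algebraMap _ _ (AlgEquiv.restrictNormalHom (IntermediateField.restrict hi)
        (σ * τ * σ⁻¹ * τ⁻¹) _) = _
      rw [hr]
      rfl
    intro n
    have h2 : (σ * τ * σ⁻¹ * τ⁻¹) ∈ MulAction.stabilizer Gal((⨆ i, t i : IntermediateField k K)/k)
      (⟨x, hi hx⟩ : (⨆ i, t i : IntermediateField k K)) := h1
    exact zpow_mem h2 n
  have hle := iSup_le key
  have : (σ * τ * σ⁻¹ * τ⁻¹) = 1 := by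
    ext x
    obtain ⟨y, hy, hyx⟩ := hle x.2
    obtain rfl : y = x := Subtype.ext hyx
    exact congr_arg _ ((IntermediateField.mem_fixedField_iff _ _).1 hy _ (Subgroup.mem_zpowers _))
  rwa [mul_inv_eq_one, mul_inv_eq_iff_eq_mul] at this

instance IsAbelianGalois.sup {k K : Type*} [Field k] [Field K] [Algebra k K]
    (E F : IntermediateField k K) [IsAbelianGalois k E] [IsAbelianGalois k F] :
    IsAbelianGalois k (E ⊔ F : IntermediateField k K) := by
  have (b : Bool) : IsAbelianGalois k (cond b E F : IntermediateField k K) := by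
    cases b <;> assumption
  have := IsAbelianGalois.iSup fun b : Bool ↦ cond b E F
  rwa [iSup_bool_eq] at this

end Abelian

section Cyclotomic

open IntermediateField

/-- The extension of `F` in `Ω` generated by all `n`-th roots of unity. -/
abbrev cyc (F Ω : Type*) [Field F] [Field Ω] [Algebra F Ω] (n : ℕ) : IntermediateField F Ω :=
  IntermediateField.adjoin F {z : Ω | z ^ n = 1}

variable {F Ω : Type*} [Field F] [Field Ω] [Algebra F Ω]

theorem cyc_mono {m n : ℕ} (h : m ∣ n) : cyc F Ω m ≤ cyc F Ω n := by
  refine IntermediateField.adjoin.mono F _ _ fun z hz ↦ ?_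
  obtain ⟨c, rfl⟩ := h
  rw [Set.mem_ofPred_eq, pow_mul, show z ^ m = 1 from hz, one_pow]

theorem mem_cyc {n : ℕ} {z : Ω} (hz : z ^ n = 1) : z ∈ cyc F Ω n :=
  IntermediateField.subset_adjoin F _ hz

variable [IsAlgClosed Ω] [CharZero Ω]

theorem exists_isPrimitiveRoot (Ω : Type*) [Field Ω] [IsAlgClosed Ω] [CharZero Ω] (n : ℕ)
    [NeZero n] : ∃ ζ : Ω, IsPrimitiveRoot ζ n :=
  HasEnoughRootsOfUnity.exists_primitiveRoot Ω n

variable (F Ω) in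
instance cyc.isCyclotomicExtension (n : ℕ) [NeZero n] :
    IsCyclotomicExtension {n} F (cyc F Ω n) := by
  have h : {z : Ω | z ^ n = 1} = {b : Ω | ∃ m ∈ ({n} : Set ℕ), m ≠ 0 ∧ b ^ m = 1} := by
    ext z
    simp [NeZero.ne n]
  rw [cyc, h]
  refine IntermediateField.isCyclotomicExtension_adjoin_of_exists_isPrimitiveRoot _ _ _ ?_
  rintro m rfl hm
  exact exists_isPrimitiveRoot Ω m

theorem cyc_sup {m n : ℕ} [NeZero m] [NeZero n] :
    cyc F Ω m ⊔ cyc F Ω n = cyc F Ω (m.lcm n) := by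
  have : NeZero (m.lcm n) := ⟨Nat.lcm_ne_zero (NeZero.ne m) (NeZero.ne n)⟩
  have h₁ := IntermediateField.isCyclotomicExtension_lcm_sup F Ω m n (cyc F Ω m) (cyc F Ω n)
  exact IntermediateField.isCyclotomicExtension_eq {m.lcm n} F Ω _ _

variable (F Ω) in
instance cyc.isAbelianGalois (n : ℕ) [NeZero n] : IsAbelianGalois F (cyc F Ω n) :=
  IsCyclotomicExtension.isAbelianGalois {n} F _

variable {Ω : Type*} [Field Ω] [CharZero Ω]

instance IsAbelianGalois.rat_sup (E F : IntermediateField ℚ Ω) [hE : IsAbelianGalois ℚ E]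
    [hF : IsAbelianGalois ℚ F] : IsAbelianGalois ℚ (E ⊔ F : IntermediateField ℚ Ω) :=
  @IsAbelianGalois.sup ℚ Ω _ _ _ E F hE hF

instance NumberField.sup (E F : IntermediateField ℚ Ω) [hE : NumberField E]
    [hF : NumberField F] : NumberField (E ⊔ F : IntermediateField ℚ Ω) where
  to_charZero := inferInstance
  to_finiteDimensional := @IntermediateField.finiteDimensional_sup ℚ Ω _ _ _ E F
    hE.to_finiteDimensional hF.to_finiteDimensional

theorem IsAbelianGalois.rat_of_le {E F : IntermediateField ℚ Ω} (h : E ≤ F)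
    [IsAbelianGalois ℚ F] : IsAbelianGalois ℚ E :=
  .of_algHom (IntermediateField.inclusion h).toRingHom.toRatAlgHom

theorem NumberField.of_le {E F : IntermediateField ℚ Ω} (h : E ≤ F) [hF : NumberField F] :
    NumberField E where
  to_charZero := inferInstance
  to_finiteDimensional :=
    have := hF.to_finiteDimensional
    FiniteDimensional.of_injective (IntermediateField.inclusion h).toLinearMap
      (IntermediateField.inclusion h).injective

variable [IsAlgClosed Ω] (n : ℕ) [NeZero n]

instance cyc.isCyclotomicExtension_rat : IsCyclotomicExtension {n} ℚ (cyc ℚ Ω n) :=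
  cyc.isCyclotomicExtension ℚ Ω n

instance cyc.isAbelianGalois_rat : IsAbelianGalois ℚ (cyc ℚ Ω n) :=
  cyc.isAbelianGalois ℚ Ω n

instance cyc.numberField : NumberField (cyc ℚ Ω n) :=
  IsCyclotomicExtension.numberField {n} ℚ (cyc ℚ Ω n)

theorem finrank_cyc : Module.finrank ℚ (cyc ℚ Ω n) = n.totient :=
  IsCyclotomicExtension.finrank (n := n) (K := ℚ) (cyc ℚ Ω n)
    (Polynomial.cyclotomic.irreducible_rat (NeZero.pos n))

end Cyclotomic

section Group

/-- A finite abelian `p`-group that is not cyclic has two distinct subgroups of index `p`. -/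
theorem exists_index_eq_prime_of_not_isCyclic {G : Type*} [CommGroup G] [Finite G] {p k : ℕ}
    (hp : p.Prime) (hcard : Nat.card G = p ^ k) (h : ¬ IsCyclic G) :
    ∃ M N : Subgroup G, M ≠ N ∧ M.index = p ∧ N.index = p := by
  have : Fact p.Prime := ⟨hp⟩
  have hmax (H : Subgroup G) (hH : H ≠ ⊤) : ∃ M : Subgroup G, H ≤ M ∧ M.index = p := by
    obtain ⟨n, hn, hHn⟩ : ∃ n ≤ k, Nat.card H = p ^ n :=
      (Nat.dvd_prime_pow hp).1 (hcard ▸ H.card_subgroup_dvd_card)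
    have hnk : n < k := by
      refine lt_of_le_of_ne hn ?_
      rintro rfl
      exact hH (Subgroup.eq_top_of_card_eq H (hHn.trans hcard.symm))
    obtain ⟨M, hM, hHM⟩ := Sylow.exists_subgroup_card_pow_prime_le p
      (hcard ▸ pow_dvd_pow p (Nat.sub_le k 1)) H hHn (Nat.le_sub_one_of_lt hnk)
    refine ⟨M, hHM, ?_⟩
    have := M.card_mul_index
    rw [hM, hcard] at this
    refine Nat.eq_of_mul_eq_mul_left (pow_pos hp.pos (k - 1)) (this.trans ?_)
    rw [← pow_succ, Nat.sub_add_cancel (by lia)]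
  have hbot : (⊥ : Subgroup G) ≠ ⊤ := by
    intro hb
    have : Subsingleton G := by
      rw [← Subgroup.subsingleton_iff, ← subsingleton_iff_bot_eq_top]
      exact hb
    exact h inferInstance
  obtain ⟨M, -, hM⟩ := hmax ⊥ hbot
  have hMt : M ≠ ⊤ := by
    rintro rfl
    exact hp.one_lt.ne (by simpa using hM)
  obtain ⟨g, hg⟩ : ∃ g, g ∉ M := by
    by_contra! hall
    exact hMt (eq_top_iff.2 fun x _ ↦ hall x)
  obtain ⟨N, hgN, hN⟩ := hmax (Subgroup.zpowers g) fun ht ↦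
    h ⟨g, fun x ↦ show x ∈ Subgroup.zpowers g from ht ▸ Subgroup.mem_top x⟩
  refine ⟨M, N, ?_, hM, hN⟩
  rintro rfl
  exact hg (hgN (Subgroup.mem_zpowers g))

/-- A finite abelian `p`-group that is not cyclic has a quotient isomorphic to `(ℤ/p)²`. -/
theorem exists_elementary_quotient_of_not_isCyclic {G : Type*} [CommGroup G] [Finite G] {p k : ℕ}
    (hp : p.Prime) (hcard : Nat.card G = p ^ k) (h : ¬ IsCyclic G) :
    ∃ N : Subgroup G, N.index = p ^ 2 ∧ ∀ g : G, g ^ p ∈ N := by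
  obtain ⟨M, N, hne, hM, hN⟩ := exists_index_eq_prime_of_not_isCyclic hp hcard h
  refine ⟨M ⊓ N, ?_, fun g ↦ ⟨hM ▸ M.pow_index_mem g, hN ▸ N.pow_index_mem g⟩⟩
  obtain ⟨j, -, hj⟩ : ∃ j ≤ k, (M ⊓ N).index = p ^ j :=
    (Nat.dvd_prime_pow hp).1 (hcard ▸ (M ⊓ N).index_dvd_card)
  have hle : (M ⊓ N).index ≤ p ^ 2 := by
    have := Subgroup.index_inf_le (H := M) (K := N)
    rwa [hM, hN, ← sq] at this
  have hlt : p < (M ⊓ N).index := by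
    rw [← hM]
    refine Subgroup.index_strictAnti (lt_of_le_of_ne inf_le_left fun heq ↦ hne ?_)
    by_contra hMN
    have := Subgroup.index_strictAnti (lt_of_le_of_ne (inf_eq_left.1 heq) hMN)
    lia
  rw [hj] at hle hlt ⊢
  have h1 := (Nat.pow_le_pow_iff_right hp.one_lt).1 hle
  have h2 : 1 < j := (Nat.pow_lt_pow_iff_right hp.one_lt).1 (by simpa using hlt)
  rw [show j = 2 by lia]

end Group

section Cyclic

variable {L : Type*} [Field L] [NumberField L] {p k : ℕ}

instance IsAbelianGalois.rat_intermediateField {L : Type*} [Field L] [CharZero L]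
    [IsAbelianGalois ℚ L] (E : IntermediateField ℚ L) : IsAbelianGalois ℚ E :=
  IsAbelianGalois.tower_bot ℚ E L

theorem ramIdx_intermediateField_eq_one [IsGalois ℚ L] (E : IntermediateField ℚ L) [IsGalois ℚ E]
    (hp : p.Prime) (h : ramIdx p L = 1) : ramIdx p E = 1 :=
  Nat.dvd_one.1 (h ▸ ramIdx_dvd_of_algebra E hp)

theorem ramIdx_eq_finrank [IsAbelianGalois ℚ L] (hp : p.Prime)
    (hram : ∀ q, q.Prime → q ≠ p → ramIdx q L = 1) : ramIdx p L = Module.finrank ℚ L := by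
  obtain ⟨E, hE, hE'⟩ := exists_intermediateField_finrank_eq_ramIdx (L := L) hp
  have : Module.finrank ℚ E = 1 := finrank_eq_one_of_ramIdx_eq_one fun q hq ↦ by
    by_cases hqp : q = p
    · rwa [hqp]
    · exact ramIdx_intermediateField_eq_one E hq (hram q hq hqp)
  rw [← Module.finrank_mul_finrank ℚ E L, this, hE, one_mul]

theorem isCyclic_gal_of_odd_prime [IsAbelianGalois ℚ L] (hp : p.Prime) (hp2 : p ≠ 2)
    (hcard : Module.finrank ℚ L = p ^ k) (hram : ∀ q, q.Prime → q ≠ p → ramIdx q L = 1) :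
    IsCyclic Gal(L/ℚ) := by
  let : CommGroup Gal(L/ℚ) := { mul_comm := mul_comm' }
  by_contra hcyc
  obtain ⟨N, hN, hpow⟩ := exists_elementary_quotient_of_not_isCyclic hp
    ((IsGalois.card_aut_eq_finrank ℚ L).trans hcard) hcyc
  have hfix : (IntermediateField.fixedField N).fixingSubgroup = N :=
    IntermediateField.fixingSubgroup_fixedField N
  have hcardE : Module.finrank ℚ (IntermediateField.fixedField N) = p ^ 2 := by
    rw [← hN, ← hfix, ← IntermediateField.finrank_eq_fixingSubgroup_index, hfix]
  refine ramIdx_ne_sq_of_elementary (L := IntermediateField.fixedField N) hp hp2 hcardE ?_ ?_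
  · intro σ
    obtain ⟨τ, rfl⟩ := AlgEquiv.restrictNormalHom_surjective L (F := ℚ)
      (K₁ := IntermediateField.fixedField N) σ
    rw [← map_pow]
    ext x
    have h2 := AlgEquiv.restrictNormal_commutes (τ ^ p) (IntermediateField.fixedField N) x
    refine h2.trans ?_
    exact x.2 ⟨_, hpow τ⟩
  · rw [ramIdx_eq_finrank hp, hcardE]
    intro q hq hqp
    exact ramIdx_intermediateField_eq_one _ hq (hram q hq hqp)

end Cyclic

section Quadratic

variable {L : Type*} [Field L] [NumberField L] {k : ℕ}

theorem exists_sq_eq_squarefree [IsGalois ℚ L] (h : Module.finrank ℚ L = 2) :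
    ∃ d : ℤ, Squarefree d ∧ ∃ x : L, x ^ 2 = d ∧ x ∉ (⊥ : IntermediateField ℚ L) := by
  have hcard : Nat.card Gal(L/ℚ) = 2 := (IsGalois.card_aut_eq_finrank ℚ L).trans h
  obtain ⟨σ, hσ, hall⟩ := (Nat.card_eq_two_iff' (1 : Gal(L/ℚ))).1 hcard
  have hσ2 : ∀ z, σ (σ z) = z := fun z ↦ by
    have : σ ^ 2 = 1 := by rw [← hcard]; exact pow_card_eq_one'
    exact DFunLike.congr_fun (this ▸ sq σ).symm z
  obtain ⟨y, hy⟩ : ∃ y, σ y ≠ y := by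
    by_contra! hy
    exact hσ (AlgEquiv.ext hy)
  have hx : σ (y - σ y) = -(y - σ y) := by rw [map_sub, hσ2, neg_sub]
  have hx0 : y - σ y ≠ 0 := sub_ne_zero.2 hy.symm
  obtain ⟨q, hq⟩ : (y - σ y) ^ 2 ∈ (⊥ : IntermediateField ℚ L) := by
    rw [IsGalois.mem_bot_iff_fixed]
    intro τ
    by_cases hτ : τ = 1
    · rw [hτ]; rfl
    · rw [hall τ hτ, map_pow, hx, neg_sq]
  set x := y - σ y
  have hq : (q : L) = x ^ 2 := by rw [← hq]; exact (eq_ratCast (algebraMap ℚ L) q).symm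
  have hq0 : q ≠ 0 := by
    rintro rfl
    exact pow_ne_zero 2 hx0 (by rw [← hq, Rat.cast_zero])
  obtain ⟨a, s, hs, ha⟩ := Nat.sq_mul_squarefree (q.num.natAbs * q.den)
  have hs0 : (s : L) ≠ 0 := by
    rintro h0
    rw [Nat.cast_eq_zero] at h0
    rw [h0] at hs
    simp [hq0] at hs
  have hsg : ((q.num.sign * a : ℤ) : L) * (s : L) ^ 2 = (q.den : L) ^ 2 * x ^ 2 := by
    have h1 : (q.num.sign * a : ℤ) * (s : ℤ) ^ 2 = q.num * q.den := by
      conv_rhs => rw [← Int.sign_mul_natAbs q.num]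
      rw [mul_assoc, mul_assoc]
      congr 1
      rw [mul_comm]
      exact_mod_cast hs
    have h2 : (q.num : ℚ) * q.den = q.den ^ 2 * q := by
      conv_rhs => rw [sq, mul_assoc, Rat.den_mul_eq_num, mul_comm]
    rw [← hq]
    have h1' : (((q.num.sign * a : ℤ) * (s : ℤ) ^ 2 : ℤ) : L) = (q.num * q.den : ℤ) := by rw [h1]
    have h2' : (((q.num : ℚ) * q.den : ℚ) : L) = (q.den ^ 2 * q : ℚ) := by rw [h2]
    push_cast at h1' h2' ⊢
    rw [h1', h2']
  refine ⟨q.num.sign * a, ?_, q.den * x / s, ?_, ?_⟩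
  · rw [← Int.squarefree_natAbs, Int.natAbs_mul, Int.natAbs_sign_of_ne_zero (by simpa using hq0)]
    simpa using ha
  · rw [div_pow, mul_pow, ← hsg, mul_div_cancel_right₀ _ (pow_ne_zero 2 hs0)]
  · intro hmem
    rw [IsGalois.mem_bot_iff_fixed] at hmem
    have := hmem σ
    rw [map_div₀, map_mul, map_natCast, map_natCast, hx, div_left_inj' hs0,
      mul_right_inj' (Nat.cast_ne_zero.2 q.den_nz)] at this
    exact hx0 (self_eq_neg.1 this.symm)

theorem isCyclic_gal_two [IsAbelianGalois ℚ L]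
    (hcard : Module.finrank ℚ L = 2 ^ k) (hram : ∀ q, q.Prime → q ≠ 2 → ramIdx q L = 1)
    (hreal : ∀ (x : L) (d : ℤ), x ^ 2 = d → 0 ≤ d) : IsCyclic Gal(L/ℚ) := by
  let : CommGroup Gal(L/ℚ) := { mul_comm := mul_comm' }
  by_contra hcyc
  obtain ⟨M, N, hMN, hM, hN⟩ := exists_index_eq_prime_of_not_isCyclic Nat.prime_two
    ((IsGalois.card_aut_eq_finrank ℚ L).trans hcard) hcyc
  have key (H : Subgroup Gal(L/ℚ)) (hH : H.index = 2) :
      ∃ x : L, x ^ 2 = 2 ∧ IntermediateField.fixedField H = IntermediateField.adjoin ℚ {x} := by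
    have hfix : (IntermediateField.fixedField H).fixingSubgroup = H :=
      IntermediateField.fixingSubgroup_fixedField H
    have hcardE : Module.finrank ℚ (IntermediateField.fixedField H) = 2 := by
      rw [← hH, ← hfix, ← IntermediateField.finrank_eq_fixingSubgroup_index, hfix]
    obtain ⟨d, hd, ⟨x, hxE⟩, hxd, hxb⟩ := exists_sq_eq_squarefree hcardE
    have hxd' : x ^ 2 = d := congr_arg Subtype.val hxd
    have hd0 := hreal x d hxd'
    have hxb' : x ∉ (⊥ : IntermediateField ℚ L) := by
      rintro ⟨r, hr⟩
      exact hxb ⟨r, Subtype.ext hr⟩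
    have hd2 : d = 2 := by
      lift d to ℕ using hd0
      have hd' : Squarefree d := by simpa using hd
      have hprime : ∀ q, q.Prime → q ∣ d → q = 2 := fun q hq hqd ↦ by
        by_contra hq2
        exact not_dvd_of_sq_eq hq (hram q hq hq2) hd hxd' (by exact_mod_cast hqd)
      have h1 : d ≠ 1 := by
        rintro rfl
        have : x ^ 2 = 1 := by simpa using hxd'
        rcases sq_eq_sq_iff_eq_or_eq_neg.1 (this.trans (one_pow 2).symm) with h | h
        · exact hxb' (h ▸ one_mem _)
        · exact hxb' (h ▸ neg_mem (one_mem _))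
      obtain ⟨e, rfl⟩ : 2 ∣ d := by
        obtain ⟨q, hq, hqd⟩ := Nat.exists_prime_and_dvd h1
        rwa [hprime q hq hqd] at hqd
      have he : e = 1 := by
        by_contra he
        obtain ⟨q, hq, hqe⟩ := Nat.exists_prime_and_dvd he
        rw [hprime q hq (hqe.mul_left 2)] at hqe
        exact Nat.prime_two.one_lt.ne' (Nat.isUnit_iff.1 (hd' 2 (mul_dvd_mul_left 2 hqe)))
      rw [he]
      rfl
    refine ⟨x, by rw [hxd', hd2]; norm_num, ?_⟩
    symm
    refine IntermediateField.eq_of_le_of_finrank_le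
      (IntermediateField.adjoin_simple_le_iff.2 hxE) ?_
    rw [hcardE]
    have h1 : Module.finrank ℚ (IntermediateField.adjoin ℚ {x}) ≠ 1 := by
      rw [Ne, IntermediateField.finrank_eq_one_iff]
      intro hb
      exact hxb' (hb ▸ IntermediateField.mem_adjoin_simple_self ℚ x)
    have h2 : 0 < Module.finrank ℚ (IntermediateField.adjoin ℚ {x}) := Module.finrank_pos
    lia
  obtain ⟨x, hx, hxM⟩ := key M hM
  obtain ⟨y, hy, hyN⟩ := key N hN
  have hxy : IntermediateField.fixedField M = IntermediateField.fixedField N := by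
    rcases sq_eq_sq_iff_eq_or_eq_neg.1 (hx.trans hy.symm) with h | h
    · rw [hxM, hyN, h]
    · rw [hxM, hyN, h]
      refine le_antisymm (IntermediateField.adjoin_simple_le_iff.2 (neg_mem
        (IntermediateField.mem_adjoin_simple_self ℚ y)))
        (IntermediateField.adjoin_simple_le_iff.2 ?_)
      have := neg_mem (IntermediateField.mem_adjoin_simple_self ℚ (-y))
      rwa [neg_neg] at this
  apply hMN
  rw [← IntermediateField.fixingSubgroup_fixedField M, hxy,
    IntermediateField.fixingSubgroup_fixedField N]

end Quadratic

section Compositum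

theorem ramIdx_dvd_of_ringHom {L F : Type*} [Field L] [NumberField L] [IsGalois ℚ L] [Field F]
    [NumberField F] [IsGalois ℚ F] (f : F →+* L) {p : ℕ} (hp : p.Prime) :
    ramIdx p F ∣ ramIdx p L :=
  letI := f.toAlgebra
  ramIdx_dvd_of_algebra F hp

variable {Ω : Type*} [Field Ω] [CharZero Ω] (E F : IntermediateField ℚ Ω)

theorem ramIdx_dvd_of_le {E F : IntermediateField ℚ Ω} [NumberField E] [NumberField F]
    [IsGalois ℚ E] [IsGalois ℚ F] (h : E ≤ F) {p : ℕ} (hp : p.Prime) :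
    ramIdx p E ∣ ramIdx p F :=
  ramIdx_dvd_of_ringHom (IntermediateField.inclusion h).toRingHom hp

theorem restrict_sup_restrict : IntermediateField.restrict (le_sup_left : E ≤ E ⊔ F) ⊔
    IntermediateField.restrict (le_sup_right : F ≤ E ⊔ F) = ⊤ := by
  rw [← IntermediateField.lift_inj, IntermediateField.lift_sup, IntermediateField.lift_restrict,
    IntermediateField.lift_restrict, IntermediateField.lift_top]

theorem ramIdx_sup_eq_one [NumberField E] [NumberField F] [IsAbelianGalois ℚ E]
    [IsAbelianGalois ℚ F] {p : ℕ} (hp : p.Prime) (hE : ramIdx p E = 1) (hF : ramIdx p F = 1) :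
    ramIdx p (E ⊔ F : IntermediateField ℚ Ω) = 1 := by
  have : IsAbelianGalois ℚ (IntermediateField.restrict (le_sup_left : E ≤ E ⊔ F)) :=
    IsAbelianGalois.rat_intermediateField (L := (E ⊔ F : IntermediateField ℚ Ω)) _
  have : IsAbelianGalois ℚ (IntermediateField.restrict (le_sup_right : F ≤ E ⊔ F)) :=
    IsAbelianGalois.rat_intermediateField (L := (E ⊔ F : IntermediateField ℚ Ω)) _
  have h1 : ramIdx p (IntermediateField.restrict (le_sup_left : E ≤ E ⊔ F)) = 1 :=
    Nat.dvd_one.1 (hE ▸ ramIdx_dvd_of_ringHom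
      (IntermediateField.restrictAlgEquiv (le_sup_left : E ≤ E ⊔ F)).symm.toRingHom hp)
  have h2 : ramIdx p (IntermediateField.restrict (le_sup_right : F ≤ E ⊔ F)) = 1 :=
    Nat.dvd_one.1 (hF ▸ ramIdx_dvd_of_ringHom
      (IntermediateField.restrictAlgEquiv (le_sup_right : F ≤ E ⊔ F)).symm.toRingHom hp)
  exact ramIdx_eq_one_of_sup_eq_top (restrict_sup_restrict E F) hp h1 h2

variable {E F} in
theorem gal_sup_eq_one {σ : Gal((E ⊔ F : IntermediateField ℚ Ω)/ℚ)}
    (hE : ∀ x : E, σ (IntermediateField.inclusion le_sup_left x) =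
      IntermediateField.inclusion le_sup_left x)
    (hF : ∀ x : F, σ (IntermediateField.inclusion le_sup_right x) =
      IntermediateField.inclusion le_sup_right x) : σ = 1 := by
  have hle : IntermediateField.restrict (le_sup_left : E ≤ E ⊔ F) ⊔
      IntermediateField.restrict (le_sup_right : F ≤ E ⊔ F) ≤
        IntermediateField.fixedField (Subgroup.zpowers σ) := by
    refine sup_le ?_ ?_ <;> intro x hx <;>
      refine (IntermediateField.mem_fixedField_iff _ _).2
        (Subgroup.forall_mem_zpowers.2 fun k ↦ ?_) <;>
      rw [IntermediateField.mem_restrict] at hx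
    · exact zpow_mem (show σ ∈ MulAction.stabilizer Gal((E ⊔ F : IntermediateField ℚ Ω)/ℚ) x
        from hE ⟨x, hx⟩) k
    · exact zpow_mem (show σ ∈ MulAction.stabilizer Gal((E ⊔ F : IntermediateField ℚ Ω)/ℚ) x
        from hF ⟨x, hx⟩) k
  rw [restrict_sup_restrict] at hle
  ext x
  have := hle (IntermediateField.mem_top (x := x))
  exact congr_arg _ ((IntermediateField.mem_fixedField_iff _ _).1 this _ (Subgroup.mem_zpowers _))

theorem exists_gal_sup_hom [IsAbelianGalois ℚ E] [IsAbelianGalois ℚ F] :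
    ∃ f : Gal((E ⊔ F : IntermediateField ℚ Ω)/ℚ) →* Gal(E/ℚ) × Gal(F/ℚ),
      Function.Injective f := by
  let := (IntermediateField.inclusion (le_sup_left : E ≤ E ⊔ F)).toRingHom.toAlgebra
  let := (IntermediateField.inclusion (le_sup_right : F ≤ E ⊔ F)).toRingHom.toAlgebra
  refine ⟨(AlgEquiv.restrictNormalHom E).prod (AlgEquiv.restrictNormalHom F), ?_⟩
  rw [injective_iff_map_eq_one]
  intro σ hσ
  obtain ⟨h₁, h₂⟩ := Prod.ext_iff.1 hσ
  refine gal_sup_eq_one (fun x ↦ ?_) (fun x ↦ ?_)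
  · exact (AlgEquiv.restrictNormal_commutes σ E x).symm.trans
      (congr_arg (algebraMap _ _) (DFunLike.congr_fun h₁ x))
  · exact (AlgEquiv.restrictNormal_commutes σ F x).symm.trans
      (congr_arg (algebraMap _ _) (DFunLike.congr_fun h₂ x))

theorem pow_eq_one_of_sup [IsAbelianGalois ℚ E] [IsAbelianGalois ℚ F] {n : ℕ}
    (σ : Gal((E ⊔ F : IntermediateField ℚ Ω)/ℚ))
    (hE : ∀ τ : Gal(E/ℚ), τ ^ n = 1) (hF : ∀ τ : Gal(F/ℚ), τ ^ n = 1) : σ ^ n = 1 := by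
  obtain ⟨f, hf⟩ := exists_gal_sup_hom E F
  apply hf
  rw [map_pow, map_one]
  exact Prod.ext (hE _) (hF _)

theorem finrank_sup_dvd [NumberField E] [NumberField F] [IsAbelianGalois ℚ E]
    [IsAbelianGalois ℚ F] : Module.finrank ℚ (E ⊔ F : IntermediateField ℚ Ω) ∣
      Module.finrank ℚ E * Module.finrank ℚ F := by
  obtain ⟨f, hf⟩ := exists_gal_sup_hom E F
  rw [← IsGalois.card_aut_eq_finrank, ← IsGalois.card_aut_eq_finrank ℚ E,
    ← IsGalois.card_aut_eq_finrank ℚ F, ← Nat.card_prod]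
  exact Subgroup.card_dvd_of_injective f hf

end Compositum

section PrimaryDecomposition

theorem exists_subgroup_inf_eq_bot {G : Type*} [CommGroup G] [Finite G] {p k b : ℕ}
    (hp : p.Prime) (hb : ¬ p ∣ b) (hcard : Nat.card G = p ^ k * b) :
    ∃ P H : Subgroup G, P.index = b ∧ H.index = p ^ k ∧ P ⊓ H = ⊥ := by
  have : Fact p.Prime := ⟨hp⟩
  obtain ⟨P, hP⟩ := Sylow.exists_subgroup_card_pow_prime p (hcard ▸ Dvd.intro b rfl)
  have hPi : P.index = b := by
    have := P.card_mul_index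
    rw [hP, hcard] at this
    exact Nat.eq_of_mul_eq_mul_left (pow_pos hp.pos k) this
  obtain ⟨H, hH⟩ := Subgroup.exists_right_complement'_of_coprime (N := P)
    (by rw [hP, hPi]; exact Nat.Coprime.pow_left k ((Nat.Prime.coprime_iff_not_dvd hp).2 hb))
  exact ⟨P, H, hPi, hP ▸ hH.index_eq_card, hH.disjoint.eq_bot⟩

variable {L : Type*} [Field L] [NumberField L] {p k b : ℕ}

theorem exists_intermediateField_sup_eq_top [IsAbelianGalois ℚ L] (hp : p.Prime) (hb : ¬ p ∣ b)
    (hcard : Module.finrank ℚ L = p ^ k * b) : ∃ E F : IntermediateField ℚ L,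
      Module.finrank ℚ E = p ^ k ∧ Module.finrank ℚ F = b ∧ E ⊔ F = ⊤ := by
  let : CommGroup Gal(L/ℚ) := { mul_comm := mul_comm' }
  obtain ⟨P, H, hP, hH, hPH⟩ := exists_subgroup_inf_eq_bot hp hb
    ((IsGalois.card_aut_eq_finrank ℚ L).trans hcard)
  have hfix (N : Subgroup Gal(L/ℚ)) : (IntermediateField.fixedField N).fixingSubgroup = N :=
    IntermediateField.fixingSubgroup_fixedField N
  have hfin (N : Subgroup Gal(L/ℚ)) :
      Module.finrank ℚ (IntermediateField.fixedField N) = N.index := by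
    rw [IntermediateField.finrank_eq_fixingSubgroup_index, hfix]
  refine ⟨IntermediateField.fixedField H, IntermediateField.fixedField P, (hfin H).trans hH,
    (hfin P).trans hP, ?_⟩
  rw [← IsGalois.fixedField_fixingSubgroup
    (IntermediateField.fixedField H ⊔ IntermediateField.fixedField P),
    IntermediateField.fixingSubgroup_sup, hfix, hfix, inf_comm, hPH,
    IntermediateField.fixedField_bot]

variable {Ω : Type*} [Field Ω] [CharZero Ω] (F : IntermediateField ℚ Ω)

theorem finrank_lift (E : IntermediateField ℚ F) :
    Module.finrank ℚ (IntermediateField.lift E) = Module.finrank ℚ E :=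
  (IntermediateField.liftAlgEquiv E).symm.toLinearEquiv.finrank_eq

theorem ramIdx_lift [NumberField F] [IsAbelianGalois ℚ F] (E : IntermediateField ℚ F)
    (hp : p.Prime) (hE : ramIdx p E = 1) [NumberField (IntermediateField.lift E)]
    [IsAbelianGalois ℚ (IntermediateField.lift E)] : ramIdx p (IntermediateField.lift E) = 1 :=
  Nat.dvd_one.1 (hE ▸ ramIdx_dvd_of_ringHom (IntermediateField.liftAlgEquiv E).symm.toRingHom hp)

theorem exists_intermediateField_sup_eq [NumberField F] [IsAbelianGalois ℚ F] (hp : p.Prime)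
    (hb : ¬ p ∣ b) (hcard : Module.finrank ℚ F = p ^ k * b) : ∃ A B : IntermediateField ℚ Ω,
      Module.finrank ℚ A = p ^ k ∧ Module.finrank ℚ B = b ∧ A ⊔ B = F := by
  obtain ⟨A, B, hA, hB, hAB⟩ := exists_intermediateField_sup_eq_top hp hb hcard
  refine ⟨IntermediateField.lift A, IntermediateField.lift B, (finrank_lift F A).trans hA,
    (finrank_lift F B).trans hB, ?_⟩
  have := congr_arg IntermediateField.lift hAB
  exact (IntermediateField.lift_sup ℚ F A B).symm.trans
    (this.trans (IntermediateField.lift_top ℚ F))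

end PrimaryDecomposition

section PrimePower

variable {Ω : Type*} [Field Ω] [CharZero Ω] [IsAlgClosed Ω] {p m : ℕ}

theorem ramIdx_cyc_of_not_dvd {n : ℕ} [NeZero n] (hp : p.Prime) (h : ¬ p ∣ n) :
    ramIdx p (cyc ℚ Ω n) = 1 :=
  ramIdx_cyclotomic_of_not_dvd (n := n) hp h

theorem finrank_eq_exponent {L : Type*} [Field L] [NumberField L] [IsGalois ℚ L]
    [IsCyclic Gal(L/ℚ)] : Module.finrank ℚ L = Monoid.exponent Gal(L/ℚ) := by
  rw [IsCyclic.exponent_eq_card, IsGalois.card_aut_eq_finrank]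

theorem exists_finrank_eq_prime_pow {L : Type*} [Field L] [NumberField L] [IsGalois ℚ L]
    (hp : p.Prime) (h : ∀ σ : Gal(L/ℚ), σ ^ p ^ m = 1) : ∃ k, Module.finrank ℚ L = p ^ k := by
  have : Fact p.Prime := ⟨hp⟩
  obtain ⟨k, hk⟩ := IsPGroup.iff_card.1 (fun σ : Gal(L/ℚ) ↦ ⟨m, h σ⟩)
  exact ⟨k, (IsGalois.card_aut_eq_finrank ℚ L).symm.trans hk⟩

theorem pow_finrank_eq_one {L : Type*} [Field L] [NumberField L] [IsGalois ℚ L]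
    (σ : Gal(L/ℚ)) : σ ^ Module.finrank ℚ L = 1 := by
  rw [← IsGalois.card_aut_eq_finrank]
  exact pow_card_eq_one'

theorem le_cyc_of_odd_prime (F : IntermediateField ℚ Ω) [NumberField F] [IsAbelianGalois ℚ F]
    (hp : p.Prime) (hp2 : p ≠ 2) (hcard : Module.finrank ℚ F = p ^ m)
    (hram : ∀ q, q.Prime → q ≠ p → ramIdx q F = 1) : F ≤ cyc ℚ Ω (p ^ (m + 1)) := by
  have : NeZero (p ^ (m + 1)) := ⟨pow_ne_zero _ hp.ne_zero⟩
  obtain ⟨C, D, hC, -, hCD⟩ := exists_intermediateField_sup_eq (cyc ℚ Ω (p ^ (m + 1))) hp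
    (b := p - 1) (k := m) (Nat.not_dvd_of_pos_of_lt
      (by have := hp.two_le; lia) (by have := hp.two_le; lia))
    (by rw [finrank_cyc, Nat.totient_prime_pow_succ hp])
  have hCle : C ≤ cyc ℚ Ω (p ^ (m + 1)) := hCD ▸ le_sup_left
  have : NumberField C := NumberField.of_le hCle
  have : IsAbelianGalois ℚ C := IsAbelianGalois.rat_of_le hCle
  have hramC : ∀ q, q.Prime → q ≠ p → ramIdx q C = 1 := fun q hq hqp ↦
    Nat.dvd_one.1 (ramIdx_cyc_of_not_dvd (Ω := Ω) (n := p ^ (m + 1)) hq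
      (fun h ↦ hqp ((Nat.prime_dvd_prime_iff_eq hq hp).1 (hq.dvd_of_dvd_pow h))) ▸
        ramIdx_dvd_of_le hCle hq)
  have hpow (σ : Gal((F ⊔ C : IntermediateField ℚ Ω)/ℚ)) : σ ^ p ^ m = 1 :=
    pow_eq_one_of_sup F C σ (fun τ ↦ hcard ▸ pow_finrank_eq_one τ)
      (fun τ ↦ hC ▸ pow_finrank_eq_one τ)
  obtain ⟨k, hk⟩ := exists_finrank_eq_prime_pow hp hpow
  have := isCyclic_gal_of_odd_prime hp hp2 hk fun q hq hqp ↦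
    ramIdx_sup_eq_one F C hq (hram q hq hqp) (hramC q hq hqp)
  have hle : Module.finrank ℚ (F ⊔ C : IntermediateField ℚ Ω) ≤ p ^ m := by
    rw [finrank_eq_exponent]
    exact Nat.le_of_dvd (pow_pos hp.pos m) (Monoid.exponent_dvd_of_forall_pow_eq_one hpow)
  have heq : C = F ⊔ C := IntermediateField.eq_of_le_of_finrank_le le_sup_right (hC ▸ hle)
  exact (heq ▸ le_sup_left : F ≤ C).trans hCle

theorem two_pow_dvd_pow_sub_one {a : ℤ} (ha : Odd a) (m : ℕ) :
    2 ^ (m + 3) ∣ a ^ 2 ^ (m + 1) - 1 := by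
  induction m with
  | zero => simpa using Int.eight_dvd_sq_sub_one_of_odd ha
  | succ m ih =>
    have h : a ^ 2 ^ (m + 1 + 1) - 1 = (a ^ 2 ^ (m + 1) - 1) * (a ^ 2 ^ (m + 1) + 1) := by ring
    rw [h, show m + 1 + 3 = (m + 3) + 1 by ring, pow_succ]
    exact mul_dvd_mul ih (Odd.add_one (ha.pow)).two_dvd

theorem pow_eq_one_of_cyc_two_pow (τ : Gal(cyc ℚ Ω (2 ^ (m + 3))/ℚ)) : τ ^ 2 ^ (m + 1) = 1 := by
  let e := IsCyclotomicExtension.autEquivPow (n := 2 ^ (m + 3)) (K := ℚ) (cyc ℚ Ω (2 ^ (m + 3)))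
    (Polynomial.cyclotomic.irreducible_rat (NeZero.pos _))
  apply e.injective
  rw [map_pow, map_one]
  generalize e τ = u
  ext
  rw [Units.val_pow_eq_pow_val, Units.val_one]
  obtain ⟨a, ha⟩ := ZMod.intCast_surjective (u : ZMod (2 ^ (m + 3)))
  have hodd : Odd a := by
    have h : IsUnit (a : ZMod (2 ^ (m + 3))) := ha ▸ u.isUnit
    rw [ZMod.coe_int_isUnit_iff_isCoprime] at h
    rw [← Int.not_even_iff_odd, even_iff_two_dvd]
    intro h2
    have h3 := h.isUnit_of_dvd' (x := 2) (by push_cast; exact dvd_pow_self 2 (by lia)) h2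
    exact absurd (Int.isUnit_iff.1 h3) (by norm_num)
  rw [← ha, ← sub_eq_zero]
  have := two_pow_dvd_pow_sub_one hodd m
  have h := (ZMod.intCast_zmod_eq_zero_iff_dvd (a ^ 2 ^ (m + 1) - 1) (2 ^ (m + 3))).2
    (by exact_mod_cast this)
  exact_mod_cast h

theorem le_cyc_two (F : IntermediateField ℚ ℂ) [NumberField F] [IsAbelianGalois ℚ F]
    (hcard : Module.finrank ℚ F = 2 ^ m)
    (hram : ∀ q, q.Prime → q ≠ 2 → ramIdx q F = 1) : F ≤ cyc ℚ ℂ (2 ^ (m + 2)) := by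
  rcases m with - | m
  · rw [IntermediateField.finrank_eq_one_iff.1 hcard]
    exact bot_le
  let C := cyc ℚ ℂ (2 ^ (m + 3))
  let L := F ⊔ C
  have hramC : ∀ q, q.Prime → q ≠ 2 → ramIdx q C = 1 := fun q hq hq2 ↦
    ramIdx_cyc_of_not_dvd hq
      (fun h ↦ hq2 ((Nat.prime_dvd_prime_iff_eq hq Nat.prime_two).1 (hq.dvd_of_dvd_pow h)))
  have hpow (σ : Gal(L/ℚ)) : σ ^ 2 ^ (m + 1) = 1 :=
    pow_eq_one_of_sup F C σ (fun τ ↦ hcard ▸ pow_finrank_eq_one τ) pow_eq_one_of_cyc_two_pow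
  have hramL (q : ℕ) (hq : q.Prime) (hq2 : q ≠ 2) : ramIdx q L = 1 :=
    ramIdx_sup_eq_one F C hq (hram q hq hq2) (hramC q hq hq2)
  let c : Gal(L/ℚ) := AlgEquiv.restrictNormal (Complex.conjAe.restrictScalars ℚ) L
  have hc (x : L) : ((c x : L) : ℂ) = starRingEnd ℂ x :=
    AlgEquiv.restrictNormal_commutes (Complex.conjAe.restrictScalars ℚ) L x
  have hc2 : c ^ 2 = 1 := by
    ext x
    rw [sq, AlgEquiv.mul_apply, hc, hc, Complex.conj_conj]
    rfl
  let E := IntermediateField.fixedField (Subgroup.zpowers c)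
  have hEL : Module.finrank E L ≤ 2 := by
    rw [IntermediateField.finrank_fixedField_eq_card, Nat.card_zpowers]
    exact orderOf_le_of_pow_eq_one two_pos hc2
  have hpowE (σ : Gal(E/ℚ)) : σ ^ 2 ^ (m + 1) = 1 := by
    obtain ⟨τ, rfl⟩ := AlgEquiv.restrictNormalHom_surjective L (F := ℚ) (K₁ := E) σ
    rw [← map_pow, hpow, map_one]
  obtain ⟨k, hk⟩ := exists_finrank_eq_prime_pow Nat.prime_two hpowE
  have hreal (x : E) (d : ℤ) (hx : x ^ 2 = d) : 0 ≤ d := by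
    have h1 : c x = x := (IntermediateField.mem_fixedField_iff _ _).1 x.2 _ (Subgroup.mem_zpowers c)
    have h2 : starRingEnd ℂ ((x : L) : ℂ) = ((x : L) : ℂ) := by rw [← hc, h1]
    obtain ⟨r, hr⟩ := Complex.conj_eq_iff_real.1 h2
    have h3 : ((x : L) : ℂ) ^ 2 = d := by exact_mod_cast congr_arg (fun y : E ↦ ((y : L) : ℂ)) hx
    rw [hr] at h3
    have h4 : r ^ 2 = d := by exact_mod_cast h3
    exact_mod_cast h4 ▸ sq_nonneg r
  have := isCyclic_gal_two hk (fun q hq hq2 ↦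
    ramIdx_intermediateField_eq_one E hq (hramL q hq hq2)) hreal
  have hle : Module.finrank ℚ E ≤ 2 ^ (m + 1) := by
    rw [finrank_eq_exponent]
    exact Nat.le_of_dvd (by positivity) (Monoid.exponent_dvd_of_forall_pow_eq_one hpowE)
  have hL : Module.finrank ℚ L ≤ Module.finrank ℚ C := by
    rw [← Module.finrank_mul_finrank ℚ E L, finrank_cyc,
      Nat.totient_prime_pow_succ Nat.prime_two]
    calc _ ≤ 2 ^ (m + 1) * 2 := Nat.mul_le_mul hle hEL
      _ = _ := by ring
  have heq : C = L := IntermediateField.eq_of_le_of_finrank_le le_sup_right hL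
  exact (le_sup_left : F ≤ L).trans heq.ge

end PrimePower

section KroneckerWeber

open NumberField

theorem ramIdx_eq_one_of_not_dvd_discr {L : Type*} [Field L] [NumberField L] [IsGalois ℚ L]
    {p : ℕ} (hp : p.Prime) (h : ¬ (p : ℤ) ∣ discr L) : ramIdx p L = 1 := by
  have := span_natCast_isPrime hp
  obtain ⟨P, _, _⟩ := exists_isPrime_liesOver L hp
  rw [not_dvd_discr_iff_isUnramifiedIn L (𝓞 L) (Nat.prime_iff_prime_int.1 hp),
    Algebra.isUnramifiedIn_iff_forall_ramificationIdx_eq_one] at h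
  exact (Ideal.ramificationIdxIn_eq_ramificationIdx (Ideal.span {(p : ℤ)}) P Gal(L/ℚ)).trans
    (h P inferInstance)

variable {p m : ℕ}

theorem exists_le_cyc_of_finrank_eq_prime_pow (hp : p.Prime) (S : Finset ℕ) :
    ∀ (F : IntermediateField ℚ ℂ) [NumberField F] [IsAbelianGalois ℚ F] (m : ℕ),
    Module.finrank ℚ F = p ^ m → (∀ q, q.Prime → q ≠ p → q ∉ S → ramIdx q F = 1) →
    ∃ n ≠ 0, F ≤ cyc ℚ ℂ n := by
  induction S using Finset.induction with
  | empty =>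
    intro F _ _ m hF hram
    by_cases hp2 : p = 2
    · subst hp2
      exact ⟨_, pow_ne_zero _ two_ne_zero, le_cyc_two F hF fun q hq hqp ↦ hram q hq hqp (by simp)⟩
    · exact ⟨_, pow_ne_zero _ hp.ne_zero,
        le_cyc_of_odd_prime F hp hp2 hF fun q hq hqp ↦ hram q hq hqp (by simp)⟩
  | insert q S hqS ih =>
    intro F _ _ m hF hram
    by_cases h0 : q.Prime ∧ q ≠ p
    swap
    · refine ih F m hF fun r hr hrp hrS ↦ hram r hr hrp ?_
      rw [Finset.mem_insert, not_or]
      refine ⟨?_, hrS⟩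
      rintro rfl
      exact h0 ⟨hr, hrp⟩
    obtain ⟨hq, hqp⟩ := h0
    have : NeZero q := ⟨hq.ne_zero⟩
    have hq1 : 1 < q := hq.one_lt
    let C := cyc ℚ ℂ q
    have hC : Module.finrank ℚ C = q - 1 := (finrank_cyc q).trans (Nat.totient_prime hq)
    let L := F ⊔ C
    have hdvd : Module.finrank ℚ L ∣ p ^ m * (q - 1) := by
      rw [← hF, ← hC]
      exact finrank_sup_dvd F C
    have hqL : ¬ q ∣ Module.finrank ℚ L := fun h ↦ by
      rcases hq.dvd_mul.1 (h.trans hdvd) with h | h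
      · exact hqp ((Nat.prime_dvd_prime_iff_eq hq hp).1 (hq.dvd_of_dvd_pow h))
      · exact absurd (Nat.le_of_dvd (by lia) h) (by lia)
    obtain ⟨E, hEL, hqE⟩ := exists_intermediateField_finrank_eq_ramIdx (L := L) hq
    let F' := IntermediateField.lift E
    have hF'L : F' ≤ L := IntermediateField.lift_le E
    have : NumberField F' := NumberField.of_le hF'L
    have : IsAbelianGalois ℚ F' := IsAbelianGalois.rat_of_le hF'L
    have hqF' : ramIdx q F' = 1 := ramIdx_lift L E hq hqE
    have hinf : F' ⊓ C = ⊥ := by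
      have : NumberField (F' ⊓ C : IntermediateField ℚ ℂ) := NumberField.of_le inf_le_left
      have : IsAbelianGalois ℚ (F' ⊓ C : IntermediateField ℚ ℂ) :=
        IsAbelianGalois.rat_of_le inf_le_left
      refine IntermediateField.finrank_eq_one_iff.1 (finrank_eq_one_of_ramIdx_eq_one fun r hr ↦ ?_)
      by_cases hrq : r = q
      · subst hrq
        exact Nat.dvd_one.1 (hqF' ▸ ramIdx_dvd_of_le inf_le_left hr)
      · have h1 : ramIdx r C = 1 := ramIdx_cyc_of_not_dvd hr
          (fun h ↦ hrq ((Nat.prime_dvd_prime_iff_eq hr hq).1 h))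
        exact Nat.dvd_one.1 (h1 ▸ ramIdx_dvd_of_le inf_le_right hr)
    have hsup : Module.finrank ℚ (F' ⊔ C : IntermediateField ℚ ℂ) =
        Module.finrank ℚ F' * (q - 1) := by
      rw [← hC]
      have : @IsGalois ℚ _ F' _ F'.algebra' := (inferInstance : IsGalois ℚ F')
      have : @FiniteDimensional ℚ F' _ _ F'.module' := (inferInstance : FiniteDimensional ℚ F')
      exact (IntermediateField.LinearDisjoint.of_inf_eq_bot hinf).finrank_sup
    have hle : F' ⊔ C ≤ L := sup_le hF'L le_sup_right
    have hLF' : Module.finrank ℚ L = Module.finrank ℚ F' * ramIdx q L := by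
      rw [← hEL, finrank_lift, Module.finrank_mul_finrank]
    have heq : F' ⊔ C = L := by
      refine IntermediateField.eq_of_le_of_finrank_le hle ?_
      rw [hsup, hLF']
      exact Nat.mul_le_mul_left _ (ramIdx_le_of_not_dvd hq hqL)
    obtain ⟨m', -, hm'⟩ : ∃ m' ≤ m, Module.finrank ℚ F' = p ^ m' := by
      refine (Nat.dvd_prime_pow hp).1 ?_
      rw [← heq, hsup] at hdvd
      exact Nat.dvd_of_mul_dvd_mul_right (by lia) hdvd
    obtain ⟨n, hn, hnF'⟩ := ih F' m' hm' fun r hr hrp hrS ↦ by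
      by_cases hrq : r = q
      · rwa [hrq]
      · have h1 : ramIdx r C = 1 := ramIdx_cyc_of_not_dvd hr
          (fun h ↦ hrq ((Nat.prime_dvd_prime_iff_eq hr hq).1 h))
        have h2 : ramIdx r L = 1 := ramIdx_sup_eq_one F C hr
          (hram r hr hrp (by simp [hrq, hrS])) h1
        exact Nat.dvd_one.1 (h2 ▸ ramIdx_dvd_of_le hF'L hr)
    have : NeZero n := ⟨hn⟩
    refine ⟨n.lcm q, Nat.lcm_ne_zero hn hq.ne_zero, ?_⟩
    rw [← cyc_sup]
    calc F ≤ L := le_sup_left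
      _ = F' ⊔ C := heq.symm
      _ ≤ _ := sup_le_sup_right hnF' C

/-- The Kronecker–Weber theorem. -/
theorem exists_le_cyc (F : IntermediateField ℚ ℂ) [NumberField F] [IsAbelianGalois ℚ F] :
    ∃ n ≠ 0, F ≤ cyc ℚ ℂ n := by
  induction hN : Module.finrank ℚ F using Nat.strong_induction_on generalizing F with
  | _ N ih =>
    by_cases h1 : N = 1
    · rw [h1] at hN
      exact ⟨1, one_ne_zero, IntermediateField.finrank_eq_one_iff.1 hN ▸ bot_le⟩
    obtain ⟨p, hp, hpN⟩ := Nat.exists_prime_and_dvd h1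
    have hN0 : N ≠ 0 := hN ▸ Module.finrank_pos.ne'
    obtain ⟨k, b, hb, hNk⟩ := Nat.exists_eq_pow_mul_and_not_dvd hN0 p hp.ne_one
    have hk : k ≠ 0 := by
      rintro rfl
      exact hb (by simpa [hNk] using hpN)
    obtain ⟨A, B, hA, hB, hAB⟩ := exists_intermediateField_sup_eq F hp hb (hN.trans hNk)
    have hAF : A ≤ F := hAB ▸ le_sup_left
    have hBF : B ≤ F := hAB ▸ le_sup_right
    have : NumberField A := NumberField.of_le hAF
    have : IsAbelianGalois ℚ A := IsAbelianGalois.rat_of_le hAF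
    have : NumberField B := NumberField.of_le hBF
    have : IsAbelianGalois ℚ B := IsAbelianGalois.rat_of_le hBF
    obtain ⟨n₁, hn₁, hA'⟩ := exists_le_cyc_of_finrank_eq_prime_pow hp
      (discr A).natAbs.primeFactors A k hA fun q hq _ hqS ↦
        ramIdx_eq_one_of_not_dvd_discr hq fun h ↦ hqS (by
          rw [Nat.mem_primeFactors]
          exact ⟨hq, Int.natCast_dvd.1 h, by simpa using discr_ne_zero A⟩)
    obtain ⟨n₂, hn₂, hB'⟩ := ih b (by
      rw [hNk]
      exact lt_mul_of_one_lt_left (Nat.pos_of_ne_zero fun h ↦ hb (h ▸ dvd_zero p))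
        (Nat.one_lt_pow hk hp.one_lt)) B hB
    have : NeZero n₁ := ⟨hn₁⟩
    have : NeZero n₂ := ⟨hn₂⟩
    refine ⟨n₁.lcm n₂, Nat.lcm_ne_zero hn₁ hn₂, ?_⟩
    rw [← cyc_sup, ← hAB]
    exact sup_le_sup hA' hB'

end KroneckerWeber

section Transfer

variable {Ω : Type*} [Field Ω] [CharZero Ω]

/-- The Kronecker–Weber theorem, inside any algebraically closed field of characteristic zero. -/
theorem exists_le_cyc_of_isAlgClosed [IsAlgClosed Ω] (F : IntermediateField ℚ Ω) [NumberField F]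
    [hF : IsAbelianGalois ℚ F] : ∃ n ≠ 0, F ≤ cyc ℚ Ω n := by
  let j : F →ₐ[ℚ] ℂ := IsAlgClosed.lift
  let e : F ≃ₐ[ℚ] j.fieldRange := AlgEquiv.ofInjectiveField j
  have : NumberField j.fieldRange :=
    { to_charZero := inferInstance
      to_finiteDimensional := Module.Finite.equiv e.toLinearEquiv }
  have : IsAbelianGalois ℚ j.fieldRange := .of_algHom e.symm.toAlgHom
  obtain ⟨n, hn, hle⟩ := exists_le_cyc j.fieldRange
  have : NeZero n := ⟨hn⟩
  let ψ : F →ₐ[ℚ] cyc ℚ Ω n := (IsCyclotomicExtension.algEquiv {n} ℚ (cyc ℚ ℂ n)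
    (cyc ℚ Ω n)).toAlgHom.comp ((IntermediateField.inclusion hle).toRingHom.toRatAlgHom.comp
      e.toAlgHom)
  refine ⟨n, hn, fun x hx ↦ ?_⟩
  have hrange : ((cyc ℚ Ω n).val.comp ψ).fieldRange = F :=
    have : Normal ℚ F := inferInstance
    @AlgHom.fieldRange_of_normal ℚ Ω _ _ _ F this _
  rw [← hrange] at hx
  obtain ⟨y, rfl⟩ := hx
  exact (ψ y).2

end Transfer

section MaxAb

variable {K Ω : Type*} [Field K] [CharZero K]

theorem maxAb.isAbelianGalois : IsAbelianGalois ℚ (maxAb K) := by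
  have h (F : {F : IntermediateField ℚ K |
      IsGalois ℚ ↥F ∧ ∀ σ τ : ↥F ≃ₐ[ℚ] ↥F, σ * τ = τ * σ}) :
      IsAbelianGalois ℚ (F : IntermediateField ℚ K) :=
    have := F.2.1
    { is_comm := ⟨F.2.2⟩ }
  have := IsAbelianGalois.iSup (k := ℚ) (K := K) (h := h)
  rwa [iSup_subtype] at this

theorem le_maxAb (F : IntermediateField ℚ K) [h : IsAbelianGalois ℚ F] : F ≤ maxAb K :=
  le_iSup₂_of_le F ⟨inferInstance, mul_comm'⟩ le_rfl

variable [Field Ω] [CharZero Ω] [Algebra K Ω]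

theorem isAbelianGalois_comap (F : IntermediateField ℚ Ω) [IsAbelianGalois ℚ F] :
    IsAbelianGalois ℚ (F.comap (IsScalarTower.toAlgHom ℚ K Ω)) := by
  let φ : F.comap (IsScalarTower.toAlgHom ℚ K Ω) →+* F :=
    (algebraMap K Ω).restrict _ _ fun x hx ↦ hx
  exact .of_algHom φ.toRatAlgHom

theorem conductorAb_set_nonempty [IsAlgClosed Ω] (hfin : FiniteDimensional ℚ (maxAb K)) :
    {f | 0 < f ∧ (maxAb K).map (IsScalarTower.toAlgHom ℚ K Ω) ≤ cyc ℚ Ω f}.Nonempty := by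
  let M := (maxAb K).map (IsScalarTower.toAlgHom ℚ K Ω)
  let e : maxAb K ≃ₐ[ℚ] M := IntermediateField.equivMap _ _
  have : NumberField M :=
    { to_charZero := inferInstance
      to_finiteDimensional := Module.Finite.equiv e.toLinearEquiv }
  have := maxAb.isAbelianGalois (K := K)
  have : IsAbelianGalois ℚ M := .of_algHom e.symm.toAlgHom
  obtain ⟨n, hn, h⟩ := exists_le_cyc_of_isAlgClosed M
  exact ⟨n, Nat.pos_of_ne_zero hn, h⟩

end MaxAb

section GaloisAction

variable {K Ω : Type*} [Field K] [Field Ω] [Algebra K Ω] {N : ℕ}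

theorem cyc_algHom_ext {φ ψ : cyc K Ω N →ₐ[K] Ω}
    (h : ∀ z (hz : z ^ N = 1), φ ⟨z, mem_cyc hz⟩ = ψ ⟨z, mem_cyc hz⟩) : φ = ψ :=
  IntermediateField.algHom_ext_of_eq_adjoin _ rfl fun z hz ↦ h z hz

theorem gal_apply_eq_of_mem_cyc {y : Ω} (hy : y ∈ cyc K Ω N) {g h : Gal(Ω/K)}
    (hgh : ∀ z, z ^ N = 1 → g z = h z) : g y = h y :=
  DFunLike.congr_fun (cyc_algHom_ext (φ := g.toAlgHom.comp (cyc K Ω N).val)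
    (ψ := h.toAlgHom.comp (cyc K Ω N).val) hgh) ⟨y, hy⟩

theorem IsPrimitiveRoot.modEq_of_pow_eq {ζ : Ω} (hζ : IsPrimitiveRoot ζ N) (hN : N ≠ 0) {a b : ℕ}
    (h : ζ ^ a = ζ ^ b) : a ≡ b [MOD N] := by
  lift ζ to Ωˣ using hζ.isUnit hN
  rw [IsPrimitiveRoot.coe_units_iff] at hζ
  rw [hζ.eq_orderOf, ← pow_eq_pow_iff_modEq]
  exact_mod_cast h

theorem isGalois_of_isAlgClosed [CharZero K] [IsAlgClosed Ω]
    [Algebra.IsAlgebraic K Ω] : IsGalois K Ω :=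
  have : IsAlgClosure K Ω := ⟨inferInstance, inferInstance⟩
  { to_normal := IsAlgClosure.normal K Ω }

theorem mem_range_of_forall_gal [CharZero K] [IsAlgClosed Ω] [Algebra.IsAlgebraic K Ω] {y : Ω}
    (h : ∀ g : Gal(Ω/K), g y = y) :
    y ∈ Set.range (algebraMap K Ω) :=
  have := isGalois_of_isAlgClosed (K := K) (Ω := Ω)
  (InfiniteGalois.mem_range_algebraMap_iff_fixed y).2 h

theorem mem_cyc_of_forall_gal [CharZero K] [IsAlgClosed Ω] [Algebra.IsAlgebraic K Ω] {y : Ω}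
    (h : ∀ g : Gal(Ω/K), (∀ z, z ^ N = 1 → g z = z) → g y = y) : y ∈ cyc K Ω N := by
  have := isGalois_of_isAlgClosed (K := K) (Ω := Ω)
  rw [← InfiniteGalois.fixedField_fixingSubgroup (cyc K Ω N)]
  refine (IntermediateField.mem_fixedField_iff _ _).2 fun g hg ↦ h g fun z hz ↦ ?_
  exact (IntermediateField.mem_fixingSubgroup_iff _ _).1 hg z (mem_cyc hz)

variable [CharZero Ω] [IsAlgClosed Ω]

theorem exists_gal_pow_eq [NeZero N] (g : Ω →+* Ω) :
    ∃ u : ℕ, u.Coprime N ∧ ∀ z : Ω, z ^ N = 1 → g z = z ^ u := by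
  obtain ⟨ζ, hζ⟩ := exists_isPrimitiveRoot Ω N
  have hg : IsPrimitiveRoot (g ζ) N := hζ.map_of_injective g.injective
  obtain ⟨u, -, hu⟩ := hζ.eq_pow_of_pow_eq_one hg.pow_eq_one
  refine ⟨u, (hζ.pow_iff_coprime (NeZero.pos N) u).1 (hu ▸ hg), fun z hz ↦ ?_⟩
  obtain ⟨i, -, rfl⟩ := hζ.eq_pow_of_pow_eq_one hz
  rw [map_pow, ← hu, ← pow_mul, ← pow_mul, mul_comm]

variable (Ω) in
theorem exists_gal_cyc_pow_eq [NeZero N] {u : ℕ} (hu : u.Coprime N) :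
    ∃ σ : Gal(cyc ℚ Ω N/ℚ), ∀ z (hz : z ^ N = 1), (σ ⟨z, mem_cyc hz⟩ : Ω) = z ^ u := by
  have hζ := IsCyclotomicExtension.zeta_spec N ℚ (cyc ℚ Ω N)
  have hμ := hζ.pow_of_coprime u hu
  have hirr := Polynomial.cyclotomic.irreducible_rat (NeZero.pos N)
  refine ⟨IsCyclotomicExtension.fromZetaAut hμ hirr, fun z hz ↦ ?_⟩
  have hz' : (⟨z, mem_cyc hz⟩ : cyc ℚ Ω N) ^ N = 1 := Subtype.ext hz
  obtain ⟨i, -, hi⟩ := hζ.eq_pow_of_pow_eq_one hz'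
  have hi' : z = (IsCyclotomicExtension.zeta N ℚ (cyc ℚ Ω N) : Ω) ^ i :=
    (congr_arg Subtype.val hi).symm
  rw [← hi, map_pow, IsCyclotomicExtension.fromZetaAut_spec, hi', ← pow_mul, ← pow_mul, mul_comm]
  rfl

variable [CharZero K] {f : ℕ}

/-- If the Galois group of `K` surjects onto that of `ℚ(ζ_f)/ℚ(ζ_d)`, then the maximal abelian
subextension of `K` lies in `ℚ(ζ_d)` as soon as it lies in `ℚ(ζ_f)`. -/
theorem maxAb_map_le_cyc {d : ℕ} [NeZero f] (hdf : d ∣ f)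
    (hf : (maxAb K).map (IsScalarTower.toAlgHom ℚ K Ω) ≤ cyc ℚ Ω f)
    (h : ∀ u : ℕ, u ≡ 1 [MOD d] → u.Coprime f →
      ∃ g : Gal(Ω/K), ∀ z : Ω, z ^ f = 1 → g z = z ^ u) :
    (maxAb K).map (IsScalarTower.toAlgHom ℚ K Ω) ≤ cyc ℚ Ω d := by
  intro x hx
  have hxf := hf hx
  obtain ⟨k, -, rfl⟩ := hx
  have hle := cyc_mono (F := ℚ) (Ω := Ω) hdf
  suffices hmem : (⟨_, hxf⟩ : cyc ℚ Ω f) ∈ IntermediateField.restrict hle from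
    (IntermediateField.mem_restrict hle _).1 hmem
  rw [← IsGalois.fixedField_fixingSubgroup (IntermediateField.restrict hle)]
  refine (IntermediateField.mem_fixedField_iff _ _).2 fun σ hσ ↦ Subtype.ext ?_
  obtain ⟨ζ, hζ⟩ := exists_isPrimitiveRoot Ω f
  have hζ' : IsPrimitiveRoot (⟨ζ, mem_cyc hζ.pow_eq_one⟩ : cyc ℚ Ω f) f :=
    IsPrimitiveRoot.of_map_of_injective (f := (cyc ℚ Ω f).val) hζ Subtype.val_injective
  obtain ⟨u, -, hu⟩ := hζ'.eq_pow_of_pow_eq_one (hζ'.map_of_injective σ.injective).pow_eq_one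
  have hu' (z : Ω) (hz : z ^ f = 1) : (σ ⟨z, mem_cyc hz⟩ : Ω) = z ^ u := by
    obtain ⟨i, -, rfl⟩ := hζ.eq_pow_of_pow_eq_one hz
    have : (⟨ζ ^ i, mem_cyc hz⟩ : cyc ℚ Ω f) = ⟨ζ, mem_cyc hζ.pow_eq_one⟩ ^ i := rfl
    rw [this, map_pow, ← hu, ← pow_mul, ← pow_mul, mul_comm]
    rfl
  have hcop : u.Coprime f :=
    (hζ'.pow_iff_coprime (NeZero.pos f) u).1 (hu ▸ hζ'.map_of_injective σ.injective)
  have hud : u ≡ 1 [MOD d] := by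
    obtain ⟨c, hc⟩ := id hdf
    have hd : IsPrimitiveRoot (ζ ^ c) d := hζ.pow (NeZero.pos f) (by rw [hc, mul_comm])
    have hcf : (ζ ^ c) ^ f = 1 := by rw [← pow_mul, mul_comm, pow_mul, hζ.pow_eq_one, one_pow]
    have h1 := hu' _ hcf
    have h2 : σ ⟨ζ ^ c, mem_cyc hcf⟩ = ⟨ζ ^ c, mem_cyc hcf⟩ :=
      (IntermediateField.mem_fixingSubgroup_iff _ _).1 hσ _
        ((IntermediateField.mem_restrict hle _).2 (mem_cyc hd.pow_eq_one))
    rw [h2] at h1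
    exact hd.modEq_of_pow_eq (ne_zero_of_dvd_ne_zero (NeZero.ne f) ⟨c, hc⟩)
      (h1.symm.trans (pow_one _).symm)
  obtain ⟨g, hg⟩ := h u hud hcop
  have heq : (cyc ℚ Ω f).val.comp σ.toAlgHom =
      (g.restrictScalars ℚ).toAlgHom.comp (cyc ℚ Ω f).val := cyc_algHom_ext fun z hz ↦
    (hu' z hz).trans (hg z hz).symm
  exact (DFunLike.congr_fun heq ⟨_, hxf⟩).trans (g.commutes k)

variable [Algebra.IsAlgebraic K Ω]

/-- If the maximal abelian subextension of `K` lies in `ℚ(ζ_f)`, then the Galois group of `K`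
surjects onto the Galois group of `ℚ(ζ_N)/ℚ(ζ_f)`. -/
theorem exists_gal_pow [NeZero N] (hfN : f ∣ N)
    (hf : (maxAb K).map (IsScalarTower.toAlgHom ℚ K Ω) ≤ cyc ℚ Ω f)
    {u : ℕ} (hu : u.Coprime N) (huf : u ≡ 1 [MOD f]) :
    ∃ g : Gal(Ω/K), ∀ z : Ω, z ^ N = 1 → g z = z ^ u := by
  obtain ⟨σ, hσ⟩ := exists_gal_cyc_pow_eq Ω hu
  let ρ : Gal(Ω/K) →* Gal(cyc ℚ Ω N/ℚ) :=
    (AlgEquiv.restrictNormalHom (cyc ℚ Ω N)).comp (AlgEquiv.restrictScalarsHom ℚ)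
  have hρ (g : Gal(Ω/K)) (x : cyc ℚ Ω N) : (ρ g x : Ω) = g x :=
    AlgEquiv.restrictNormal_commutes (g.restrictScalars ℚ) (cyc ℚ Ω N) x
  suffices hmem : σ ∈ ρ.range by
    obtain ⟨g, rfl⟩ := hmem
    exact ⟨g, fun z hz ↦ (hρ g ⟨z, mem_cyc hz⟩).symm.trans (hσ z hz)⟩
  rw [← IntermediateField.fixingSubgroup_fixedField ρ.range]
  refine (IntermediateField.mem_fixingSubgroup_iff _ _).2 fun x hx ↦ ?_
  obtain ⟨k, hk⟩ : (x : Ω) ∈ Set.range (algebraMap K Ω) := mem_range_of_forall_gal fun g ↦ by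
    rw [← hρ]
    exact congr_arg _ ((IntermediateField.mem_fixedField_iff _ _).1 hx _ ⟨g, rfl⟩)
  have := isAbelianGalois_comap (K := K) (cyc ℚ Ω N)
  have hkN : k ∈ (cyc ℚ Ω N).comap (IsScalarTower.toAlgHom ℚ K Ω) := by
    change algebraMap K Ω k ∈ cyc ℚ Ω N
    rw [hk]
    exact x.2
  have hxf : (x : Ω) ∈ cyc ℚ Ω f := hf ⟨k, le_maxAb _ hkN, hk⟩
  have hle := cyc_mono (F := ℚ) (Ω := Ω) hfN
  have heq : ((cyc ℚ Ω N).val.comp σ.toAlgHom).comp (IntermediateField.inclusion hle) =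
      (cyc ℚ Ω f).val := cyc_algHom_ext fun z hz ↦ by
    obtain ⟨c, hc⟩ := hfN
    refine (hσ z (by rw [hc, pow_mul, hz, one_pow])).trans ?_
    exact (pow_eq_pow_of_modEq huf hz).trans (pow_one z)
  refine Subtype.ext ?_
  exact DFunLike.congr_fun heq ⟨x, hxf⟩

end GaloisAction

section Powers

variable {K : Type*} [Field K] {x : K} {m n : ℕ}

theorem exists_pow_eq_of_pow_eq_pow (hx : x ≠ 0) (hmn : m.Coprime n) {z : K} (hz : x ^ m = z ^ n) :
    ∃ w : K, w ^ n = x := by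
  have h := Nat.gcd_eq_gcd_ab m n
  rw [hmn, Nat.cast_one] at h
  rcases eq_or_ne n 0 with rfl | hn
  · exact ⟨x, by simp_all⟩
  have hz0 : z ≠ 0 := fun h0 ↦ pow_ne_zero m hx (by rw [hz, h0, zero_pow hn])
  refine ⟨z ^ m.gcdA n * x ^ m.gcdB n, ?_⟩
  rw [mul_pow, ← zpow_natCast, ← zpow_natCast, ← zpow_mul, mul_comm _ (n : ℤ), zpow_mul,
    zpow_natCast, ← hz, ← zpow_natCast, ← zpow_mul, ← zpow_mul, mul_comm _ (n : ℤ), ← zpow_add₀ hx,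
    ← h, zpow_one]

theorem exists_pow_mul_eq (hx : x ≠ 0) (hmn : m.Coprime n) (hm : ∃ z : K, z ^ m = x)
    (hn : ∃ z : K, z ^ n = x) : ∃ z : K, z ^ (m * n) = x := by
  obtain ⟨z, rfl⟩ := hm
  obtain ⟨w, hw⟩ := hn
  have hz0 : z ^ m ≠ 0 := hx
  rcases eq_or_ne m 0 with rfl | hm0
  · exact ⟨1, by simp⟩
  obtain ⟨t, rfl⟩ := exists_pow_eq_of_pow_eq_pow (fun h ↦ hz0 (by rw [h, zero_pow hm0])) hmn hw.symm
  exact ⟨t, by rw [mul_comm, pow_mul]⟩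

theorem exists_pow_eq_of_forall_prime (hx : x ≠ 0) (hn : n ≠ 0)
    (h : ∀ p : ℕ, p.Prime → ∃ z : K, z ^ p ^ n.factorization p = x) : ∃ z : K, z ^ n = x := by
  induction n using Nat.recOnPosPrimePosCoprime with
  | zero => exact absurd rfl hn
  | one => exact ⟨x, pow_one x⟩
  | prime_pow p k hp hk => simpa [hp.factorization_pow] using h p hp
  | coprime a b ha hb hab iha ihb =>
    have ha0 : a ≠ 0 := by lia
    have hb0 : b ≠ 0 := by lia
    refine exists_pow_mul_eq hx hab (iha ha0 fun p hp ↦ ?_) (ihb hb0 fun p hp ↦ ?_)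
    all_goals
      obtain ⟨z, hz⟩ := h p hp
      rw [Nat.factorization_mul ha0 hb0, Finsupp.add_apply, pow_add] at hz
    · exact ⟨z ^ p ^ b.factorization p, by rw [← pow_mul, mul_comm, hz]⟩
    · exact ⟨z ^ p ^ a.factorization p, by rw [← pow_mul, hz]⟩

end Powers

section Local

/-- The `p`-primary part of the Chevalley–Bass property, for an exponent of `p`-adic
valuation `v`. -/
def IsLocalCB (K Ω : Type*) [Field K] [Field Ω] [Algebra K Ω] (p v : ℕ) : Prop :=
  ∀ (b M : ℕ) (x : K), ¬ p ∣ M → x ≠ 0 →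
    (∃ y ∈ cyc K Ω (p ^ (b + v) * M), y ^ p ^ (b + v) = algebraMap K Ω x) → ∃ z : K, z ^ p ^ b = x

variable {K Ω : Type*} [Field K] [Field Ω] [Algebra K Ω]

theorem mem_cbSet_iff {Λ : ℕ} :
    Λ ∈ cbSet K Ω ↔ Λ ≠ 0 ∧ ∀ p, p.Prime → IsLocalCB K Ω p (Λ.factorization p) := by
  rw [cbSet, Set.mem_ofPred_eq, Nat.pos_iff_ne_zero]
  refine and_congr_right fun hΛ ↦ ⟨fun h p hp b M x hM hx ⟨y, hy, hyx⟩ ↦ ?_,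
    fun h n hn x hx ⟨y, hy, hyx⟩ ↦ ?_⟩
  · have hM0 : M ≠ 0 := by
      rintro rfl
      exact hM (dvd_zero p)
    have hΛ' := Nat.ordProj_mul_ordCompl_eq_self Λ p
    have hcop := Nat.coprime_ordCompl hp hΛ
    set Λ' := Λ / p ^ Λ.factorization p
    have heq : Λ * (p ^ b * M) = p ^ (b + Λ.factorization p) * (Λ' * M) := by
      conv_lhs => rw [← hΛ']
      ring
    have hyM : y ∈ cyc K Ω (Λ * (p ^ b * M)) := by
      rw [heq]
      exact cyc_mono (mul_dvd_mul_left _ (dvd_mul_left _ _)) hy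
    obtain ⟨z, hz⟩ := h (p ^ b * M)
      (Nat.pos_of_ne_zero (mul_ne_zero (pow_ne_zero _ hp.ne_zero) hM0))
      (x ^ (Λ' * M)) (pow_ne_zero _ hx) ⟨y, hyM, by rw [heq, pow_mul, hyx, map_pow]⟩
    refine exists_pow_eq_of_pow_eq_pow (m := Λ' * M) (z := z ^ M) hx ?_
      (by rw [← pow_mul, mul_comm M, hz])
    exact Nat.Coprime.pow_right _ (Nat.Coprime.mul_left hcop.symm
      ((Nat.Prime.coprime_iff_not_dvd hp).2 hM).symm)
  · refine exists_pow_eq_of_forall_prime hx hn.ne' fun p hp ↦ ?_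
    have hΛ' := Nat.ordProj_mul_ordCompl_eq_self Λ p
    have hn' := Nat.ordProj_mul_ordCompl_eq_self n p
    have hcop := Nat.not_dvd_ordCompl hp hΛ
    have hcop' := Nat.not_dvd_ordCompl hp hn.ne'
    set Λ' := Λ / p ^ Λ.factorization p
    set n' := n / p ^ n.factorization p
    have heq : Λ * n = p ^ (n.factorization p + Λ.factorization p) * (Λ' * n') := by
      conv_lhs => rw [← hΛ', ← hn']
      ring
    refine h p hp _ (Λ' * n') x ?_ hx ⟨y ^ (Λ' * n'), pow_mem ?_ _, ?_⟩
    · rw [hp.dvd_mul]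
      tauto
    · rwa [heq] at hy
    · rw [← pow_mul, mul_comm, ← heq, hyx]

theorem gcd_mem_cbSet {a b : ℕ} (ha : a ∈ cbSet K Ω) (hb : b ∈ cbSet K Ω) :
    a.gcd b ∈ cbSet K Ω := by
  rw [mem_cbSet_iff] at *
  refine ⟨Nat.gcd_ne_zero_left ha.1, fun p hp ↦ ?_⟩
  rw [Nat.factorization_gcd ha.1 hb.1, Finsupp.inf_apply]
  rcases min_choice (a.factorization p) (b.factorization p) with h | h
  · rw [h]
    exact ha.2 p hp
  · rw [h]
    exact hb.2 p hp

theorem chevalleyBass_dvd {a : ℕ} (ha : a ∈ cbSet K Ω) : chevalleyBass K Ω ∣ a := by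
  have hmem : chevalleyBass K Ω ∈ cbSet K Ω := Nat.sInf_mem ⟨a, ha⟩
  have h1 := gcd_mem_cbSet hmem ha
  have h2 : chevalleyBass K Ω ≤ (chevalleyBass K Ω).gcd a := Nat.sInf_le h1
  exact Nat.gcd_eq_left_iff_dvd.1 (le_antisymm (Nat.gcd_le_left _ hmem.1) h2)

end Local

section UpperBound

variable {K Ω : Type*} [Field K] [Field Ω] [Algebra K Ω] {p F b M : ℕ}

theorem eq_one_of_pow_eq_one_of_coprime {G : Type*} [Monoid G] {x : G} {m n : ℕ}
    (h : m.Coprime n) (hm : x ^ m = 1) (hn : x ^ n = 1) : x = 1 := by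
  have := pow_gcd_eq_one.2 ⟨hm, hn⟩
  rwa [h, pow_one] at this

theorem gal_pow_apply_eq_pow {z : Ω} {g : Gal(Ω/K)} {u : ℕ} (h : g z = z ^ u) (n : ℕ) :
    (g ^ n) z = z ^ u ^ n := by
  induction n with
  | zero => simp
  | succ n ih => rw [pow_succ, AlgEquiv.mul_apply, h, map_pow, ih, ← pow_mul, pow_succ]

theorem gal_pow_apply_eq_mul {y ξ : Ω} {g : Gal(Ω/K)} {u : ℕ} (hy : g y = ξ * y)
    (hξ : g ξ = ξ ^ u) (n : ℕ) : (g ^ n) y = ξ ^ (∑ i ∈ Finset.range n, u ^ i) * y := by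
  induction n with
  | zero => simp
  | succ n ih =>
    rw [pow_succ, AlgEquiv.mul_apply, hy, map_mul, ih, gal_pow_apply_eq_pow hξ,
      Finset.sum_range_succ, pow_add]
    ring

theorem gal_apply_eq_self_of_coprime {a c : ℕ} (hac : a.Coprime c) {g : Gal(Ω/K)}
    (ha : ∀ z, z ^ a = 1 → g z = z) (hc : ∀ z, z ^ c = 1 → g z = z) {z : Ω}
    (hz : z ^ (a * c) = 1) : g z = z := by
  have h1 : g (z ^ a) = z ^ a := hc _ (by rw [← pow_mul, hz])
  have h2 : g (z ^ c) = z ^ c := ha _ (by rw [← pow_mul, mul_comm, hz])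
  rcases eq_or_ne z 0 with rfl | hz0
  · exact map_zero g
  refine div_eq_one_iff_eq hz0 |>.1 (eq_one_of_pow_eq_one_of_coprime hac ?_ ?_)
  · rw [div_pow, ← map_pow, h1, div_self (pow_ne_zero _ hz0)]
  · rw [div_pow, ← map_pow, h2, div_self (pow_ne_zero _ hz0)]

theorem exists_one_add_pow_prime_pow (hp : p.Prime) (hF : F + 2 ≤ p * F) {t : ℕ} (ht : ¬ p ∣ t)
    (n : ℕ) : ∃ s, ¬ p ∣ s ∧ (1 + p ^ F * t) ^ p ^ n = 1 + p ^ (n + F) * s := by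
  have hF0 : F ≠ 0 := by
    rintro rfl
    simp at hF
  obtain ⟨y, hy⟩ := ZMod.exists_one_add_mul_pow_prime_pow_eq (R := ℕ) (u := p ^ F) (v := p) hp
    (dvd_pow_self p hF0) (by
      rw [Nat.cast_id, ← pow_succ', ← pow_succ, ← pow_mul, mul_comm F]
      exact pow_dvd_pow p hF) t n
  refine ⟨t + p * y, fun h ↦ ht ((Nat.dvd_add_left (dvd_mul_right p y)).1 h), ?_⟩
  rw [hy, pow_add, Nat.cast_id]

variable [CharZero Ω] [IsAlgClosed Ω]

theorem gal_comm_apply {N : ℕ} [NeZero N] (g h : Gal(Ω/K)) {y : Ω} (hy : y ∈ cyc K Ω N) :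
    g (h y) = h (g y) := by
  refine gal_apply_eq_of_mem_cyc (g := g * h) (h := h * g) hy fun z hz ↦ ?_
  obtain ⟨u, -, hu⟩ := exists_gal_pow_eq (Ω := Ω) (N := N) (g : Ω →+* Ω)
  obtain ⟨w, -, hw⟩ := exists_gal_pow_eq (Ω := Ω) (N := N) (h : Ω →+* Ω)
  replace hu : g z = z ^ u := hu z hz
  replace hw : h z = z ^ w := hw z hz
  simp only [AlgEquiv.mul_apply, hu, hw, map_pow, ← pow_mul, mul_comm]

variable [CharZero K] [Algebra.IsAlgebraic K Ω]

theorem exists_pow_eq_of_gal (hp : p.Prime) (hM : ¬ p ∣ M) {x : K} (hx : x ≠ 0) {y : Ω}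
    (hy : y ∈ cyc K Ω (p ^ (b + F) * M)) (hyx : y ^ p ^ (b + F) = algebraMap K Ω x)
    {g : Gal(Ω/K)} {t : ℕ} (ht : ¬ p ∣ t)
    (hg : ∀ z, z ^ p ^ (b + F) = 1 → g z = z ^ (1 + p ^ F * t))
    {ξ : Ω} (hξ : ξ ^ p ^ (b + F) = 1) (hgy : g y = ξ ^ p ^ F * y) : ∃ z : K, z ^ p ^ b = x := by
  have : NeZero (p ^ (b + F) * M) :=
    ⟨mul_ne_zero (pow_ne_zero _ hp.ne_zero) fun h ↦ hM (h ▸ dvd_zero p)⟩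
  have hcop : t.Coprime (p ^ (b + F)) := (((Nat.Prime.coprime_iff_not_dvd hp).2 ht).pow_left _).symm
  obtain ⟨s, -, hs⟩ :=
    Nat.exists_mul_mod_eq_of_coprime (p ^ (b + F) - 1) hcop (pow_ne_zero _ hp.ne_zero)
  have hst : ξ ^ (t * s) * ξ = 1 := by
    have h1 : t * s + 1 ≡ 0 [MOD p ^ (b + F)] := by
      have : t * s ≡ p ^ (b + F) - 1 [MOD p ^ (b + F)] := hs
      refine (this.add_right 1).trans ?_
      rw [Nat.sub_add_cancel (Nat.pos_of_ne_zero (pow_ne_zero _ hp.ne_zero))]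
      exact (Nat.modEq_zero_iff_dvd.2 dvd_rfl)
    rw [← pow_succ]
    exact (pow_eq_pow_of_modEq h1 hξ).trans (pow_zero ξ)
  set y' := ξ ^ s * y with hy'
  have hξs : (ξ ^ s) ^ p ^ (b + F) = 1 := by rw [← pow_mul, mul_comm, pow_mul, hξ, one_pow]
  have hy'x : y' ^ p ^ (b + F) = algebraMap K Ω x := by rw [hy', mul_pow, hξs, hyx, one_mul]
  have hy'0 : y' ≠ 0 := by
    intro h
    rw [h, zero_pow (pow_ne_zero _ hp.ne_zero), eq_comm, map_eq_zero] at hy'x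
    exact hx hy'x
  have hy'mem : y' ∈ cyc K Ω (p ^ (b + F) * M) :=
    mul_mem (pow_mem (cyc_mono (Dvd.intro _ rfl) (mem_cyc hξ)) s) hy
  have hgy' : g y' = y' := by
    rw [hy', map_mul, hg _ hξs, hgy]
    calc (ξ ^ s) ^ (1 + p ^ F * t) * (ξ ^ p ^ F * y)
        = (ξ ^ (t * s) * ξ) ^ p ^ F * (ξ ^ s * y) := by ring
      _ = _ := by rw [hst, one_pow, one_mul]
  obtain ⟨k, hk⟩ : y' ^ p ^ F ∈ Set.range (algebraMap K Ω) := by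
    refine mem_range_of_forall_gal fun h ↦ ?_
    set ζ := h y' / y' with hζ
    have hhy : h y' = ζ * y' := by rw [hζ, div_mul_cancel₀ _ hy'0]
    have hζ1 : ζ ^ p ^ (b + F) = 1 := by
      rw [hζ, div_pow, ← map_pow, hy'x, AlgEquiv.commutes, div_self]
      rwa [ne_eq, map_eq_zero]
    have h1 := gal_comm_apply g h hy'mem
    rw [hgy', hhy, map_mul, hgy', hg _ hζ1, pow_add, pow_one] at h1
    have hζ0 : ζ ≠ 0 := by
      intro h0
      rw [h0, zero_pow (pow_ne_zero _ hp.ne_zero)] at hζ1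
      exact zero_ne_one hζ1
    have h2 : ζ ^ (p ^ F * t) = 1 := by
      have := mul_right_cancel₀ hy'0 h1
      exact mul_left_cancel₀ hζ0 (this.trans (mul_one ζ).symm)
    have h3 : ζ ^ p ^ F = 1 := by
      refine eq_one_of_pow_eq_one_of_coprime hcop (by rw [← pow_mul, h2]) ?_
      rw [← pow_mul, mul_comm, pow_mul, hζ1, one_pow]
    rw [map_pow, hhy, mul_pow, h3, one_mul]
  refine ⟨k, (algebraMap K Ω).injective ?_⟩
  rw [map_pow, hk, ← pow_mul, ← pow_add, add_comm F b, hy'x]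

theorem isLocalCB_zero (hp : p.Prime) (hK : ∀ z : K, z ^ p = 1 → z = 1) : IsLocalCB K Ω p 0 := by
  rintro b M x hM hx ⟨y, hy, hyx⟩
  rcases eq_or_ne b 0 with rfl | hb
  · exact ⟨x, by simp⟩
  have : NeZero p := ⟨hp.ne_zero⟩
  have : NeZero (p ^ (b + 0)) := ⟨pow_ne_zero _ hp.ne_zero⟩
  obtain ⟨ζ, hζ⟩ := exists_isPrimitiveRoot Ω p
  obtain ⟨g, hgζ⟩ : ∃ g : Gal(Ω/K), g ζ ≠ ζ := by
    by_contra! h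
    obtain ⟨k, rfl⟩ := mem_range_of_forall_gal h
    have hk : k = 1 := hK k ((algebraMap K Ω).injective (by rw [map_pow, hζ.pow_eq_one, map_one]))
    exact hζ.ne_one hp.one_lt (by rw [hk, map_one])
  obtain ⟨u, hu, hgu⟩ := exists_gal_pow_eq (Ω := Ω) (N := p ^ (b + 0)) (g : Ω →+* Ω)
  have hup : u.Coprime p := hu.coprime_dvd_right (dvd_pow_self p hb)
  have hu0 : u ≠ 0 := by
    rintro rfl
    exact hp.ne_one (Nat.coprime_zero_left p |>.1 hup)
  have hζb : ζ ^ p ^ (b + 0) = 1 := by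
    obtain ⟨c, hc⟩ := dvd_pow_self p hb
    rw [add_zero, hc, pow_mul, hζ.pow_eq_one, one_pow]
  have hpu : ¬ p ∣ u - 1 := fun h ↦ hgζ <| by
    refine (hgu ζ hζb).trans ?_
    obtain ⟨c, hc⟩ := h
    rw [show u = p * c + 1 by lia, pow_succ, pow_mul, hζ.pow_eq_one, one_pow, one_mul]
  have hy0 : y ≠ 0 := by
    intro h
    rw [h, zero_pow (pow_ne_zero _ hp.ne_zero), eq_comm, map_eq_zero] at hyx
    exact hx hyx
  refine exists_pow_eq_of_gal hp hM hx hy hyx (g := g) (ξ := g y / y) hpu (fun z hz ↦ ?_) ?_ ?_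
  · rw [pow_zero, one_mul, show 1 + (u - 1) = u by lia]
    exact hgu z hz
  · rw [div_pow, ← map_pow, hyx, AlgEquiv.commutes, div_self]
    rwa [ne_eq, map_eq_zero]
  · rw [pow_zero, pow_one, div_mul_cancel₀ _ hy0]

theorem isLocalCB_of_gal (hp : p.Prime) (hF : F + 2 ≤ p * F)
    (h : ∀ a M : ℕ, ¬ p ∣ M → ∃ g : Gal(Ω/K),
      (∀ z, z ^ p ^ a = 1 → g z = z ^ (1 + p ^ F)) ∧ ∀ z, z ^ M = 1 → g z = z) :
    IsLocalCB K Ω p F := by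
  rintro b M x hM hx ⟨y, hy, hyx⟩
  obtain ⟨g, hg, hgM⟩ := h (b + F) M hM
  have hp1 : ¬ p ∣ 1 := hp.one_lt.ne' ∘ Nat.dvd_one.1
  have hy0 : y ≠ 0 := by
    intro h
    rw [h, zero_pow (pow_ne_zero _ hp.ne_zero), eq_comm, map_eq_zero] at hyx
    exact hx hyx
  set ξ := g y / y with hξ
  have hgy : g y = ξ * y := by rw [hξ, div_mul_cancel₀ _ hy0]
  have hξ1 : ξ ^ p ^ (b + F) = 1 := by
    rw [hξ, div_pow, ← map_pow, hyx, AlgEquiv.commutes, div_self]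
    rwa [ne_eq, map_eq_zero]
  obtain ⟨s, hs, hpow⟩ := exists_one_add_pow_prime_pow hp hF hp1 b
  rw [mul_one] at hpow
  have hgn : (g ^ p ^ b) y = y := by
    have := gal_apply_eq_of_mem_cyc hy (g := g ^ p ^ b) (h := 1) fun z hz ↦ by
      refine gal_apply_eq_self_of_coprime
        (((Nat.Prime.coprime_iff_not_dvd hp).2 hM).pow_left (b + F)) (fun z hz ↦ ?_)
        (fun z hz ↦ ?_) hz
      · rw [gal_pow_apply_eq_pow (hg z hz), hpow, pow_add, pow_mul, hz, one_pow, pow_one, mul_one]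
      · rw [gal_pow_apply_eq_pow ((hgM z hz).trans (pow_one z).symm), one_pow, pow_one]
    exact this
  rw [gal_pow_apply_eq_mul hgy (hg ξ hξ1)] at hgn
  set S := ∑ i ∈ Finset.range (p ^ b), (1 + p ^ F) ^ i
  have hξS : ξ ^ S = 1 := mul_right_cancel₀ hy0 (hgn.trans (one_mul y).symm)
  have hS : S = p ^ b * s := by
    have h1 := geom_sum_mul_add (p ^ F) (p ^ b)
    rw [add_comm (p ^ F) 1, hpow, pow_add] at h1
    change S * p ^ F + 1 = _ at h1
    refine Nat.eq_of_mul_eq_mul_right (Nat.pos_of_ne_zero (pow_ne_zero F hp.ne_zero)) ?_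
    linarith
  obtain ⟨η, hη⟩ := IsAlgClosed.exists_pow_nat_eq ξ (Nat.pos_of_ne_zero (pow_ne_zero F hp.ne_zero))
  have hξb : ξ ^ p ^ b = 1 := by
    refine eq_one_of_pow_eq_one_of_coprime (m := s) (n := p ^ F)
      (((Nat.Prime.coprime_iff_not_dvd hp).2 hs).pow_left F).symm ?_ ?_
    · rw [← pow_mul, ← hS, hξS]
    · rw [← pow_mul, ← pow_add, hξ1]
  refine exists_pow_eq_of_gal hp hM hx hy hyx (g := g) (ξ := η) hp1 (by simpa using hg) ?_ ?_
  · rw [add_comm, pow_add, pow_mul, hη, hξb]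
  · rw [hη, hgy]

end UpperBound

section RootsOfUnity

variable {K Ω : Type*} [Field K] [Field Ω] [Algebra K Ω] [CharZero K] [CharZero Ω] [IsAlgClosed Ω]
  [Algebra.IsAlgebraic K Ω] {p f e : ℕ}

theorem exists_gal_pow_one_add_prime_pow (hp : p.Prime) (hf0 : f ≠ 0)
    (hf : (maxAb K).map (IsScalarTower.toAlgHom ℚ K Ω) ≤ cyc ℚ Ω f) (he : f.factorization p ≤ e)
    (hpe : (1 + p ^ e).Coprime p) {a M : ℕ} (hM : ¬ p ∣ M) : ∃ g : Gal(Ω/K),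
      (∀ z, z ^ p ^ a = 1 → g z = z ^ (1 + p ^ e)) ∧ ∀ z, z ^ M = 1 → g z = z := by
  set f₀ := f / p ^ f.factorization p
  have hff : p ^ f.factorization p * f₀ = f := Nat.ordProj_mul_ordCompl_eq_self f p
  have hf₀ : ¬ p ∣ f₀ := Nat.not_dvd_ordCompl hp hf0
  set A := a + e
  have hcop : (p ^ A).Coprime (f₀ * M) := by
    refine ((Nat.Prime.coprime_iff_not_dvd hp).2 fun h ↦ ?_).pow_left A
    exact (hp.dvd_mul.1 h).elim hf₀ hM
  obtain ⟨u, hu1, hu2⟩ := Nat.chineseRemainder hcop (1 + p ^ e) 1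
  have hN : p ^ A * (f₀ * M) ≠ 0 := by
    refine mul_ne_zero (pow_ne_zero _ hp.ne_zero) (mul_ne_zero ?_ ?_)
    · exact fun h ↦ hf₀ (h ▸ dvd_zero p)
    · exact fun h ↦ hM (h ▸ dvd_zero p)
  have : NeZero (p ^ A * (f₀ * M)) := ⟨hN⟩
  have hfN : f ∣ p ^ A * (f₀ * M) := by
    rw [← hff]
    exact mul_dvd_mul (pow_dvd_pow p (he.trans (Nat.le_add_left e a))) (dvd_mul_right _ _)
  have huN : u.Coprime (p ^ A * (f₀ * M)) := by
    refine Nat.Coprime.mul_right ?_ ?_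
    · rw [Nat.Coprime, hu1.gcd_eq]
      exact hpe.pow_right A
    · rw [Nat.Coprime, hu2.gcd_eq, Nat.gcd_one_left]
  have huf : u ≡ 1 [MOD f] := by
    rw [← hff]
    refine (Nat.modEq_and_modEq_iff_modEq_mul
      (hcop.coprime_dvd_left ?_ |>.coprime_dvd_right (dvd_mul_right _ _))).1
      ⟨(hu1.of_dvd ?_).trans ?_, hu2.of_dvd (dvd_mul_right _ _)⟩
    · exact pow_dvd_pow p (he.trans (Nat.le_add_left e a))
    · exact pow_dvd_pow p (he.trans (Nat.le_add_left e a))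
    · exact (Nat.modEq_zero_iff_dvd.2 (pow_dvd_pow p he)).add_left 1
  obtain ⟨g, hg⟩ := exists_gal_pow hfN hf huN huf
  refine ⟨g, fun z hz ↦ ?_, fun z hz ↦ ?_⟩
  · rw [hg z]
    · exact pow_eq_pow_of_modEq (hu1.of_dvd (pow_dvd_pow p (Nat.le_add_right a e))) hz
    · rw [show p ^ A * (f₀ * M) = p ^ a * (p ^ e * (f₀ * M)) by ring, pow_mul, hz, one_pow]
  · rw [hg z]
    · exact (pow_eq_pow_of_modEq (hu2.of_dvd (dvd_mul_left _ _)) hz).trans (pow_one z)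
    · rw [show p ^ A * (f₀ * M) = M * (p ^ A * f₀) by ring, pow_mul, hz, one_pow]

theorem le_of_isPrimitiveRoot_prime_pow (hp : p.Prime) (hf0 : f ≠ 0)
    (hf : (maxAb K).map (IsScalarTower.toAlgHom ℚ K Ω) ≤ cyc ℚ Ω f) (he : f.factorization p ≤ e)
    (hpe : (1 + p ^ e).Coprime p) {k : ℕ} {ζ : K} (hζ : IsPrimitiveRoot ζ (p ^ k)) : k ≤ e := by
  obtain ⟨g, hg, -⟩ := exists_gal_pow_one_add_prime_pow (a := k) hp hf0 hf he hpe
    (M := 1) (hp.one_lt.ne' ∘ Nat.dvd_one.1)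
  have hζΩ := hζ.map_of_injective (algebraMap K Ω).injective
  have h := hg _ hζΩ.pow_eq_one
  rw [AlgEquiv.commutes] at h
  have h1 := hζΩ.modEq_of_pow_eq (pow_ne_zero k hp.ne_zero) ((pow_one _).trans h)
  have h2 := Nat.ModEq.add_left_cancel' (a := 0) (b := p ^ e) 1 h1
  exact (Nat.pow_dvd_pow_iff_le_right hp.one_lt).1 ((Nat.modEq_zero_iff_dvd).1 h2.symm)

theorem factorization_le_of_isPrimitiveRoot (hp : p.Prime) (hf0 : f ≠ 0)
    (hf : (maxAb K).map (IsScalarTower.toAlgHom ℚ K Ω) ≤ cyc ℚ Ω f) (he : f.factorization p ≤ e)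
    (hpe : (1 + p ^ e).Coprime p) {n : ℕ} (hn : n ≠ 0) {ζ : K} (hζ : IsPrimitiveRoot ζ n) :
    n.factorization p ≤ e := by
  refine le_of_isPrimitiveRoot_prime_pow hp hf0 hf he hpe
    (ζ := ζ ^ (n / p ^ n.factorization p)) (hζ.pow (Nat.pos_of_ne_zero hn) ?_)
  exact (Nat.div_mul_cancel (Nat.ordProj_dvd n p)).symm

theorem coprime_one_add_prime_pow (hp : p.Prime) (h : e ≠ 0 ∨ p ≠ 2) : (1 + p ^ e).Coprime p := by
  rcases eq_or_ne e 0 with rfl | he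
  · have h2 : p ≠ 2 := by simpa using h
    exact (Nat.coprime_primes Nat.prime_two hp).2 h2.symm
  · obtain ⟨c, hc⟩ := dvd_pow_self p he
    rw [hc]
    simp

theorem dvd_two_mul_of_isPrimitiveRoot (hf0 : f ≠ 0)
    (hf : (maxAb K).map (IsScalarTower.toAlgHom ℚ K Ω) ≤ cyc ℚ Ω f) {n : ℕ} (hn : n ≠ 0)
    {ζ : K} (hζ : IsPrimitiveRoot ζ n) : n ∣ 2 * f := by
  rw [← Nat.factorization_prime_le_iff_dvd hn (by positivity)]
  intro p hp
  rw [Nat.factorization_mul two_ne_zero hf0, Finsupp.add_apply]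
  by_cases hp2 : p = 2
  · subst hp2
    refine factorization_le_of_isPrimitiveRoot hp hf0 hf (Nat.le_add_left _ _) ?_ hn hζ
    refine coprime_one_add_prime_pow hp (.inl ?_)
    rw [Nat.prime_two.factorization_self]
    lia
  · refine factorization_le_of_isPrimitiveRoot hp hf0 hf (Nat.le_add_left _ _) ?_ hn hζ
    exact coprime_one_add_prime_pow hp (.inr hp2)

variable (Ω) in
/-- The roots of unity of `K` form a finite cyclic group of order `numRootsOfUnity K`. -/
theorem exists_isPrimitiveRoot_numRootsOfUnity (hf0 : f ≠ 0)
    (hf : (maxAb K).map (IsScalarTower.toAlgHom ℚ K Ω) ≤ cyc ℚ Ω f) :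
    ∃ ζ : K, numRootsOfUnity K ≠ 0 ∧ IsPrimitiveRoot ζ (numRootsOfUnity K) ∧
      ∀ (z : K) (n : ℕ), n ≠ 0 → z ^ n = 1 → z ^ numRootsOfUnity K = 1 := by
  have h2f : NeZero (2 * f) := ⟨by positivity⟩
  have htor : CommGroup.torsion Kˣ = rootsOfUnity (2 * f) K := by
    ext u
    rw [mem_rootsOfUnity]
    refine ⟨fun hu ↦ ?_, fun hu ↦ isOfFinOrder_iff_pow_eq_one.2 ⟨2 * f, NeZero.pos _, hu⟩⟩
    have hu' : IsOfFinOrder u := hu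
    have := dvd_two_mul_of_isPrimitiveRoot hf0 hf hu'.orderOf_pos.ne'
      (IsPrimitiveRoot.coe_units_iff.2 (IsPrimitiveRoot.orderOf u))
    exact orderOf_dvd_iff_pow_eq_one.1 this
  have hfin : Finite (CommGroup.torsion Kˣ) := htor ▸ inferInstance
  have hcyc : IsCyclic (CommGroup.torsion Kˣ) := htor ▸ inferInstance
  obtain ⟨g, hg⟩ := IsCyclic.exists_generator (α := CommGroup.torsion Kˣ)
  have hord : orderOf g = numRootsOfUnity K := orderOf_eq_card_of_forall_mem_zpowers hg
  have hprim : IsPrimitiveRoot ((g : Kˣ) : K) (numRootsOfUnity K) := by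
    rw [IsPrimitiveRoot.coe_units_iff, ← hord, ← Subgroup.orderOf_coe]
    exact IsPrimitiveRoot.orderOf _
  refine ⟨_, Nat.card_pos.ne', hprim, fun z n hn hz ↦ ?_⟩
  have hz' : (IsUnit.of_pow_eq_one hz hn).unit ∈ CommGroup.torsion Kˣ :=
    isOfFinOrder_iff_pow_eq_one.2 ⟨n, Nat.pos_of_ne_zero hn, Units.ext hz⟩
  have := pow_card_eq_one' (x := (⟨_, hz'⟩ : CommGroup.torsion Kˣ))
  exact congrArg (fun u : CommGroup.torsion Kˣ ↦ ((u : Kˣ) : K)) this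

end RootsOfUnity

section LowerBound

variable {K Ω : Type*} [Field K] [Field Ω] [Algebra K Ω] {p f v : ℕ}

theorem one_add_mul_pow_modEq {d : ℕ} (hpd : p ∣ d) (t i : ℕ) :
    (1 + d * t) ^ i ≡ 1 + d * (t * i) [MOD d * p] := by
  induction i with
  | zero => simp [Nat.ModEq.refl]
  | succ i ih =>
    rw [pow_succ]
    refine (ih.mul_right _).trans ?_
    have h0 : d * d * (t * i * t) ≡ 0 [MOD d * p] :=
      Nat.modEq_zero_iff_dvd.2 ((mul_dvd_mul_left d hpd).mul_right _)
    have := h0.add_left (1 + d * (t * (i + 1)))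
    rw [add_zero] at this
    convert this using 1
    ring

/-- The Galois group acts on a Gauss sum through the multiplicative character. -/
theorem mulChar_mul_map_gaussSum {q : ℕ} [Fact q.Prime] (χ : MulChar (ZMod q) K)
    {ζ : Ω} (hζ : ζ ^ q = 1) (g : Gal(Ω/K)) {u : ℕ} (hu : u.Coprime q) (hg : g ζ = ζ ^ u) :
    algebraMap K Ω (χ u) * g (gaussSum (χ.ringHomComp (algebraMap K Ω)) (AddChar.zmodChar q hζ)) =
      gaussSum (χ.ringHomComp (algebraMap K Ω)) (AddChar.zmodChar q hζ) := by
  have h := gaussSum_mulShift (χ.ringHomComp (algebraMap K Ω)) (AddChar.zmodChar q hζ)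
    (ZMod.unitOfCoprime u hu)
  rw [MulChar.ringHomComp_apply, ZMod.coe_unitOfCoprime] at h
  refine Eq.trans ?_ h
  refine congrArg (algebraMap K Ω (χ u) * ·) ?_
  simp only [gaussSum, map_sum, map_mul, MulChar.ringHomComp_apply, AlgEquiv.commutes]
  refine Finset.sum_congr rfl fun a _ ↦ ?_
  congr 1
  rw [AddChar.mulShift_apply, AddChar.zmodChar_apply, map_pow, hg, ← pow_mul]
  conv_rhs => rw [← ZMod.natCast_zmod_val a, ← Nat.cast_mul, AddChar.zmodChar_apply']

theorem gaussSum_mem_cyc {q : ℕ} [Fact q.Prime] (χ : MulChar (ZMod q) K) {ζ : Ω}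
    (hζ : ζ ^ q = 1) :
    gaussSum (χ.ringHomComp (algebraMap K Ω)) (AddChar.zmodChar q hζ) ∈ cyc K Ω q :=
  sum_mem fun _ _ ↦ mul_mem (algebraMap_mem _ _) (pow_mem (mem_cyc hζ) _)

variable [CharZero K] [CharZero Ω] [IsAlgClosed Ω]

/-- If `f` is the conductor of the maximal abelian subextension of `K`, an automorphism fixing the
roots of unity of order `p ^ j * f₀` fixes those of order `p ^ (j + 1) * f₀`. -/
theorem gal_apply_eq_self_step (hp : p.Prime)
    (hf : (maxAb K).map (IsScalarTower.toAlgHom ℚ K Ω) ≤ cyc ℚ Ω f)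
    (hmin : ¬ (maxAb K).map (IsScalarTower.toAlgHom ℚ K Ω) ≤ cyc ℚ Ω (f / p))
    {f₀ F j : ℕ} (hff : f = p ^ F * f₀) (hf₀ : ¬ p ∣ f₀) (hj : j + 2 ≤ p * j) (hjF : j < F)
    {g : Gal(Ω/K)} (hg : ∀ z, z ^ (p ^ j * f₀) = 1 → g z = z) :
    ∀ z, z ^ (p ^ (j + 1) * f₀) = 1 → g z = z := by
  have hj0 : 1 ≤ j := by
    by_contra! h
    simp [Nat.lt_one_iff.1 h] at hj
  have hf₀0 : f₀ ≠ 0 := fun h ↦ hf₀ (h ▸ dvd_zero p)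
  have hf0 : f ≠ 0 := hff ▸ mul_ne_zero (pow_ne_zero _ hp.ne_zero) hf₀0
  have : NeZero f := ⟨hf0⟩
  have : NeZero (p ^ j * f₀) := ⟨mul_ne_zero (pow_ne_zero _ hp.ne_zero) hf₀0⟩
  have hpf : p ∣ f := hff ▸ (dvd_pow_self p (by lia)).mul_right f₀
  have hf1 : f ≠ 1 := by
    rintro rfl
    exact hp.one_lt.ne' (Nat.dvd_one.1 hpf)
  obtain ⟨u, hu, hgu⟩ := exists_gal_pow_eq (Ω := Ω) (N := f) (g : Ω →+* Ω)
  replace hgu : ∀ z : Ω, z ^ f = 1 → g z = z ^ u := hgu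
  have hu0 : 1 ≤ u := by
    refine Nat.one_le_iff_ne_zero.2 ?_
    rintro rfl
    exact hf1 ((Nat.coprime_zero_left f).1 hu)
  have hdvd (i : ℕ) (hi : i ≤ F) : p ^ i * f₀ ∣ f :=
    hff ▸ mul_dvd_mul_right (pow_dvd_pow p hi) f₀
  have hone {i : ℕ} (hi : i ≤ F) {z : Ω} (hz : z ^ (p ^ i * f₀) = 1) : z ^ f = 1 := by
    obtain ⟨c, hc⟩ := hdvd i hi
    rw [hc, pow_mul, hz, one_pow]
  obtain ⟨s, hs⟩ : p ^ j * f₀ ∣ u - 1 := by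
    obtain ⟨ζ, hζ⟩ := exists_isPrimitiveRoot Ω (p ^ j * f₀)
    have h1 : ζ ^ 1 = ζ ^ u := by
      rw [← hgu ζ (hone hjF.le hζ.pow_eq_one), hg ζ hζ.pow_eq_one, pow_one]
    exact (Nat.modEq_iff_dvd' hu0).1 (hζ.modEq_of_pow_eq (NeZero.ne _) h1)
  have hus : u = 1 + p ^ j * (f₀ * s) := by rw [← mul_assoc, ← hs]; lia
  have hps : p ∣ s := by
    by_contra hps
    obtain ⟨s', hs', hpow⟩ := exists_one_add_pow_prime_pow hp hj
      (fun h ↦ (hp.dvd_mul.1 h).elim hf₀ hps) (F - 1 - j)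
    rw [← hus, show F - 1 - j + j = F - 1 by lia] at hpow
    obtain ⟨t, rfl⟩ : f₀ ∣ s' := by
      have h1 : u ^ p ^ (F - 1 - j) ≡ 1 [MOD f₀] := by
        have : u ≡ 1 [MOD f₀] := by
          rw [hus]
          exact (Nat.modEq_zero_iff_dvd.2 (Dvd.intro _ (by ring : f₀ * (p ^ j * s) = _))).add_left 1
        simpa using this.pow (p ^ (F - 1 - j))
      rw [hpow] at h1
      have h2 := Nat.modEq_zero_iff_dvd.1 (Nat.ModEq.add_left_cancel' (b := 0) 1 h1)
      exact (((Nat.Prime.coprime_iff_not_dvd hp).2 hf₀).pow_left _).symm.dvd_of_dvd_mul_left h2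
    have hpt : ¬ p ∣ t := fun h ↦ hs' (h.mul_left f₀)
    set d := p ^ (F - 1) * f₀ with hd
    have hdp : d * p = f := by
      rw [hff, hd, mul_right_comm, ← pow_succ, Nat.sub_add_cancel (by lia)]
    have hpd : p ∣ d := (dvd_pow_self p (by lia)).mul_right f₀
    refine hmin ?_
    rw [← hdp, Nat.mul_div_cancel _ hp.pos]
    refine maxAb_map_le_cyc (f := f) (Dvd.intro _ hdp) hf fun w hw hwf ↦ ?_
    have hw0 : 1 ≤ w := by
      refine Nat.one_le_iff_ne_zero.2 ?_
      rintro rfl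
      exact hf1 ((Nat.coprime_zero_left f).1 hwf)
    obtain ⟨r, hr⟩ := (Nat.modEq_iff_dvd' hw0).1 hw.symm
    obtain ⟨i, -, hi⟩ := Nat.exists_mul_mod_eq_of_coprime r
      ((Nat.Prime.coprime_iff_not_dvd hp).2 hpt).symm hp.ne_zero
    refine ⟨(g ^ p ^ (F - 1 - j)) ^ i, fun z hz ↦ ?_⟩
    rw [gal_pow_apply_eq_pow (gal_pow_apply_eq_pow (hgu z hz) _), hpow]
    refine pow_eq_pow_of_modEq ?_ hz
    rw [show 1 + p ^ (F - 1) * (f₀ * t) = 1 + d * t by rw [hd, mul_assoc],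
      show w = 1 + d * r by lia]
    rw [← hdp]
    exact (one_add_mul_pow_modEq hpd t i).trans
      ((Nat.ModEq.mul_left' d (show t * i ≡ r [MOD p] from hi)).add_left 1)
  intro z hz
  rw [hgu z (hone hjF hz)]
  obtain ⟨s', rfl⟩ := hps
  rw [hus, show 1 + p ^ j * (f₀ * (p * s')) = p ^ (j + 1) * f₀ * s' + 1 by ring, pow_succ,
    pow_mul, hz, one_pow, one_mul]

theorem gal_apply_eq_self_of_prime_pow (hp : p.Prime)
    (hf : (maxAb K).map (IsScalarTower.toAlgHom ℚ K Ω) ≤ cyc ℚ Ω f)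
    (hmin : ¬ (maxAb K).map (IsScalarTower.toAlgHom ℚ K Ω) ≤ cyc ℚ Ω (f / p))
    {f₀ F c : ℕ} (hff : f = p ^ F * f₀) (hf₀ : ¬ p ∣ f₀) (hc : c + 2 ≤ p * c) (hcF : c ≤ F)
    {g : Gal(Ω/K)} (hg : ∀ z, z ^ (p ^ c * f₀) = 1 → g z = z) :
    ∀ z, z ^ f = 1 → g z = z := by
  suffices h : ∀ j, c ≤ j → j ≤ F → ∀ z, z ^ (p ^ j * f₀) = 1 → g z = z from
    hff ▸ h F hcF le_rfl
  intro j hcj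
  induction j, hcj using Nat.le_induction with
  | base => exact fun _ ↦ hg
  | succ j hcj ih =>
    refine fun hjF ↦ gal_apply_eq_self_step hp hf hmin hff hf₀ ?_ hjF (ih (by lia))
    obtain ⟨m, rfl⟩ := Nat.exists_eq_add_of_le hcj
    have := Nat.mul_le_mul_right m hp.one_le
    rw [mul_add]
    lia

variable [Algebra.IsAlgebraic K Ω]

theorem le_of_isLocalCB (hp : p.Prime) (hf0 : f ≠ 0)
    (hf : (maxAb K).map (IsScalarTower.toAlgHom ℚ K Ω) ≤ cyc ℚ Ω f) (hv : IsLocalCB K Ω p v)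
    {k : ℕ} {ζ : K} (hζ : IsPrimitiveRoot ζ (p ^ k)) : k ≤ v := by
  by_contra! hvk
  obtain ⟨q, hq, hqf, hqk⟩ := Nat.exists_prime_gt_modEq_one (k := p ^ k) (f * p)
    (pow_ne_zero k hp.ne_zero)
  have : Fact q.Prime := ⟨hq⟩
  have : NeZero q := ⟨hq.ne_zero⟩
  have : NeZero (f * q) := ⟨mul_ne_zero hf0 hq.ne_zero⟩
  have hpq : ¬ p ∣ q := fun h ↦ by
    have := (Nat.prime_dvd_prime_iff_eq hp hq).1 h
    have := Nat.le_mul_of_pos_left p (Nat.pos_of_ne_zero hf0)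
    lia
  have hfq : f.Coprime q := (Nat.coprime_of_lt_prime hf0
    ((Nat.le_mul_of_pos_right f hp.pos).trans_lt hqf) hq).symm
  obtain ⟨χ, hχ⟩ := MulChar.exists_mulChar_orderOf (ZMod q) (n := p ^ k)
    (by rw [ZMod.card]; exact (Nat.modEq_iff_dvd' hq.one_le).1 hqk.symm) hζ
  obtain ⟨ω, hω⟩ := exists_isPrimitiveRoot Ω q
  set y := gaussSum (χ.ringHomComp (algebraMap K Ω)) (AddChar.zmodChar q hω.pow_eq_one) with hy
  have hgy (g : Gal(Ω/K)) {u : ℕ} (hu : u.Coprime q) (hg : g ω = ω ^ u) :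
      algebraMap K Ω (χ u) * g y = y := mulChar_mul_map_gaussSum χ hω.pow_eq_one g hu hg
  have hχ1 : χ ≠ 1 := by
    rintro rfl
    rw [orderOf_one] at hχ
    exact (Nat.one_lt_pow (by lia) hp.one_lt).ne hχ
  have hy0 : y ≠ 0 := by
    refine gaussSum_ne_zero_of_nontrivial ?_ ?_
      (AddChar.zmodChar_primitive_of_primitive_root q hω)
    · rw [ZMod.card]
      exact_mod_cast hq.ne_zero
    · exact (MulChar.ringHomComp_ne_one_iff (algebraMap K Ω).injective).2 hχ1
  obtain ⟨x, hx⟩ : y ^ p ^ k ∈ Set.range (algebraMap K Ω) := by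
    refine mem_range_of_forall_gal fun g ↦ ?_
    obtain ⟨u, hu, hgu⟩ := exists_gal_pow_eq (Ω := Ω) (N := q) (g : Ω →+* Ω)
    have h1 := congrArg (· ^ p ^ k) (hgy g hu (hgu ω hω.pow_eq_one))
    have h2 : χ u ^ p ^ k = 1 := by
      have := pow_orderOf_eq_one χ
      rw [hχ] at this
      rw [← ZMod.coe_unitOfCoprime u hu, ← MulChar.pow_apply_coe, this, MulChar.one_apply_coe]
    simpa only [mul_pow, ← map_pow, h2, map_one, one_mul] using h1
  have hx0 : x ≠ 0 := by
    rintro rfl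
    rw [map_zero, eq_comm] at hx
    exact hy0 (pow_eq_zero_iff (pow_ne_zero k hp.ne_zero) |>.1 hx)
  have hkv : k - v + v = k := Nat.sub_add_cancel hvk.le
  obtain ⟨z, hz⟩ := hv (k - v) q x hpq hx0
    ⟨y, cyc_mono (Dvd.intro_left _ rfl) (gaussSum_mem_cyc χ hω.pow_eq_one), by rw [hkv, hx]⟩
  have hz0 : algebraMap K Ω z ≠ 0 := by
    rw [ne_eq, map_eq_zero]
    rintro rfl
    rw [zero_pow (pow_ne_zero _ hp.ne_zero)] at hz
    exact hx0 hz.symm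
  have hw : (y ^ p ^ v / algebraMap K Ω z) ^ p ^ k = 1 := by
    have h1 : (y ^ p ^ v / algebraMap K Ω z) ^ p ^ (k - v) = 1 := by
      rw [div_pow, ← pow_mul, ← pow_add, add_comm, hkv, ← map_pow, hz, hx, div_self]
      exact pow_ne_zero _ hy0
    rw [← hkv, pow_add, pow_mul, h1, one_pow]
  have : NeZero (p ^ k) := ⟨pow_ne_zero k hp.ne_zero⟩
  obtain ⟨i, -, hi⟩ := (hζ.map_of_injective (algebraMap K Ω).injective).eq_pow_of_pow_eq_one hw
  have hyv : y ^ p ^ v = algebraMap K Ω (ζ ^ i * z) := by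
    rw [map_mul, map_pow, hi, div_mul_cancel₀ _ hz0]
  obtain ⟨a, ha⟩ : ∃ a : (ZMod q)ˣ, χ a ^ p ^ v ≠ 1 := by
    by_contra! h
    have : χ ^ p ^ v = 1 := MulChar.ext fun a ↦ by
      rw [MulChar.pow_apply_coe, h, MulChar.one_apply_coe]
    rw [← orderOf_dvd_iff_pow_eq_one, hχ] at this
    exact hvk.not_ge (Nat.pow_dvd_pow_iff_le_right hp.one_lt |>.1 this)
  obtain ⟨u, hu1, hu2⟩ := Nat.chineseRemainder hfq 1 (a : ZMod q).val
  have hua : (u : ZMod q) = a := by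
    rw [← ZMod.natCast_zmod_val (a : ZMod q), ZMod.natCast_eq_natCast_iff]
    exact hu2
  have huq : u.Coprime q := (ZMod.isUnit_iff_coprime u q).1 (hua ▸ a.isUnit)
  have huf : u.Coprime f := by rw [Nat.Coprime, hu1.gcd_eq, Nat.gcd_one_left]
  obtain ⟨g, hg⟩ := exists_gal_pow (dvd_mul_right f q) hf (huf.mul_right huq) hu1
  have h1 := congrArg (· ^ p ^ v)
    (hgy g huq (hg ω (by rw [mul_comm, pow_mul, hω.pow_eq_one, one_pow])))
  simp only [mul_pow, ← map_pow, hyv, AlgEquiv.commutes] at h1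
  rw [← map_mul] at h1
  have h2 := (algebraMap K Ω).injective h1
  refine ha ?_
  rw [← hua, ← map_pow]
  refine mul_right_cancel₀ ?_ (h2.trans (one_mul _).symm)
  intro h
  rw [h, map_zero] at hyv
  exact pow_ne_zero _ hy0 hyv

theorem two_le_of_isLocalCB (hf0 : f ≠ 0)
    (hf : (maxAb K).map (IsScalarTower.toAlgHom ℚ K Ω) ≤ cyc ℚ Ω f) (hv : IsLocalCB K Ω 2 v) :
    2 ≤ v := by
  have h1 : 1 ≤ v := le_of_isLocalCB Nat.prime_two hf0 hf hv (k := 1) (ζ := -1)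
    (by simpa using IsPrimitiveRoot.neg_one 0 (by norm_num))
  by_contra! hv2
  obtain rfl : v = 1 := by lia
  obtain ⟨i, hi⟩ := IsAlgClosed.exists_pow_nat_eq (-1 : Ω) two_pos
  have hi4 : (1 + i) ^ 4 = -4 := by linear_combination (i ^ 2 + 4 * i + 5) * hi
  obtain ⟨z, hz⟩ := hv 1 1 (-4) (by norm_num) (by norm_num) ⟨1 + i,
    add_mem (one_mem _) (mem_cyc (by norm_num; linear_combination (i ^ 2 - 1) * hi)),
    by norm_num [hi4, map_ofNat (algebraMap K Ω) 4]⟩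
  have hz2 : (z / 2) ^ 2 = -1 := by
    rw [div_pow, show z ^ 2 = -4 by simpa using hz]
    norm_num
  refine hv2.not_ge (le_of_isLocalCB Nat.prime_two hf0 hf hv (k := 2) (ζ := z / 2) ?_)
  have h4 := orderOf_eq_prime_pow (p := 2) (n := 1) (x := z / 2)
    (by rw [pow_one, hz2]; norm_num) (by rw [pow_succ, pow_one, pow_mul, hz2]; norm_num)
  exact h4 ▸ IsPrimitiveRoot.orderOf _

theorem le_add_of_isLocalCB (hp : p.Prime)
    (hf : (maxAb K).map (IsScalarTower.toAlgHom ℚ K Ω) ≤ cyc ℚ Ω f)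
    (hmin : ¬ (maxAb K).map (IsScalarTower.toAlgHom ℚ K Ω) ≤ cyc ℚ Ω (f / p))
    {f₀ F k : ℕ} (hff : f = p ^ F * f₀) (hf₀ : ¬ p ∣ f₀) (hv : v + 2 ≤ p * v)
    (hcb : IsLocalCB K Ω p v) (hk : k ≠ 0) {ζ : K} (hζ : IsPrimitiveRoot ζ (p ^ k))
    (hmax : ∀ z : K, ¬ IsPrimitiveRoot z (p ^ (k + 1))) : F ≤ k + v := by
  by_contra! hF
  have : NeZero (p ^ F) := ⟨pow_ne_zero F hp.ne_zero⟩
  have : NeZero (p ^ k) := ⟨pow_ne_zero k hp.ne_zero⟩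
  obtain ⟨y, hy⟩ := exists_isPrimitiveRoot Ω (p ^ F)
  have hyk : IsPrimitiveRoot (y ^ p ^ (F - k)) (p ^ k) :=
    hy.pow (NeZero.pos _) (by rw [← pow_add, Nat.sub_add_cancel (by lia)])
  obtain ⟨i, -, hi⟩ := (hζ.map_of_injective (algebraMap K Ω).injective).eq_pow_of_pow_eq_one
    hyk.pow_eq_one
  rw [← map_pow] at hi
  have hx : IsPrimitiveRoot (ζ ^ i) (p ^ k) := by
    rw [← hi] at hyk
    exact hyk.of_map_of_injective (algebraMap K Ω).injective
  have hymem : y ∈ cyc K Ω (p ^ (F - k) * f₀) := by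
    refine mem_cyc_of_forall_gal fun g hg ↦ ?_
    refine gal_apply_eq_self_of_prime_pow hp hf hmin hff hf₀ (c := F - k) ?_ (Nat.sub_le F k)
      hg y ?_
    · obtain ⟨m, hm⟩ := Nat.exists_eq_add_of_le (show v ≤ F - k by lia)
      have := Nat.mul_le_mul_right m hp.one_le
      rw [hm, mul_add]
      lia
    · rw [hff, pow_mul, hy.pow_eq_one, one_pow]
  have hFk : F - k - v + v = F - k := Nat.sub_add_cancel (by lia)
  obtain ⟨z, hz⟩ := hcb (F - k - v) f₀ (ζ ^ i) hf₀ (hx.ne_zero (NeZero.ne _))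
    ⟨y, by rwa [hFk], by rw [hFk, hi]⟩
  set w := z ^ p ^ (F - k - v - 1) with hw
  have hwp : w ^ p = ζ ^ i := by
    rw [hw, ← pow_mul, ← pow_succ, Nat.sub_add_cancel (by lia), hz]
  have : Fact p.Prime := ⟨hp⟩
  refine hmax w ?_
  rw [← orderOf_eq_prime_pow (x := w) (n := k)]
  · exact IsPrimitiveRoot.orderOf w
  · rw [show p ^ k = p * p ^ (k - 1) by rw [← pow_succ', Nat.sub_add_cancel (by lia)], pow_mul, hwp]
    refine hx.pow_ne_one_of_pos_of_lt (pow_ne_zero _ hp.ne_zero) ?_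
    exact Nat.pow_lt_pow_right hp.one_lt (by lia)
  · rw [pow_succ', pow_mul, hwp, hx.pow_eq_one]

end LowerBound

theorem Nat.factorization_prod_primeFactors_pow (l f p : ℕ) :
    (∏ q ∈ l.primeFactors, q ^ f.factorization q).factorization p =
      if p ∈ l.primeFactors then f.factorization p else 0 := by
  have hq {q : ℕ} (h : q ∈ l.primeFactors) : q.Prime := Nat.prime_of_mem_primeFactors h
  rw [Nat.factorization_prod_apply fun q h ↦ pow_ne_zero _ (hq h).ne_zero,
    ← Finset.sum_ite_eq' l.primeFactors p fun q ↦ f.factorization q]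
  refine Finset.sum_congr rfl fun q h ↦ ?_
  rw [(hq h).factorization_pow, Finsupp.single_apply]

theorem two_mul_add_two_le {p e : ℕ} (hp : p.Prime) (he : e ≠ 0) (h2 : p = 2 → 2 ≤ e) :
    e + 2 ≤ p * e := by
  rcases hp.two_le.eq_or_lt with rfl | hp3
  · have := h2 rfl
    lia
  · have := Nat.mul_le_mul_right e (show 3 ≤ p from hp3)
    lia

section Main

variable {K Ω : Type*} [Field K] [Field Ω] [Algebra K Ω]

theorem cyc_two_mul_of_odd {m : ℕ} (hm : Odd m) : cyc K Ω (2 * m) = cyc K Ω m := by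
  refine le_antisymm (IntermediateField.adjoin_le_iff.2 fun z hz ↦ ?_)
    (cyc_mono (Dvd.intro_left 2 rfl))
  have h : (z ^ m) ^ 2 = 1 := by rw [← pow_mul, mul_comm]; exact hz
  rcases eq_or_eq_neg_of_sq_eq_sq (z ^ m) 1 (by rw [h, one_pow]) with h | h
  · exact mem_cyc h
  · rw [← neg_neg z]
    exact neg_mem (mem_cyc (by rw [hm.neg_pow, h, neg_neg]))

variable [CharZero K] [CharZero Ω] {f f' : ℕ}

theorem four_dvd_or_odd (hf0 : f ≠ 0)
    (hf : (maxAb K).map (IsScalarTower.toAlgHom ℚ K Ω) ≤ cyc ℚ Ω f)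
    (hmin : ∀ d, d ≠ 0 → (maxAb K).map (IsScalarTower.toAlgHom ℚ K Ω) ≤ cyc ℚ Ω d → f ≤ d) :
    4 ∣ f ∨ Odd f := by
  rcases Nat.even_or_odd' f with ⟨m, rfl | rfl⟩
  · rcases Nat.even_or_odd m with hm | hm
    · obtain ⟨c, rfl⟩ := even_iff_two_dvd.1 hm
      exact .inl ⟨c, by ring⟩
    · rw [cyc_two_mul_of_odd hm] at hf
      have := hmin m (by lia) hf
      lia
  · exact .inr ⟨m, rfl⟩

theorem two_dvd_numRootsOfUnity (h : (-1 : K) ^ numRootsOfUnity K = 1) :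
    2 ∣ numRootsOfUnity K :=
  even_iff_two_dvd.1 ((neg_one_pow_eq_one_iff_even (by norm_num)).1 h)

variable [IsAlgClosed Ω] [Algebra.IsAlgebraic K Ω]

/-- The local bounds on the Chevalley–Bass number, phrased through the valuations of `f'`. -/
theorem chevalleyBass_bounds (hf0 : f ≠ 0)
    (hf : (maxAb K).map (IsScalarTower.toAlgHom ℚ K Ω) ≤ cyc ℚ Ω f)
    (hmin : ∀ d, d ≠ 0 → (maxAb K).map (IsScalarTower.toAlgHom ℚ K Ω) ≤ cyc ℚ Ω d → f ≤ d)
    (hf'0 : f' ≠ 0)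
    (hndvd : ∀ p, p.Prime → ¬ p ∣ numRootsOfUnity K → f'.factorization p = 0)
    (hdvd : ∀ p, p.Prime → p ∣ numRootsOfUnity K → f.factorization p ≤ f'.factorization p ∧
      f'.factorization p + 2 ≤ p * f'.factorization p ∧
      (f'.factorization p = f.factorization p ∨ p = 2 ∧ f'.factorization p = 2)) :
    Nat.lcm 4 (Nat.lcm (numRootsOfUnity K) (f' / numRootsOfUnity K)) ∣ chevalleyBass K Ω ∧
      chevalleyBass K Ω ∣ f' := by
  obtain ⟨ζ, hl0, hζ, hroots⟩ := exists_isPrimitiveRoot_numRootsOfUnity Ω hf0 hf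
  set l := numRootsOfUnity K
  have hord {p : ℕ} : IsPrimitiveRoot (ζ ^ (l / p ^ l.factorization p)) (p ^ l.factorization p) :=
    hζ.pow (Nat.pos_of_ne_zero hl0) (Nat.div_mul_cancel (Nat.ordProj_dvd l p)).symm
  have hne {p : ℕ} (hp : p.Prime) (hpl : p ∣ l) : f'.factorization p ≠ 0 := by
    intro h
    have := (hdvd p hp hpl).2.1
    simp [h] at this
  have hmem : f' ∈ cbSet K Ω := by
    refine mem_cbSet_iff.2 ⟨hf'0, fun p hp ↦ ?_⟩
    by_cases hpl : p ∣ l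
    · obtain ⟨h1, h2, -⟩ := hdvd p hp hpl
      exact isLocalCB_of_gal hp h2 fun a M hM ↦ exists_gal_pow_one_add_prime_pow hp hf0 hf h1
        (coprime_one_add_prime_pow hp (.inl (hne hp hpl))) hM
    · rw [hndvd p hp hpl]
      exact isLocalCB_zero hp fun z hz ↦ eq_one_of_pow_eq_one_of_coprime
        ((Nat.Prime.coprime_iff_not_dvd hp).2 hpl) hz (hroots z p hp.ne_zero hz)
  refine ⟨?_, chevalleyBass_dvd hmem⟩
  have hΛmem : chevalleyBass K Ω ∈ cbSet K Ω := Nat.sInf_mem ⟨f', hmem⟩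
  obtain ⟨hΛ0, hΛ⟩ := mem_cbSet_iff.1 hΛmem
  set Λ := chevalleyBass K Ω
  have hlΛ (p : ℕ) (hp : p.Prime) : l.factorization p ≤ Λ.factorization p :=
    le_of_isLocalCB hp hf0 hf (hΛ p hp) hord
  have h2Λ : 2 ≤ Λ.factorization 2 := two_le_of_isLocalCB hf0 hf (hΛ 2 Nat.prime_two)
  have hpos {p : ℕ} (hp : p.Prime) (hpl : p ∣ l) : l.factorization p ≠ 0 :=
    (hp.factorization_pos_of_dvd hl0 hpl).ne'
  have hlf' : l ∣ f' := by
    refine (Nat.factorization_prime_le_iff_dvd hl0 hf'0).1 fun p hp ↦ ?_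
    by_cases hpl : p ∣ l
    · exact factorization_le_of_isPrimitiveRoot hp hf0 hf (hdvd p hp hpl).1
        (coprime_one_add_prime_pow hp (.inl (hne hp hpl))) hl0 hζ
    · rw [Nat.factorization_eq_zero_of_not_dvd hpl]
      exact Nat.zero_le _
  refine Nat.lcm_dvd ?_ (Nat.lcm_dvd ((Nat.factorization_prime_le_iff_dvd hl0 hΛ0).1 hlΛ) ?_)
  · exact (Nat.prime_two.pow_dvd_iff_le_factorization hΛ0).2 h2Λ
  · have hdiv0 : f' / l ≠ 0 := (Nat.div_pos (Nat.le_of_dvd (Nat.pos_of_ne_zero hf'0) hlf')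
      (Nat.pos_of_ne_zero hl0)).ne'
    refine (Nat.factorization_prime_le_iff_dvd hdiv0 hΛ0).1 fun p hp ↦ ?_
    rw [Nat.factorization_div hlf', Finsupp.tsub_apply, Nat.sub_le_iff_le_add, add_comm]
    by_cases hpl : p ∣ l
    · have hk := hpos hp hpl
      obtain ⟨-, -, h | ⟨rfl, h⟩⟩ := hdvd p hp hpl
      · have hpf : p ∣ f := Nat.dvd_of_factorization_pos (h ▸ hne hp hpl)
        rw [h]
        refine le_add_of_isLocalCB hp hf (fun hle ↦ ?_)
          (Nat.ordProj_mul_ordCompl_eq_self f p).symm (Nat.not_dvd_ordCompl hp hf0)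
          (two_mul_add_two_le hp ?_ ?_) (hΛ p hp) hk hord fun z hz ↦ ?_
        · have hlt := Nat.div_lt_self (Nat.pos_of_ne_zero hf0) hp.one_lt
          refine hlt.not_ge (hmin _ (Nat.div_pos ?_ hp.pos).ne' hle)
          exact Nat.le_of_dvd (Nat.pos_of_ne_zero hf0) hpf
        · exact (Nat.pos_of_ne_zero hk |>.trans_le (hlΛ p hp)).ne'
        · rintro rfl
          exact h2Λ
        · have h1 := hz.dvd_of_pow_eq_one _
            (hroots z _ (pow_ne_zero _ hp.ne_zero) hz.pow_eq_one)
          have := (hp.pow_dvd_iff_le_factorization hl0).1 h1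
          lia
      · lia
    · rw [hndvd p hp hpl]
      exact Nat.zero_le _

end Main

/-- Let `K` be a field of characteristic 0 with finite maximal abelian subextension of
conductor `f`, let `λ` be the number of roots of unity in `K`, and define
`f' := Π_{p | λ} p^{v_p(f)}` if `4 | f`, and `f' := 4·Π_{p | λ} p^{v_p(f)}` if `f` is odd.
Then the Chevalley–Bass number `Λ` of `K` satisfies `lcm(4, λ, f'/λ) | Λ` and `Λ | f'`. -/
theorem stmt_15 (K Ω : Type*) [Field K] [CharZero K] [Field Ω] [Algebra K Ω]
    [IsAlgClosed Ω] [Algebra.IsAlgebraic K Ω] [Algebra ℚ Ω] [IsScalarTower ℚ K Ω]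
    (hfin : FiniteDimensional ℚ ↥(maxAb K))
    (f l f' : ℕ) (hf : f = conductorAb K Ω) (hl : l = numRootsOfUnity K)
    (hf4 : 4 ∣ f → f' = ∏ p ∈ l.primeFactors, p ^ (f.factorization p))
    (hfodd : Odd f → f' = 4 * ∏ p ∈ l.primeFactors, p ^ (f.factorization p)) :
    Nat.lcm 4 (Nat.lcm l (f' / l)) ∣ chevalleyBass K Ω ∧ chevalleyBass K Ω ∣ f' := by
  rename_i _ instΩ _
  have : CharZero Ω := charZero_of_injective_algebraMap (algebraMap K Ω).injective
  obtain rfl : instΩ = DivisionRing.toRatAlgebra := Subsingleton.elim _ _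
  obtain ⟨hf0, hfle⟩ : 0 < f ∧ (maxAb K).map (IsScalarTower.toAlgHom ℚ K Ω) ≤ cyc ℚ Ω f :=
    hf ▸ Nat.sInf_mem (conductorAb_set_nonempty hfin)
  have hmin (d : ℕ) (hd : d ≠ 0)
      (h : (maxAb K).map (IsScalarTower.toAlgHom ℚ K Ω) ≤ cyc ℚ Ω d) : f ≤ d :=
    hf ▸ Nat.sInf_le ⟨Nat.pos_of_ne_zero hd, h⟩
  replace hf0 := hf0.ne'
  obtain ⟨ζ, hl0, hζ, hroots⟩ := exists_isPrimitiveRoot_numRootsOfUnity Ω hf0 hfle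
  have h2l := two_dvd_numRootsOfUnity (hroots (-1) 2 two_ne_zero (by norm_num))
  subst hl
  set l := numRootsOfUnity K with hl
  set P := ∏ p ∈ l.primeFactors, p ^ f.factorization p with hP
  have hP0 : P ≠ 0 := Finset.prod_ne_zero_iff.2 fun p hp ↦
    pow_ne_zero _ (Nat.prime_of_mem_primeFactors hp).ne_zero
  have hPf (p : ℕ) : P.factorization p = if p ∈ l.primeFactors then f.factorization p else 0 :=
    Nat.factorization_prod_primeFactors_pow l f p
  have h4 (p : ℕ) (hp : p.Prime) : Nat.factorization 4 p = if p = 2 then 2 else 0 := by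
    rw [show 4 = 2 ^ 2 by rfl, Nat.prime_two.factorization_pow, Finsupp.single_apply]
    simp only [eq_comm]
  have hodd {p : ℕ} (hp : p.Prime) (hpl : p ∣ l) (hp2 : p ≠ 2) : f.factorization p ≠ 0 := by
    refine Nat.one_le_iff_ne_zero.1 (le_of_isPrimitiveRoot_prime_pow (k := 1) hp hf0 hfle le_rfl
      (coprime_one_add_prime_pow hp (.inr hp2))
      (hζ.pow (Nat.pos_of_ne_zero hl0) (b := p ^ 1) (a := l / p) ?_))
    rw [pow_one, Nat.div_mul_cancel hpl]
  have hmemP {p : ℕ} (hp : p.Prime) : p ∈ l.primeFactors ↔ p ∣ l := by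
    rw [Nat.mem_primeFactors]
    tauto
  rcases four_dvd_or_odd hf0 hfle hmin with h | h
  · obtain rfl := hf4 h
    refine chevalleyBass_bounds hf0 hfle hmin hP0 (fun p hp hpl ↦ ?_) fun p hp hpl ↦ ?_
    · rw [hPf, if_neg (by rwa [hmemP hp])]
    · rw [hPf, if_pos (by rwa [hmemP hp])]
      have h2 : p = 2 → 2 ≤ f.factorization p := by
        rintro rfl
        exact (Nat.prime_two.pow_dvd_iff_le_factorization hf0).1 h
      refine ⟨le_rfl, two_mul_add_two_le hp ?_ h2, .inl rfl⟩
      by_cases hp2 : p = 2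
      · have := h2 hp2
        lia
      · exact hodd hp hpl hp2
  · have hf' : ∀ p, p.Prime → f'.factorization p = (if p = 2 then 2 else 0) +
        if p ∣ l then f.factorization p else 0 := fun p hp ↦ by
      rw [hfodd h, Nat.factorization_mul (by norm_num) hP0, Finsupp.add_apply, h4 p hp, hPf]
      simp only [hmemP hp]
    have hf2 : f.factorization 2 = 0 :=
      Nat.factorization_eq_zero_of_not_dvd (Nat.two_dvd_ne_zero.2 (Nat.odd_iff.1 h))
    refine chevalleyBass_bounds hf0 hfle hmin (by rw [hfodd h]; positivity)
      (fun p hp hpl ↦ ?_) fun p hp hpl ↦ ?_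
    · rw [hf' p hp, if_neg hpl, if_neg (by rintro rfl; exact hpl h2l)]
    · rw [hf' p hp, if_pos hpl]
      by_cases hp2 : p = 2
      · subst hp2
        simp [hf2]
      · rw [if_neg hp2, zero_add]
        exact ⟨le_rfl, two_mul_add_two_le hp (hodd hp hpl hp2) fun h ↦ absurd h hp2, .inl rfl⟩
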